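/- arXiv:2010.13256 — 4 statements merged into one kernel-verified Lean document; each statement's English description precedes it below -/
import Mathlib

section
/- For every nonnegative integer n, the number p_n of distinct parabolic double cosets in S_n satisfies p_n = (1/n!) · Σ_{m=0}^{n} c(n,m) · Σ_{c=0}^{⌊m/2⌋} Σ_{t=2c}^{m} C(m,t) · ( Σ_{k=c}^{t-c} (-1)^k (c+k)! · S2(t, c+k) · C(k-1, k-c) ) · ( Σ_{j=0}^{c} f_{m-t+c,j} · f_{m-t+c,c-j} / (j!·(c-j)!) ), where the equality is an equality of rational numbers. -/
/-- The set of simple (adjacent) transpositions `s_i = (i, i+1)` in `S_n`. -/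
def simples (n : ℕ) : Set (Equiv.Perm (Fin n)) :=
  { σ | ∃ (i : ℕ) (h : i + 1 < n), σ = Equiv.swap ⟨i, Nat.lt_of_succ_lt h⟩ ⟨i + 1, h⟩ }

/-- The parabolic double coset `W_I w W_J` as a set of permutations. -/
def doubleCoset {n : ℕ} (I : Set (Equiv.Perm (Fin n))) (w : Equiv.Perm (Fin n))
    (J : Set (Equiv.Perm (Fin n))) : Set (Equiv.Perm (Fin n)) :=
  { u | ∃ x ∈ Subgroup.closure I, ∃ y ∈ Subgroup.closure J, u = x * w * y }

/-- `pdcCount n` is the number of distinct parabolic double cosets in `S_n`. -/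
noncomputable def pdcCount (n : ℕ) : ℕ :=
  Nat.card {C : Set (Equiv.Perm (Fin n)) //
    ∃ I ⊆ simples n, ∃ J ⊆ simples n, ∃ w : Equiv.Perm (Fin n), C = doubleCoset I w J}

/-- Stirling numbers of the second kind. -/
def S2 : ℕ → ℕ → ℕ
  | 0, 0 => 1
  | 0, _ + 1 => 0
  | _ + 1, 0 => 0
  | n + 1, k + 1 => (k + 1) * S2 n (k + 1) + S2 n k

/-- Unsigned Stirling numbers of the first kind. -/
def c1 : ℕ → ℕ → ℕ
  | 0, 0 => 1
  | 0, _ + 1 => 0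
  | _ + 1, 0 => 0
  | n + 1, k + 1 => n * c1 n (k + 1) + c1 n k

/-- Generalized Fubini numbers: `f_{n,k} = ∑_{l=k}^n l! · S2(n-k, l-k)`. -/
def genFubini (n k : ℕ) : ℕ :=
  ∑ l ∈ Finset.Icc k n, Nat.factorial l * S2 (n - k) (l - k)

namespace ParabolicCount

open Equiv Finset

/-- The multiset of pairs of labels attached to a permutation by a row labelling `r` of its values
and a column labelling `c` of its arguments: the contingency table of the permutation. -/
def table {n : ℕ} {α β : Type*} (r : Fin n → α) (c : Fin n → β) (u : Perm (Fin n)) :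
    Multiset (α × β) :=
  univ.val.map fun x => (r (u x), c x)

/-- The simple transpositions preserving a labelling. -/
def stabSimples {n : ℕ} {α : Type*} (r : Fin n → α) : Set (Perm (Fin n)) :=
  {s | s ∈ simples n ∧ ∀ x, r (s x) = r x}

theorem map_univ_val_eq_iff {ι γ : Type*} [Fintype ι] (f g : ι → γ) :
    (univ.val.map f = univ.val.map g) ↔ ∃ σ : Perm ι, ∀ x, f x = g (σ x) := by
  classical
  constructor
  · intro h
    have hcard : ∀ b, Nonempty ({x // f x = b} ≃ {x // g x = b}) := by
      intro b
      refine Fintype.card_eq.mp ?_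
      have hb := congrArg (Multiset.count b) h
      simp only [Multiset.count_map] at hb
      rw [Fintype.card_subtype, Fintype.card_subtype]
      simpa [Finset.card_def, eq_comm] using hb
    let e := fun b => (hcard b).some
    refine ⟨((Equiv.sigmaFiberEquiv f).symm.trans (Equiv.sigmaCongrRight e)).trans
      (Equiv.sigmaFiberEquiv g), fun x => ?_⟩
    exact ((e (f x) ⟨x, rfl⟩).2).symm
  · rintro ⟨σ, h⟩
    have : f = g ∘ σ := funext h
    rw [this, ← Multiset.map_map]
    congr 1
    exact congrArg Finset.val (Finset.map_univ_equiv σ)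

theorem isSwap_of_mem_simples {n : ℕ} {s : Perm (Fin n)} (hs : s ∈ simples n) : s.IsSwap := by
  obtain ⟨i, h, rfl⟩ := hs
  exact ⟨_, _, by simp, rfl⟩

theorem mem_closure_stabSimples {n : ℕ} {α : Type*} [PartialOrder α] {r : Fin n → α}
    (hr : Monotone r) (σ : Perm (Fin n)) :
    σ ∈ Subgroup.closure (stabSimples r) ↔ ∀ x, r (σ x) = r x := by
  constructor
  · intro h
    induction h using Subgroup.closure_induction with
    | mem s hs => exact hs.2
    | one => simp
    | mul a b _ _ ha hb => intro x; rw [Perm.mul_apply, ha, hb]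
    | inv a _ ha => intro x; simpa using (ha (a⁻¹ x)).symm
  · intro h
    rw [mem_closure_isSwap fun f hf => isSwap_of_mem_simples hf.1]
    refine ⟨Set.toFinite _, fun x => ?_⟩
    have key : ∀ (d i : ℕ) (hi : i + d < n), r ⟨i, by omega⟩ = r ⟨i + d, hi⟩ →
        (⟨i + d, hi⟩ : Fin n) ∈
          MulAction.orbit (Subgroup.closure (stabSimples r)) (⟨i, by omega⟩ : Fin n) := by
      intro d
      induction d with
      | zero => intro i hi _; exact MulAction.mem_orbit_self _
      | succ d ih =>
        intro i hi he
        have h1 : r ⟨i, by omega⟩ ≤ r ⟨i + d, by omega⟩ := hr (by simp)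
        have h2 : r ⟨i + d, by omega⟩ ≤ r ⟨i + (d + 1), hi⟩ := hr (by simp)
        have h3 : r ⟨i, by omega⟩ = r ⟨i + d, by omega⟩ := le_antisymm h1 (he ▸ h2)
        have h4 := ih i (by omega) h3
        rw [← MulAction.orbit_eq_iff.mpr h4]
        have hs : swap (⟨i + d, by omega⟩ : Fin n) ⟨i + (d + 1), hi⟩ ∈ stabSimples r := by
          refine ⟨⟨i + d, hi, rfl⟩, fun y => ?_⟩
          rw [swap_apply_def]
          split_ifs with hy hy
          · rw [hy, ← h3, he]
          · rw [hy, ← h3, he]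
          · rfl
        exact ⟨⟨_, Subgroup.subset_closure hs⟩, swap_apply_left _ _⟩
    rcases le_total x (σ x) with hx | hx
    · obtain ⟨d, hd⟩ := Nat.exists_eq_add_of_le (Fin.le_def.mp hx)
      have e : σ x = ⟨x.1 + d, hd ▸ (σ x).2⟩ := Fin.ext hd
      rw [e]
      exact key d x.1 _ (by rw [← e]; exact (h x).symm)
    · obtain ⟨d, hd⟩ := Nat.exists_eq_add_of_le (Fin.le_def.mp hx)
      have e : x = ⟨(σ x).1 + d, hd ▸ x.2⟩ := Fin.ext hd
      have := key d (σ x).1 (hd ▸ x.2) (by rw [← e]; exact h x)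
      rw [← e] at this
      exact (MulAction.orbit_eq_iff.mpr this) ▸ MulAction.mem_orbit_self _

theorem mem_doubleCoset_stabSimples {n : ℕ} {α β : Type*} [PartialOrder α] [PartialOrder β]
    {r : Fin n → α} {c : Fin n → β} (hr : Monotone r) (hc : Monotone c) (w u : Perm (Fin n)) :
    u ∈ doubleCoset (stabSimples r) w (stabSimples c) ↔ table r c u = table r c w := by
  unfold table
  rw [map_univ_val_eq_iff]
  constructor
  · rintro ⟨x, hx, y, hy, rfl⟩
    rw [mem_closure_stabSimples hr] at hx
    rw [mem_closure_stabSimples hc] at hy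
    exact ⟨y, fun i => by simp [hx, hy]⟩
  · rintro ⟨σ, h⟩
    simp only [Prod.mk.injEq] at h
    refine ⟨u * σ⁻¹ * w⁻¹, ?_, σ, ?_, by group⟩
    · rw [mem_closure_stabSimples hr]
      intro x
      have := (h (σ⁻¹ (w⁻¹ x))).1
      simpa using this
    · rw [mem_closure_stabSimples hc]
      exact fun x => ((h x).2).symm

theorem table_inv {n : ℕ} {α β : Type*} (r : Fin n → α) (c : Fin n → β) (u : Perm (Fin n)) :
    table c r u⁻¹ = (table r c u).map Prod.swap := by
  unfold table
  rw [Multiset.map_map, map_univ_val_eq_iff]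
  exact ⟨u⁻¹, fun x => by simp⟩

theorem exists_table_eq {n k l : ℕ} (s : Multiset (Fin k × Fin l)) (hs : s.card = n) :
    ∃ (r : Fin n → Fin k) (c : Fin n → Fin l) (u : Perm (Fin n)),
      Monotone r ∧ Monotone c ∧ table r c u = s := by
  obtain ⟨f, hf⟩ : ∃ f : Fin n → Fin k × Fin l, univ.val.map f = s := by
    induction s using Quotient.inductionOn with
    | h L =>
      subst hs
      refine ⟨L.get, ?_⟩
      change Multiset.map L.get (Multiset.ofList (List.finRange L.length)) = _
      rw [Multiset.map_coe, List.map_get_finRange]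
      rfl
  refine ⟨fun x => (f (Tuple.sort (Prod.fst ∘ f) x)).1,
    fun x => (f (Tuple.sort (Prod.snd ∘ f) x)).2,
    (Tuple.sort (Prod.fst ∘ f))⁻¹ * Tuple.sort (Prod.snd ∘ f),
    Tuple.monotone_sort (Prod.fst ∘ f), Tuple.monotone_sort (Prod.snd ∘ f), ?_⟩
  unfold table
  rw [← hf, map_univ_val_eq_iff]
  exact ⟨Tuple.sort (Prod.snd ∘ f), fun x => by simp⟩

/-- The simple transposition `(i, i+1)`. -/
abbrev simpleSwap {n : ℕ} (i : ℕ) (h : i + 1 < n) : Perm (Fin n) :=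
  swap ⟨i, Nat.lt_of_succ_lt h⟩ ⟨i + 1, h⟩

theorem apply_swap_of_eq {ι α : Type*} [DecidableEq ι] {r : ι → α} {x y : ι} (h : r x = r y)
    (z : ι) : r (swap x y z) = r z := by
  rw [swap_apply_def]
  split_ifs with hz hz <;> simp [hz, h]

theorem simpleSwap_mem_stabSimples {n : ℕ} {α : Type*} {r : Fin n → α} {i : ℕ} (h : i + 1 < n) :
    simpleSwap i h ∈ stabSimples r ↔ r ⟨i, Nat.lt_of_succ_lt h⟩ = r ⟨i + 1, h⟩ := by
  constructor
  · intro hs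
    have := hs.2 ⟨i + 1, h⟩
    rwa [swap_apply_right] at this
  · exact fun he => ⟨⟨i, h, rfl⟩, apply_swap_of_eq he⟩

theorem ext_simples {n : ℕ} {I J : Set (Perm (Fin n))} (hI : I ⊆ simples n) (hJ : J ⊆ simples n)
    (h : ∀ (i : ℕ) (hi : i + 1 < n), simpleSwap i hi ∈ I ↔ simpleSwap i hi ∈ J) : I = J := by
  ext s
  constructor
  · intro hs
    obtain ⟨i, hi, rfl⟩ := hI hs
    exact (h i hi).1 hs
  · intro hs
    obtain ⟨i, hi, rfl⟩ := hJ hs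
    exact (h i hi).2 hs

open Classical in
/-- The number of simple transpositions `(i, i+1)` outside `I` with `i < x`. -/
noncomputable def cutCount {n : ℕ} (I : Set (Perm (Fin n))) (x : ℕ) : ℕ :=
  #{i ∈ range x | ∃ h : i + 1 < n, simpleSwap i h ∉ I}

open Classical in
theorem cutCount_succ {n : ℕ} (I : Set (Perm (Fin n))) (x : ℕ) (h : x + 1 < n) :
    cutCount I (x + 1) = cutCount I x + if simpleSwap x h ∈ I then 0 else 1 := by
  unfold cutCount
  rw [range_add_one, filter_insert]
  by_cases hx : simpleSwap x h ∈ I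
  · rw [if_neg (by push Not; exact fun _ => hx), if_pos hx, add_zero]
  · rw [if_pos ⟨h, hx⟩, if_neg hx, card_insert_of_notMem (by simp)]

theorem exists_succ_label {n k : ℕ} {r : Fin n → Fin k} (hr : Monotone r)
    (hs : Function.Surjective r) {a a' : Fin k} (haa : a'.val = a.val + 1) :
    ∃ (i : ℕ) (h : i + 1 < n), r ⟨i, Nat.lt_of_succ_lt h⟩ = a ∧ r ⟨i + 1, h⟩ = a' := by
  obtain ⟨x, hx⟩ := hs a
  have hex : ∃ y : ℕ, ∃ h : y < n, a' ≤ r ⟨y, h⟩ := by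
    obtain ⟨y, hy⟩ := hs a'
    exact ⟨y.1, y.2, hy.ge⟩
  classical
  obtain ⟨hy, hya⟩ := Nat.find_spec hex
  have hmin := fun m hm => Nat.find_min hex (m := m) hm
  generalize Nat.find hex = y at *
  have hxy : x.1 < y := by
    by_contra hcon
    have h1 : r ⟨y, hy⟩ ≤ r x := hr (Fin.le_def.mpr (by simpa using hcon))
    have := hya.trans h1
    rw [hx, Fin.le_def] at this
    omega
  obtain ⟨i, rfl⟩ : ∃ i, y = i + 1 := ⟨y - 1, by omega⟩
  have h2 : r ⟨i, by omega⟩ < a' := by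
    by_contra hcon
    exact hmin i (by omega) ⟨by omega, not_lt.mp hcon⟩
  have h3 : a ≤ r ⟨i, by omega⟩ := hx ▸ hr (Fin.le_def.mpr (by simp; omega))
  have h4 : r ⟨i, by omega⟩ = a := by
    rw [Fin.lt_def] at h2
    rw [Fin.le_def] at h3
    exact Fin.ext (by omega)
  refine ⟨i, hy, h4, le_antisymm ?_ hya⟩
  by_contra hcon
  obtain ⟨z, hz⟩ := hs a'
  rcases Nat.lt_or_ge i z.1 with h5 | h5
  · exact hcon (hz ▸ hr (Fin.le_def.mpr (by simpa using h5)))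
  · have h6 : r z ≤ r ⟨i, by omega⟩ := hr (Fin.le_def.mpr (by simpa using h5))
    rw [hz, h4, Fin.le_def] at h6
    omega

theorem val_eq_cutCount {n k : ℕ} {r : Fin n → Fin k} (hr : Monotone r)
    (hs : Function.Surjective r) (x : ℕ) (hx : x < n) :
    (r ⟨x, hx⟩).val = cutCount (stabSimples r) x := by
  classical
  induction x with
  | zero =>
    have hk : 0 < k := Nat.lt_of_le_of_lt (Nat.zero_le _) (r ⟨0, hx⟩).2
    obtain ⟨y, hy⟩ := hs ⟨0, hk⟩
    have h1 : r ⟨0, hx⟩ ≤ r y := hr (Fin.le_def.mpr (Nat.zero_le _))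
    rw [hy, Fin.le_def] at h1
    have h2 : cutCount (stabSimples r) 0 = 0 := by simp [cutCount]
    rw [h2]
    simpa using h1
  | succ x ih =>
    rw [cutCount_succ _ _ hx, ← ih (by omega)]
    simp only [simpleSwap_mem_stabSimples]
    split_ifs with he
    · rw [he, add_zero]
    · have h1 : r ⟨x, by omega⟩ ≤ r ⟨x + 1, hx⟩ := hr (Fin.le_def.mpr (by simp))
      have h2 : r ⟨x, by omega⟩ < r ⟨x + 1, hx⟩ := lt_of_le_of_ne h1 he
      have h3 : (r ⟨x, by omega⟩).val + 1 < k := by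
        have := (r ⟨x + 1, hx⟩).2
        rw [Fin.lt_def] at h2
        omega
      obtain ⟨i, hi, hi1, hi2⟩ := exists_succ_label hr hs
        (a := r ⟨x, by omega⟩) (a' := ⟨(r ⟨x, by omega⟩).val + 1, h3⟩) rfl
      have h4 : i = x := by
        rcases lt_trichotomy i x with h | h | h
        · have : r ⟨i + 1, hi⟩ ≤ r ⟨x, by omega⟩ := hr (Fin.le_def.mpr h)
          rw [hi2, Fin.le_def] at this
          simp at this
        · exact h
        · have : r ⟨x + 1, hx⟩ ≤ r ⟨i, by omega⟩ := hr (Fin.le_def.mpr h)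
          rw [hi1] at this
          exact absurd h2 (not_lt.mpr this)
      subst h4
      rw [hi2]

theorem eq_of_stabSimples_eq {n k k' : ℕ} {r : Fin n → Fin k} {r' : Fin n → Fin k'}
    (hr : Monotone r) (hs : Function.Surjective r) (hr' : Monotone r')
    (hs' : Function.Surjective r') (h : stabSimples r = stabSimples r') :
    k = k' ∧ ∀ x, (r x).val = (r' x).val := by
  have hval : ∀ x, (r x).val = (r' x).val := fun x => by
    rw [val_eq_cutCount hr hs x.1 x.2, val_eq_cutCount hr' hs' x.1 x.2, h]
  refine ⟨?_, hval⟩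
  refine le_antisymm ?_ ?_
  · by_contra hcon
    obtain ⟨x, hx⟩ := hs ⟨k', by omega⟩
    have := hval x
    rw [hx] at this
    have h2 := (r' x).2
    simp at this
    omega
  · by_contra hcon
    obtain ⟨x, hx⟩ := hs' ⟨k, by omega⟩
    have := hval x
    rw [hx] at this
    have h2 := (r x).2
    simp at this
    omega

theorem exists_label_of_subset_simples {n : ℕ} {I : Set (Perm (Fin n))} (hI : I ⊆ simples n) :
    ∃ (k : ℕ) (r : Fin n → Fin k), k ≤ n ∧ Monotone r ∧ Function.Surjective r ∧
      stabSimples r = I := by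
  classical
  let f : Fin n → ℕ := fun x => cutCount I x.1
  have hf : Monotone f := fun x y hxy =>
    card_le_card (filter_subset_filter _ (range_subset_range.mpr hxy))
  let e := (univ.image f).orderIsoOfFin rfl
  let r : Fin n → Fin (#(univ.image f)) := fun x => e.symm ⟨f x, mem_image_of_mem f (mem_univ x)⟩
  have hreq : ∀ x y, r x = r y ↔ f x = f y := by
    intro x y
    simp [r]
  refine ⟨_, r, ?_, ?_, ?_, ?_⟩
  · simpa using card_image_le (s := univ) (f := f)
  · intro x y hxy
    exact e.symm.monotone (hf hxy)
  · intro a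
    obtain ⟨x, -, hx⟩ := mem_image.mp (e a).2
    refine ⟨x, ?_⟩
    simp [r, hx]
  · refine ext_simples (fun s hs => hs.1) hI fun i hi => ?_
    rw [simpleSwap_mem_stabSimples, hreq]
    change cutCount I i = cutCount I (i + 1) ↔ _
    rw [cutCount_succ I i hi]
    split_ifs with h <;> simp [h]

theorem table_simpleSwap_mul_iff {n : ℕ} {α β : Type*} {r : Fin n → α} {c : Fin n → β}
    (u : Perm (Fin n)) {i : ℕ} (h : i + 1 < n)
    (hne : r ⟨i, Nat.lt_of_succ_lt h⟩ ≠ r ⟨i + 1, h⟩) :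
    (∀ v, table r c v = table r c u → table r c (simpleSwap i h * v) = table r c u) ↔
      ∃ b, ∀ z ∈ table r c u,
        z.1 = r ⟨i, Nat.lt_of_succ_lt h⟩ ∨ z.1 = r ⟨i + 1, h⟩ → z.2 = b := by
  classical
  set p : Fin n := ⟨i, Nat.lt_of_succ_lt h⟩ with hp
  set q : Fin n := ⟨i + 1, h⟩ with hq
  constructor
  · contrapose!
    intro hb
    obtain ⟨x, y, hx, hy, hxy⟩ : ∃ x y, r (u x) = r p ∧ r (u y) = r q ∧ c x ≠ c y := by
      by_cases hc : c (u⁻¹ p) = c (u⁻¹ q)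
      · obtain ⟨z, hz, hz1, hz2⟩ := hb (c (u⁻¹ p))
        obtain ⟨t, -, rfl⟩ := Multiset.mem_map.mp hz
        rcases hz1 with hz1 | hz1
        · exact ⟨t, u⁻¹ q, hz1, by simp, fun h => hz2 (h.trans hc.symm)⟩
        · exact ⟨u⁻¹ p, t, by simp, hz1, fun h => hz2 h.symm⟩
      · exact ⟨u⁻¹ p, u⁻¹ q, by simp, by simp, hc⟩
    have hpq : p ≠ q := fun e => hne (congrArg r e)
    have huxq : u x ≠ q := fun e => hne (by rw [← hx, e])
    have huyp : u y ≠ p := fun e => hne (by rw [← hy, e])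
    have huxy : u x ≠ u y := fun e => hne (by rw [← hx, ← hy, e])
    have hux : swap (u x) p (swap (u y) q (u x)) = p := by
      rw [swap_apply_of_ne_of_ne huxy huxq, swap_apply_left]
    have huy : swap (u x) p (swap (u y) q (u y)) = q := by
      rw [swap_apply_left, swap_apply_of_ne_of_ne huxq.symm hpq.symm]
    have hv : ∀ t, r (swap (u x) p (swap (u y) q (u t))) = r (u t) := fun t => by
      rw [apply_swap_of_eq hx, apply_swap_of_eq hy]
    set v : Perm (Fin n) := swap (u x) p * (swap (u y) q * u) with hvdef
    have hvt : table r c v = table r c u := by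
      unfold table
      simp only [hvdef, Perm.mul_apply, hv]
    refine ⟨v, hvt, fun heq => ?_⟩
    rw [← hvt] at heq
    have hcount := congrArg (Multiset.count (r p, c x)) heq
    unfold table at hcount
    rw [Multiset.count_map, Multiset.count_map] at hcount
    refine absurd hcount (ne_of_lt ?_)
    change #{t | (r p, c x) = (r ((simpleSwap i h * v) t), c t)} <
      #{t | (r p, c x) = (r (v t), c t)}
    have hvx : v x = p := hux
    have hvy : v y = q := huy
    apply card_lt_card
    rw [ssubset_iff_of_subset]
    · refine ⟨x, by simp [hvx], ?_⟩
      simp only [mem_filter, mem_univ, true_and, Perm.mul_apply, hvx, Prod.mk.injEq]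
      rw [swap_apply_left]
      exact fun e => hne e.1
    · intro t
      simp only [mem_filter, mem_univ, true_and, Perm.mul_apply, Prod.mk.injEq]
      rintro ⟨h1, h2⟩
      refine ⟨?_, h2⟩
      by_cases e1 : v t = p
      · rw [e1]
      · by_cases e2 : v t = q
        · have : t = y := v.injective (e2.trans hvy.symm)
          exact absurd (this ▸ h2) hxy
        · rwa [swap_apply_of_ne_of_ne e1 e2] at h1
  · rintro ⟨b, hb⟩ v hv
    rw [← hv] at hb ⊢
    have hb' : ∀ t, r (v t) = r p ∨ r (v t) = r q → c t = b := fun t =>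
      hb _ (Multiset.mem_map_of_mem _ (mem_univ t))
    unfold table
    rw [map_univ_val_eq_iff]
    refine ⟨swap (v⁻¹ p) (v⁻¹ q), fun t => ?_⟩
    have h1 : v * swap (v⁻¹ p) (v⁻¹ q) = swap p q * v := by
      rw [mul_swap_eq_swap_mul]; simp
    rw [apply_swap_of_eq (r := c), ← Perm.mul_apply v, h1]
    rw [hb' (v⁻¹ p) (by simp), hb' (v⁻¹ q) (by simp)]

/-- The support of a contingency table without zero rows or columns that cannot be coarsened:
no two adjacent rows are supported on one common column, and no two adjacent columns are
supported on one common row. -/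
def IsReduced {k l : ℕ} (D : Finset (Fin k × Fin l)) : Prop :=
  ((∀ a, ∃ b, (a, b) ∈ D) ∧
    ∀ a a' : Fin k, a'.val = a.val + 1 → ¬ ∃ b, ∀ z ∈ D, z.1 = a ∨ z.1 = a' → z.2 = b) ∧
  ((∀ b, ∃ a, (a, b) ∈ D) ∧
    ∀ b b' : Fin l, b'.val = b.val + 1 → ¬ ∃ a, ∀ z ∈ D, z.2 = b ∨ z.2 = b' → z.1 = a)

/-- The left simple stabilizer of a set of permutations. -/
def leftStab {n : ℕ} (C : Set (Perm (Fin n))) : Set (Perm (Fin n)) :=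
  {s | s ∈ simples n ∧ ∀ v ∈ C, s * v ∈ C}

/-- The row half of `IsReduced` says that the row labelling is that of the left stabilizer. -/
theorem stabSimples_eq_leftStab_iff {n k : ℕ} {β : Type*} {r : Fin n → Fin k} {c : Fin n → β}
    (hr : Monotone r) (hs : Function.Surjective r) (u : Perm (Fin n)) :
    stabSimples r = leftStab {v | table r c v = table r c u} ↔
      ∀ a a' : Fin k, a'.val = a.val + 1 →
        ¬ ∃ b, ∀ z ∈ table r c u, z.1 = a ∨ z.1 = a' → z.2 = b := by
  constructor
  · intro h a a' haa
    obtain ⟨i, hi, rfl, rfl⟩ := exists_succ_label hr hs haa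
    have hne : r ⟨i, Nat.lt_of_succ_lt hi⟩ ≠ r ⟨i + 1, hi⟩ := by
      intro e
      rw [← e] at haa
      omega
    rw [← table_simpleSwap_mul_iff u hi hne]
    intro hst
    have hmem : simpleSwap i hi ∈ stabSimples r := by
      rw [h]
      exact ⟨⟨i, hi, rfl⟩, hst⟩
    exact hne ((simpleSwap_mem_stabSimples hi).1 hmem)
  · intro h
    refine ext_simples (fun s hs => hs.1) (fun s hs => hs.1) fun i hi => ?_
    constructor
    · intro hmem
      refine ⟨hmem.1, fun v hv => ?_⟩
      change table r c (simpleSwap i hi * v) = table r c u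
      rw [← (show table r c v = table r c u from hv)]
      unfold table
      simp only [Perm.mul_apply, hmem.2]
    · rintro ⟨_, hst⟩
      rw [simpleSwap_mem_stabSimples]
      by_contra hne
      have h1 := (table_simpleSwap_mul_iff (c := c) u hi hne).1 hst
      refine h _ _ ?_ h1
      rw [val_eq_cutCount hr hs, val_eq_cutCount hr hs, cutCount_succ _ _ hi, if_neg]
      rwa [simpleSwap_mem_stabSimples]

theorem isReduced_toFinset_iff {n k l : ℕ} {r : Fin n → Fin k} {c : Fin n → Fin l}
    (hr : Monotone r) (hc : Monotone c) (u : Perm (Fin n)) :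
    IsReduced (table r c u).toFinset ↔
      (Function.Surjective r ∧ stabSimples r = leftStab {v | table r c v = table r c u}) ∧
      (Function.Surjective c ∧ stabSimples c = leftStab {v | table r c v⁻¹ = table r c u}) := by
  have hset : {v : Perm (Fin n) | table r c v⁻¹ = table r c u} =
      {v | table c r v = table c r u⁻¹} := by
    ext v
    simp only [Set.mem_ofPred_eq]
    have h1 := table_inv r c v⁻¹
    rw [inv_inv] at h1
    rw [h1, table_inv r c u]
    exact (Multiset.map_injective Prod.swap_injective).eq_iff.symm
  have hrow : (∀ a, ∃ b, (a, b) ∈ (table r c u).toFinset) ↔ Function.Surjective r := by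
    simp only [table, Multiset.mem_toFinset, Multiset.mem_map, Finset.mem_val, mem_univ, true_and,
      Prod.mk.injEq]
    constructor
    · intro h a
      obtain ⟨b, x, hx, -⟩ := h a
      exact ⟨_, hx⟩
    · intro h a
      obtain ⟨x, hx⟩ := h a
      exact ⟨c (u⁻¹ x), u⁻¹ x, by simpa using hx, rfl⟩
  have hcol : (∀ b, ∃ a, (a, b) ∈ (table r c u).toFinset) ↔ Function.Surjective c := by
    simp only [table, Multiset.mem_toFinset, Multiset.mem_map, Finset.mem_val, mem_univ, true_and,
      Prod.mk.injEq]
    constructor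
    · intro h a
      obtain ⟨b, x, -, hx⟩ := h a
      exact ⟨_, hx⟩
    · intro h a
      obtain ⟨x, hx⟩ := h a
      exact ⟨r (u x), x, rfl, hx⟩
  unfold IsReduced
  rw [hrow, hcol, hset]
  refine and_congr (and_congr_right fun hs => ?_) (and_congr_right fun hs => ?_)
  · rw [stabSimples_eq_leftStab_iff hr hs]
    simp only [Multiset.mem_toFinset]
  · rw [stabSimples_eq_leftStab_iff hc hs, table_inv]
    simp only [Multiset.mem_toFinset, Multiset.mem_map, Prod.exists, Prod.forall, Prod.swap_prod_mk,
      Prod.mk.injEq]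
    refine forall_congr' fun b => forall_congr' fun b' => imp_congr_right fun _ => not_congr ?_
    refine exists_congr fun a => ?_
    constructor
    · rintro h x y ⟨p, q, hpq, rfl, rfl⟩ hx
      exact h _ _ hpq hx
    · intro h x y hxy hy
      exact h _ _ ⟨_, _, hxy, rfl, rfl⟩ hy

/-- A parabolic double coset is presented by its full stabilizers. -/
theorem doubleCoset_eq_leftStab {n : ℕ} {I J : Set (Perm (Fin n))} (hI : I ⊆ simples n)
    (hJ : J ⊆ simples n) (w : Perm (Fin n)) :
    doubleCoset I w J = doubleCoset (leftStab (doubleCoset I w J)) w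
      (leftStab {v | v⁻¹ ∈ doubleCoset I w J}) := by
  set C := doubleCoset I w J with hC
  have hinv : ∀ s ∈ simples n, s⁻¹ = s := by
    rintro s ⟨i, h, rfl⟩
    exact swap_inv _ _
  have hIs : I ⊆ leftStab C := fun s hs => by
    refine ⟨hI hs, ?_⟩
    rintro v ⟨x, hx, y, hy, rfl⟩
    exact ⟨s * x, mul_mem (Subgroup.subset_closure hs) hx, y, hy, by group⟩
  have hJs : J ⊆ leftStab {v | v⁻¹ ∈ C} := fun s hs => by
    refine ⟨hJ hs, ?_⟩
    rintro v ⟨x, hx, y, hy, hv⟩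
    refine ⟨x, hx, y * s, mul_mem hy (Subgroup.subset_closure hs), ?_⟩
    rw [mul_inv_rev, hv, hinv s (hJ hs)]
    group
  have hcl : ∀ (D : Set (Perm (Fin n))), ∀ x ∈ Subgroup.closure (leftStab D), ∀ v,
      v ∈ D ↔ x * v ∈ D := by
    intro D x hx
    induction hx using Subgroup.closure_induction with
    | mem s hs =>
      refine fun v => ⟨hs.2 v, fun h => ?_⟩
      have := hs.2 _ h
      have hss : s * s = 1 := mul_eq_one_iff_eq_inv.mpr (hinv s hs.1).symm
      rwa [← mul_assoc, hss, one_mul] at this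
    | one => simp
    | mul a b _ _ ha hb => intro v; rw [hb v, ha, mul_assoc]
    | inv a _ ha => intro v; rw [ha (a⁻¹ * v), mul_inv_cancel_left]
  have hw : w ∈ C := ⟨1, one_mem _, 1, one_mem _, by simp⟩
  apply Set.Subset.antisymm
  · rintro v ⟨x, hx, y, hy, rfl⟩
    exact ⟨x, Subgroup.closure_mono hIs hx, y, Subgroup.closure_mono hJs hy, rfl⟩
  · rintro v ⟨x, hx, y, hy, rfl⟩
    have h1 : (w * y) ∈ C := by
      have := (hcl {v | v⁻¹ ∈ C} y⁻¹ (inv_mem hy) w⁻¹).1 (by simpa using hw)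
      simpa using this
    rw [mul_assoc]
    exact (hcl C x hx _).1 h1

open Classical in
theorem pdcCount_eq_sum_sym (n : ℕ) :
    pdcCount n = ∑ k ∈ range (n + 1), ∑ l ∈ range (n + 1),
      #{s : Sym (Fin k × Fin l) n | IsReduced (s : Multiset (Fin k × Fin l)).toFinset} := by
  let T := Σ k : Fin (n + 1), Σ l : Fin (n + 1),
    {s : Sym (Fin k × Fin l) n // IsReduced (s : Multiset (Fin k × Fin l)).toFinset}
  have hT : Fintype.card T = ∑ k ∈ range (n + 1), ∑ l ∈ range (n + 1),
      #{s : Sym (Fin k × Fin l) n | IsReduced (s : Multiset (Fin k × Fin l)).toFinset} := by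
    rw [Fintype.card_sigma, ← Fin.sum_univ_eq_sum_range (fun k => ∑ l ∈ range (n + 1),
      #{s : Sym (Fin k × Fin l) n | IsReduced (s : Multiset (Fin k × Fin l)).toFinset})]
    refine sum_congr rfl fun k _ => ?_
    rw [Fintype.card_sigma, ← Fin.sum_univ_eq_sum_range (fun l =>
      #{s : Sym (Fin k × Fin l) n | IsReduced (s : Multiset (Fin k × Fin l)).toFinset})]
    refine sum_congr rfl fun l _ => ?_
    rw [Fintype.card_subtype]
  rw [← hT, pdcCount, ← Nat.card_eq_fintype_card]
  symm
  have hex : ∀ t : T, ∃ (r : Fin n → Fin t.1) (c : Fin n → Fin t.2.1) (u : Perm (Fin n)),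
      Monotone r ∧ Monotone c ∧ table r c u = t.2.2.1.1 := fun t =>
    exists_table_eq t.2.2.1.1 t.2.2.1.2
  choose r c u hr hc hu using hex
  have hred : ∀ t, IsReduced (table (r t) (c t) (u t)).toFinset := fun t => by
    rw [hu t]; exact t.2.2.2
  have hred' := fun t => (isReduced_toFinset_iff (hr t) (hc t) (u t)).1 (hred t)
  let F : T → {C : Set (Perm (Fin n)) //
      ∃ I ⊆ simples n, ∃ J ⊆ simples n, ∃ w : Perm (Fin n), C = doubleCoset I w J} := fun t =>
    ⟨{v | table (r t) (c t) v = table (r t) (c t) (u t)}, stabSimples (r t), fun s hs => hs.1,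
      stabSimples (c t), fun s hs => hs.1, u t, by
        ext v; exact (mem_doubleCoset_stabSimples (hr t) (hc t) _ _).symm⟩
  refine Nat.card_congr (Equiv.ofBijective F ⟨?_, ?_⟩)
  · intro t t' htt
    have hC := congrArg Subtype.val htt
    change {v | table (r t) (c t) v = table (r t) (c t) (u t)} =
      {v | table (r t') (c t') v = table (r t') (c t') (u t')} at hC
    have hC' : {v : Perm (Fin n) | table (r t) (c t) v⁻¹ = table (r t) (c t) (u t)} =
        {v | table (r t') (c t') v⁻¹ = table (r t') (c t') (u t')} := by
      ext v
      exact Set.ext_iff.mp hC v⁻¹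
    obtain ⟨hk, hrr⟩ := eq_of_stabSimples_eq (hr t) (hred' t).1.1 (hr t') (hred' t').1.1
      (by rw [(hred' t).1.2, (hred' t').1.2, hC])
    obtain ⟨hl, hcc⟩ := eq_of_stabSimples_eq (hc t) (hred' t).2.1 (hc t') (hred' t').2.1
      (by rw [(hred' t).2.2, (hred' t').2.2, hC'])
    have hmem : u t ∈ {v | table (r t') (c t') v = table (r t') (c t') (u t')} := by
      rw [← hC]; rfl
    have hmem' : table (r t') (c t') (u t) = t'.2.2.1.1 := by
      rw [← hu t']; exact hmem
    have hut := hu t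
    clear_value F
    generalize r t = r1 at *
    generalize r t' = r2 at *
    generalize c t = c1 at *
    generalize c t' = c2 at *
    generalize u t = u1 at *
    clear hred hred' hC hC' hmem htt hu hc hr
    obtain ⟨k, l, s⟩ := t
    obtain ⟨k', l', s'⟩ := t'
    have hk' : k = k' := Fin.ext hk
    have hl' : l = l' := Fin.ext hl
    subst hk' hl'
    have h1 : r1 = r2 := funext fun x => Fin.ext (hrr x)
    have h2 : c1 = c2 := funext fun x => Fin.ext (hcc x)
    subst h1 h2
    have : s = s' := Subtype.ext (Subtype.ext (hut.symm.trans hmem'))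
    rw [this]
  · rintro ⟨C, I, hI, J, hJ, w, rfl⟩
    have hmax := doubleCoset_eq_leftStab hI hJ w
    obtain ⟨k, r', hk, hr', hs', hrI⟩ := exists_label_of_subset_simples
      (I := leftStab (doubleCoset I w J)) (fun s hs => hs.1)
    obtain ⟨l, c', hl, hc', ht', hcJ⟩ := exists_label_of_subset_simples
      (I := leftStab {v | v⁻¹ ∈ doubleCoset I w J}) (fun s hs => hs.1)
    rw [← hrI, ← hcJ] at hmax
    have hset : doubleCoset I w J = {v | table r' c' v = table r' c' w} := by
      ext v
      rw [hmax, mem_doubleCoset_stabSimples hr' hc']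
      rfl
    have hred0 : IsReduced (table r' c' w).toFinset := by
      rw [isReduced_toFinset_iff hr' hc']
      refine ⟨⟨hs', ?_⟩, ht', ?_⟩
      · rw [hrI, hset]
      · rw [hcJ, hset]
        rfl
    let t : T := ⟨⟨k, by omega⟩, ⟨l, by omega⟩, ⟨⟨table r' c' w, by simp [table]⟩, hred0⟩⟩
    refine ⟨t, Subtype.ext ?_⟩
    change {v | table (r t) (c t) v = table (r t) (c t) (u t)} = doubleCoset I w J
    rw [hset]
    have hut : table (r t) (c t) (u t) = table r' c' w := hu t
    have hrt : r t = r' := by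
      obtain ⟨σ, hσ⟩ := (map_univ_val_eq_iff _ _).1 hut
      have e1 : r t ∘ ⇑(u t * σ⁻¹ * w⁻¹) = r' := funext fun x => by
        have := hσ (σ⁻¹ (w⁻¹ x))
        simp only [Prod.mk.injEq] at this
        simpa using this.1
      have := Tuple.unique_monotone (f := r t) (σ := 1) (τ := u t * σ⁻¹ * w⁻¹)
        (hr t) (by rw [e1]; exact hr')
      rw [e1] at this
      exact this
    have hct : c t = c' := by
      obtain ⟨σ, hσ⟩ := (map_univ_val_eq_iff _ _).1 hut
      have e1 : c t ∘ ⇑(σ⁻¹) = c' := funext fun x => by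
        have := hσ (σ⁻¹ x)
        simp only [Prod.mk.injEq] at this
        simpa using this.2
      have := Tuple.unique_monotone (f := c t) (σ := 1) (τ := σ⁻¹)
        (hc t) (by rw [e1]; exact hc')
      rw [e1] at this
      exact this
    rw [hut, hrt, hct]

theorem card_sym_subset {β : Type*} [Fintype β] [DecidableEq β] (D : Finset β) (n : ℕ) :
    #{s : Sym β n | (s : Multiset β).toFinset ⊆ D} = (#D).multichoose n := by
  have h1 : ({s : Sym β n | (s : Multiset β).toFinset ⊆ D} : Finset (Sym β n)) =
      (univ : Finset (Sym D n)).image (Sym.map Subtype.val) := by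
    ext s
    simp only [mem_filter, mem_univ, true_and, mem_image]
    constructor
    · intro h
      have h' : ∀ x ∈ s, x ∈ D := fun x hx => h (Multiset.mem_toFinset.mpr hx)
      refine ⟨s.attach.map fun x => ⟨x.1, h' x.1 x.2⟩, ?_⟩
      rw [Sym.map_map]
      exact Sym.attach_map_coe s
    · rintro ⟨t, rfl⟩ x hx
      rw [Multiset.mem_toFinset] at hx
      obtain ⟨y, -, rfl⟩ := Sym.mem_map.mp hx
      exact y.2
  rw [h1, card_image_of_injective _ (Sym.map_injective Subtype.val_injective n), card_univ,
    Sym.card_sym_eq_multichoose, Fintype.card_coe]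

theorem c1_eq_zero_of_lt {n k : ℕ} (h : n < k) : c1 n k = 0 := by
  induction n generalizing k with
  | zero =>
    obtain ⟨k, rfl⟩ : ∃ j, k = j + 1 := ⟨k - 1, by omega⟩
    rfl
  | succ n ih =>
    obtain ⟨k, rfl⟩ : ∃ j, k = j + 1 := ⟨k - 1, by omega⟩
    rw [c1, ih (by omega), ih (by omega), mul_zero]

theorem sum_c1_mul_pow (d n : ℕ) :
    ∑ m ∈ range (n + 1), c1 n m * d ^ m = d.ascFactorial n := by
  induction n with
  | zero => simp [c1]
  | succ n ih =>
    rw [sum_range_succ', Nat.ascFactorial_succ, ← ih]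
    have h0 : c1 (n + 1) 0 = 0 := rfl
    have hsplit : ∀ m, c1 (n + 1) (m + 1) * d ^ (m + 1) =
        n * (c1 n (m + 1) * d ^ (m + 1)) + d * (c1 n m * d ^ m) := fun m => by
      rw [c1]; ring
    simp only [hsplit, h0, zero_mul, add_zero, sum_add_distrib, ← mul_sum]
    have hn : n * ∑ m ∈ range (n + 1), c1 n (m + 1) * d ^ (m + 1) =
        n * ∑ m ∈ range (n + 1), c1 n m * d ^ m := by
      rw [sum_range_succ, c1_eq_zero_of_lt (Nat.lt_succ_self n), sum_range_succ' _ n]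
      cases n with
      | zero => simp
      | succ n => simp [c1]
    rw [hn]
    ring

theorem eq_of_sum_powerset_eq {β M : Type*} [DecidableEq β] [AddCommGroup M]
    {f g : Finset β → M} (h : ∀ D : Finset β, ∑ E ∈ D.powerset, f E = ∑ E ∈ D.powerset, g E)
    (D : Finset β) : f D = g D := by
  induction D using Finset.strongInduction with
  | H D ih =>
    have hD := h D
    rw [← sum_erase_add _ _ (mem_powerset_self D), ← sum_erase_add _ _ (mem_powerset_self D),
      sum_congr rfl fun E hE => ih E ?_] at hD
    · exact add_left_cancel hD
    · rw [mem_erase, mem_powerset] at hE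
      exact lt_of_le_of_ne hE.2 hE.1

/-- Counting multisets by their support reduces to counting functions by their image. -/
theorem card_sym_support_eq {β : Type*} [Fintype β] [DecidableEq β] (n : ℕ) (D : Finset β) :
    (Nat.factorial n : ℚ) * #{s : Sym β n | (s : Multiset β).toFinset = D} =
      ∑ m ∈ range (n + 1), (c1 n m : ℚ) * #{f : Fin m → β | univ.image f = D} := by
  revert D
  refine eq_of_sum_powerset_eq fun D => ?_
  have hA : ∑ E ∈ D.powerset, #{s : Sym β n | (s : Multiset β).toFinset = E} =
      (#D).multichoose n := by
    rw [← card_sym_subset, card_eq_sum_card_fiberwise (t := D.powerset)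
      (f := fun s : Sym β n => (s : Multiset β).toFinset) (fun s hs => by simpa using hs)]
    refine sum_congr rfl fun E hE => ?_
    rw [filter_filter]
    refine congrArg card (filter_congr fun s _ => ?_)
    rw [mem_powerset] at hE
    exact ⟨fun h => ⟨h ▸ hE, h⟩, fun h => h.2⟩
  have hB : ∀ m, ∑ E ∈ D.powerset, #{f : Fin m → β | univ.image f = E} = (#D) ^ m := by
    intro m
    have h1 : #{f : Fin m → β | univ.image f ⊆ D} = (#D) ^ m := by
      have : ({f : Fin m → β | univ.image f ⊆ D} : Finset (Fin m → β)) =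
          Fintype.piFinset fun _ => D := by
        ext f
        simp [image_subset_iff]
      rw [this, Fintype.card_piFinset]
      simp
    rw [← h1, card_eq_sum_card_fiberwise (t := D.powerset)
      (f := fun f : Fin m → β => univ.image f)
      (fun s hs => mem_coe.2 (mem_powerset.2 (mem_filter.1 hs).2))]
    refine sum_congr rfl fun E hE => ?_
    rw [filter_filter]
    refine congrArg card (filter_congr fun s _ => ?_)
    rw [mem_powerset] at hE
    exact ⟨fun h => ⟨h.le.trans hE, h⟩, fun h => h.2⟩
  rw [← mul_sum, sum_comm]
  simp only [← mul_sum]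
  have key : Nat.factorial n * ∑ E ∈ D.powerset, #{s : Sym β n | (s : Multiset β).toFinset = E} =
      ∑ m ∈ range (n + 1), c1 n m * ∑ E ∈ D.powerset, #{f : Fin m → β | univ.image f = E} := by
    rw [hA, Nat.multichoose_eq, ← Nat.ascFactorial_eq_factorial_mul_choose', ← sum_c1_mul_pow]
    simp only [hB]
  exact_mod_cast key

theorem card_filter_comp_eq_sum {ι γ : Type*} [Fintype ι] [Fintype γ] [DecidableEq γ]
    (Q : γ → Prop) [DecidablePred Q]
    (F : ι → γ) : #{s : ι | Q (F s)} = ∑ D with Q D, #{s : ι | F s = D} := by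
  rw [card_eq_sum_card_fiberwise (t := univ.filter Q) (f := F) (fun s hs => by simpa using hs)]
  refine sum_congr rfl fun E hE => ?_
  rw [filter_filter]
  refine congrArg card (filter_congr fun s _ => ?_)
  rw [mem_filter] at hE
  exact ⟨fun h => h.2, fun h => ⟨h ▸ hE.2, h⟩⟩

open Classical in
theorem card_sym_eq_sum_card_fun {β : Type*} [Fintype β] (n : ℕ) (Q : Finset β → Prop) :
    (#{s : Sym β n | Q (s : Multiset β).toFinset} : ℚ) = (1 / (Nat.factorial n : ℚ)) *
      ∑ m ∈ range (n + 1), (c1 n m : ℚ) * #{f : Fin m → β | Q (univ.image f)} := by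
  have hn : (Nat.factorial n : ℚ) ≠ 0 := Nat.cast_ne_zero.mpr n.factorial_ne_zero
  rw [eq_comm, one_div, inv_mul_eq_iff_eq_mul₀ hn,
    card_filter_comp_eq_sum Q fun s : Sym β n => (s : Multiset β).toFinset]
  have hf : ∀ m, #{f : Fin m → β | Q (univ.image f)} =
      ∑ D with Q D, #{f : Fin m → β | univ.image f = D} := fun m =>
    card_filter_comp_eq_sum Q fun f : Fin m → β => univ.image f
  simp only [hf, Nat.cast_sum, mul_sum]
  rw [sum_comm]
  refine sum_congr rfl fun D _ => ?_
  convert! (card_sym_support_eq n D).symm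

section OrderedPartitions

variable {α : Type*} [Fintype α] [DecidableEq α]

/-- The ways to write `X` as a disjoint union of `k` labelled, possibly empty, parts. -/
def parts (k : ℕ) (X : Finset α) : Finset (Fin k → Finset α) :=
  {F | (∀ i j, i ≠ j → Disjoint (F i) (F j)) ∧ univ.biUnion F = X}

theorem mem_parts {k : ℕ} {X : Finset α} {F : Fin k → Finset α} :
    F ∈ parts k X ↔ (∀ i j, i ≠ j → Disjoint (F i) (F j)) ∧ univ.biUnion F = X := by
  simp [parts]

theorem sum_parts_zero (X : Finset α) (H : (Fin 0 → Finset α) → ℚ) :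
    ∑ F ∈ parts 0 X, H F = if X = ∅ then H Fin.elim0 else 0 := by
  have : parts 0 X = if X = ∅ then {Fin.elim0} else ∅ := by
    ext F
    rw [mem_parts]
    split_ifs with h
    · simp [h, Subsingleton.elim F Fin.elim0]
    · simp only [univ_eq_empty, biUnion_empty, notMem_empty, iff_false, not_and]
      exact fun _ h' => h h'.symm
  rw [this]
  split_ifs <;> simp

theorem cons_mem_parts {k : ℕ} {X B : Finset α} {F : Fin k → Finset α} :
    (Fin.cons B F : Fin (k + 1) → Finset α) ∈ parts (k + 1) X ↔ B ⊆ X ∧ F ∈ parts k (X \ B) := by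
  rw [mem_parts, mem_parts]
  have hU : univ.biUnion (Fin.cons B F : Fin (k + 1) → Finset α) = B ∪ univ.biUnion F := by
    ext x
    simp [Fin.exists_fin_succ]
  rw [hU]
  constructor
  · rintro ⟨h, rfl⟩
    refine ⟨subset_union_left, fun i j hij => ?_, ?_⟩
    · simpa using h i.succ j.succ (by simpa using hij)
    · rw [eq_comm, union_sdiff_left, Finset.sdiff_eq_self_iff_disjoint, disjoint_biUnion_left]
      intro i _
      simpa using h i.succ 0 (Fin.succ_ne_zero i)
  · rintro ⟨hB, h, hX⟩
    rw [hX]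
    have hd : ∀ i, Disjoint B (F i) := fun i => by
      have : F i ⊆ X \ B := hX ▸ subset_biUnion_of_mem F (mem_univ i)
      exact (disjoint_sdiff.mono_right this)
    refine ⟨fun i j => ?_, union_sdiff_of_subset hB⟩
    refine Fin.cases ?_ (fun i => ?_) i <;> refine Fin.cases ?_ (fun j => ?_) j
    · simp
    · simpa using fun _ => hd j
    · simpa using (hd i).symm
    · simpa using h i j

theorem sum_parts_succ {k : ℕ} (X : Finset α) (H : (Fin (k + 1) → Finset α) → ℚ) :
    ∑ F ∈ parts (k + 1) X, H F =
      ∑ B ∈ X.powerset, ∑ F ∈ parts k (X \ B), H (Fin.cons B F) := by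
  rw [sum_sigma']
  refine sum_bij' (fun F _ => ⟨F 0, Fin.tail F⟩) (fun z _ => Fin.cons z.1 z.2) ?_ ?_ ?_ ?_ ?_
  · intro F hF
    rw [← Fin.cons_self_tail F, cons_mem_parts] at hF
    simpa using hF
  · rintro ⟨B, F⟩ hF
    simpa [cons_mem_parts] using hF
  · intro F _
    simp
  · rintro ⟨B, F⟩ _
    simp
  · intro F _
    simp

theorem le_card_of_mem_parts {k : ℕ} {X : Finset α} {F : Fin k → Finset α} (hF : F ∈ parts k X)
    (hne : ∀ i, F i ≠ ∅) : k ≤ #X := by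
  rw [mem_parts] at hF
  rw [← hF.2, card_biUnion fun i _ j _ hij => hF.1 i j hij]
  calc k = ∑ _i : Fin k, 1 := by simp
    _ ≤ ∑ i, #(F i) := sum_le_sum fun i _ => card_pos.mpr (nonempty_iff_ne_empty.mpr (hne i))

theorem sum_parts_eq_zero {k : ℕ} {X : Finset α} (h : #X < k) {φ : Finset α → ℚ} (hφ : φ ∅ = 0)
    (H : (Fin k → Finset α) → ℚ) : ∑ F ∈ parts k X, (∏ i, φ (F i)) * H F = 0 := by
  refine sum_eq_zero fun F hF => ?_
  by_cases hne : ∀ i, F i ≠ ∅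
  · exact absurd (le_card_of_mem_parts hF hne) (not_le.mpr h)
  · push Not at hne
    obtain ⟨i, hi⟩ := hne
    rw [prod_eq_zero (mem_univ i) (by rw [hi, hφ]), zero_mul]

theorem sum_range_sum_parts_of_lt {N : ℕ} {X : Finset α} (h : #X < N) {φ : Finset α → ℚ}
    (hφ : φ ∅ = 0) (H : (k : ℕ) → (Fin k → Finset α) → ℚ) :
    ∑ k ∈ range N, ∑ F ∈ parts k X, (∏ i, φ (F i)) * H k F =
      ∑ k ∈ range (#X + 1), ∑ F ∈ parts k X, (∏ i, φ (F i)) * H k F := by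
  symm
  refine sum_subset (range_subset_range.mpr h) fun k _ hk => ?_
  exact sum_parts_eq_zero (by simpa using hk) hφ _

theorem sum_fun_eq_sum_parts {k : ℕ} (H : (Fin k → Finset α) → ℚ) :
    ∑ p : α → Fin k, H (fun i => univ.filter fun x => p x = i) = ∑ F ∈ parts k univ, H F := by
  refine sum_bij (fun p _ => fun i => univ.filter fun x => p x = i) ?_ ?_ ?_ ?_
  · intro p _
    rw [mem_parts]
    refine ⟨fun i j hij => ?_, ?_⟩
    · rw [disjoint_filter]
      rintro x _ rfl
      exact hij
    · ext x
      simp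
  · intro p _ p' _ h
    funext x
    have := congrFun h (p x)
    have hx : x ∈ univ.filter fun y => p y = p x := by simp
    rw [this] at hx
    exact (mem_filter.mp hx).2.symm
  · intro F hF
    rw [mem_parts] at hF
    have hex : ∀ x, ∃ i, x ∈ F i := fun x => by
      have : x ∈ univ.biUnion F := hF.2 ▸ mem_univ x
      simpa using this
    choose p hp using hex
    refine ⟨p, mem_univ _, funext fun i => ?_⟩
    ext x
    simp only [mem_filter, mem_univ, true_and]
    constructor
    · rintro rfl
      exact hp x
    · intro hx
      by_contra hne
      exact disjoint_left.mp (hF.1 _ _ hne) (hp x) hx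
  · intro p _
    rfl

omit [Fintype α] in
theorem sum_powerset_sdiff (X : Finset α) (G : Finset α → Finset α → ℚ) :
    ∑ B ∈ X.powerset, ∑ D ∈ (X \ B).powerset, G B (B ∪ D) =
      ∑ E ∈ X.powerset, ∑ B ∈ E.powerset, G B E := by
  rw [sum_sigma', sum_sigma']
  refine sum_bij' (fun z _ => ⟨z.1 ∪ z.2, z.1⟩) (fun z _ => ⟨z.2, z.1 \ z.2⟩) ?_ ?_ ?_ ?_ ?_
  · rintro ⟨B, D⟩ h
    simp only [mem_sigma, mem_powerset] at h ⊢
    exact ⟨union_subset h.1 (h.2.trans sdiff_subset), subset_union_left⟩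
  · rintro ⟨E, B⟩ h
    simp only [mem_sigma, mem_powerset] at h ⊢
    exact ⟨h.2.trans h.1, sdiff_subset_sdiff h.1 subset_rfl⟩
  · rintro ⟨B, D⟩ h
    simp only [mem_sigma, mem_powerset] at h
    have : (B ∪ D) \ B = D := by
      rw [union_sdiff_left, Finset.sdiff_eq_self_iff_disjoint]
      exact (disjoint_sdiff.mono_right h.2).symm
    simp [this]
  · rintro ⟨E, B⟩ h
    simp only [mem_sigma, mem_powerset] at h
    simp [union_sdiff_of_subset h.2]
  · rintro ⟨B, D⟩ h
    rfl

/-- The sum over ordered set partitions of `X` of the product of the weights of the blocks. -/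
def partitionSum (K : Finset α → ℚ) (X : Finset α) : ℚ :=
  ∑ k ∈ range (#X + 1), ∑ F ∈ parts k X, ∏ i, K (F i)

theorem partitionSum_rec {K : Finset α → ℚ} (hK : K ∅ = 0) (X : Finset α) :
    partitionSum K X =
      (if X = ∅ then 1 else 0) + ∑ B ∈ X.powerset, K B * partitionSum K (X \ B) := by
  unfold partitionSum
  rw [sum_range_succ', sum_parts_zero, add_comm]
  congr 1
  · simp only [sum_parts_succ]
    rw [sum_comm]
    refine sum_congr rfl fun B hB => ?_
    rw [mem_powerset] at hB
    simp only [Fin.prod_univ_succ, Fin.cons_zero, Fin.cons_succ, ← mul_sum]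
    rcases eq_or_ne B ∅ with rfl | hne
    · simp [hK]
    · congr 1
      have hlt : #(X \ B) < #X := card_lt_card (sdiff_ssubset hB (nonempty_iff_ne_empty.mpr hne))
      simpa using sum_range_sum_parts_of_lt hlt hK (fun _ _ => 1)

/-- The indicator that no two adjacent blocks have a union satisfying `S`. -/
def noAdjacent (S : Finset α → Prop) [DecidablePred S] {k : ℕ} (F : Fin k → Finset α) : ℚ :=
  ∏ i, ∏ j, if j.val = i.val + 1 then (if S (F i ∪ F j) then 0 else 1) else 1

/-- The indicator that the union of `B` with the first block does not satisfy `S`. -/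
def noAdjacentHead (S : Finset α → Prop) [DecidablePred S] (B : Finset α) {k : ℕ}
    (F : Fin k → Finset α) : ℚ :=
  ∏ j, if j.val = 0 then (if S (B ∪ F j) then 0 else 1) else 1

omit [Fintype α] in
theorem noAdjacent_cons (S : Finset α → Prop) [DecidablePred S] (B : Finset α) {k : ℕ}
    (F : Fin k → Finset α) : noAdjacent S (Fin.cons B F : Fin (k + 1) → Finset α) =
      noAdjacentHead S B F * noAdjacent S F := by
  unfold noAdjacent noAdjacentHead
  rw [Fin.prod_univ_succ]
  congr 1
  · rw [Fin.prod_univ_succ]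
    simp
  · refine prod_congr rfl fun i _ => ?_
    rw [Fin.prod_univ_succ]
    simp

omit [Fintype α] in
theorem noAdjacentHead_cons (S : Finset α → Prop) [DecidablePred S] (B D : Finset α) {k : ℕ}
    (F : Fin k → Finset α) : noAdjacentHead S B (Fin.cons D F : Fin (k + 1) → Finset α) =
      if S (B ∪ D) then 0 else 1 := by
  unfold noAdjacentHead
  rw [Fin.prod_univ_succ]
  simp

/-- The sum over ordered set partitions of `X`, weighted by blocks, without `S`-adjacencies. -/
def avoidingSum (S : Finset α → Prop) [DecidablePred S] (φ : Finset α → ℚ) (X : Finset α) : ℚ :=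
  ∑ k ∈ range (#X + 1), ∑ F ∈ parts k X, (∏ i, φ (F i)) * noAdjacent S F

/-- The analogue of `avoidingSum` with a block `B` placed in front. -/
def avoidingSumHead (S : Finset α → Prop) [DecidablePred S] (φ : Finset α → ℚ) (B X : Finset α) :
    ℚ :=
  ∑ k ∈ range (#X + 1), ∑ F ∈ parts k X,
    (∏ i, φ (F i)) * (noAdjacentHead S B F * noAdjacent S F)

section Recursion

variable {S : Finset α → Prop} [DecidablePred S] {φ : Finset α → ℚ}

theorem avoidingSum_rec (hφ : φ ∅ = 0) (X : Finset α) :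
    avoidingSum S φ X =
      (if X = ∅ then 1 else 0) + ∑ B ∈ X.powerset, φ B * avoidingSumHead S φ B (X \ B) := by
  unfold avoidingSum avoidingSumHead
  rw [sum_range_succ', sum_parts_zero, add_comm]
  congr 1
  · simp [noAdjacent]
  · simp only [sum_parts_succ]
    rw [sum_comm]
    refine sum_congr rfl fun B hB => ?_
    rw [mem_powerset] at hB
    simp only [Fin.prod_univ_succ, Fin.cons_zero, Fin.cons_succ, noAdjacent_cons, mul_assoc,
      ← mul_sum]
    rcases eq_or_ne B ∅ with rfl | hne
    · simp [hφ]
    · congr 1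
      have hlt : #(X \ B) < #X := card_lt_card (sdiff_ssubset hB (nonempty_iff_ne_empty.mpr hne))
      exact sum_range_sum_parts_of_lt hlt hφ (fun _ F => noAdjacentHead S B F * noAdjacent S F)

theorem avoidingSumHead_rec (hφ : φ ∅ = 0) (B X : Finset α) :
    avoidingSumHead S φ B X = avoidingSum S φ X -
      ∑ D ∈ X.powerset, if S (B ∪ D) then φ D * avoidingSumHead S φ D (X \ D) else 0 := by
  rw [avoidingSum_rec hφ, add_sub_assoc, ← sum_sub_distrib]
  conv_lhs => unfold avoidingSumHead
  rw [sum_range_succ', sum_parts_zero, add_comm]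
  congr 1
  · simp [noAdjacent, noAdjacentHead]
  · simp only [sum_parts_succ]
    rw [sum_comm]
    refine sum_congr rfl fun D hD => ?_
    rw [mem_powerset] at hD
    simp only [Fin.prod_univ_succ, Fin.cons_zero, Fin.cons_succ, noAdjacent_cons,
      noAdjacentHead_cons]
    split_ifs with h
    · simp
    · simp only [one_mul, mul_assoc, ← mul_sum, sub_zero]
      rcases eq_or_ne D ∅ with rfl | hne
      · simp [hφ]
      · congr 1
        have hlt : #(X \ D) < #X := card_lt_card (sdiff_ssubset hD (nonempty_iff_ne_empty.mpr hne))
        exact sum_range_sum_parts_of_lt hlt hφ (fun _ F => noAdjacentHead S D F * noAdjacent S F)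

end Recursion

/-- The alternating sum over pairs of nonempty complementary subsets of an `r`-element set. -/
def clusterWeight (r : ℕ) : ℚ := if r = 0 then 0 else -1 - (-1) ^ r

omit [Fintype α] in
theorem sum_powerset_neg_one_pow_card_sdiff (M : Finset α) :
    ∑ B ∈ M.powerset, (-1 : ℚ) ^ #(M \ B) = if M = ∅ then 1 else 0 := by
  have h := sum_powerset_neg_one_pow_card (x := M)
  have h' : ∑ B ∈ M.powerset, (-1 : ℚ) ^ #B = if M = ∅ then 1 else 0 := by
    exact_mod_cast congrArg (Int.cast : ℤ → ℚ) h
  rw [← h']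
  refine sum_bij' (fun B _ => M \ B) (fun B _ => M \ B) ?_ ?_ ?_ ?_ ?_
  · intro B _
    simp
  · intro B _
    simp
  · intro B hB
    exact Finset.sdiff_sdiff_eq_self (mem_powerset.mp hB)
  · intro B hB
    exact Finset.sdiff_sdiff_eq_self (mem_powerset.mp hB)
  · intro B _
    rfl

omit [Fintype α] in
theorem sum_powerset_nonempty_neg_one_pow (M : Finset α) :
    ∑ B ∈ M.powerset, (if B.Nonempty then (-1 : ℚ) ^ #(M \ B) else 0) =
      if M.Nonempty then -(-1) ^ #M else 0 := by
  have h : ∀ B ∈ M.powerset, (if B.Nonempty then (-1 : ℚ) ^ #(M \ B) else 0) =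
      (-1 : ℚ) ^ #(M \ B) - if B = ∅ then (-1 : ℚ) ^ #M else 0 := by
    intro B _
    rcases B.eq_empty_or_nonempty with rfl | hB
    · simp
    · simp [hB, hB.ne_empty]
  rw [sum_congr rfl h, sum_sub_distrib, sum_powerset_neg_one_pow_card_sdiff]
  rcases M.eq_empty_or_nonempty with rfl | hM
  · simp
  · simp [hM, hM.ne_empty]

omit [Fintype α] in
theorem sum_powerset_proper_neg_one_pow (M : Finset α) :
    ∑ B ∈ M.powerset, (if B.Nonempty ∧ (M \ B).Nonempty then (-1 : ℚ) ^ #(M \ B) else 0) =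
      clusterWeight #M := by
  have h : ∀ B ∈ M.powerset,
      (if B.Nonempty ∧ (M \ B).Nonempty then (-1 : ℚ) ^ #(M \ B) else 0) =
      (if B.Nonempty then (-1 : ℚ) ^ #(M \ B) else 0) -
        if B = M then (if M.Nonempty then 1 else 0) else 0 := by
    intro B hB
    rw [mem_powerset] at hB
    by_cases hBM : B = M
    · subst hBM
      simp
    · have : (M \ B).Nonempty := by
        rw [sdiff_nonempty]
        exact fun h => hBM (hB.antisymm h)
      simp [hBM, this]
  rw [sum_congr rfl h, sum_sub_distrib, sum_powerset_nonempty_neg_one_pow]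
  unfold clusterWeight
  rcases M.eq_empty_or_nonempty with rfl | hM
  · simp
  · simp [hM, hM.ne_empty]
    ring

section Cluster

variable {S : Finset α → Prop} [DecidablePred S] {φ ψ : Finset α → ℚ}

theorem mul_avoidingSumHead (hφ : φ ∅ = 0) (hmono : ∀ B B', S B → B' ⊆ B → S B')
    (hchain : ∀ B₁ B₂ B₃, B₂.Nonempty → S (B₁ ∪ B₂) → S (B₂ ∪ B₃) → S (B₁ ∪ (B₂ ∪ B₃)))
    (h₁ : ∀ B₁ B₂, B₁.Nonempty → B₂.Nonempty → Disjoint B₁ B₂ → S (B₁ ∪ B₂) →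
      φ B₁ * φ B₂ = ψ (B₁ ∪ B₂))
    (h₂ : ∀ B₁ B₂, B₁.Nonempty → B₂.Nonempty → Disjoint B₁ B₂ → S (B₁ ∪ B₂) →
      φ B₁ * ψ B₂ = ψ (B₁ ∪ B₂)) (X : Finset α) :
    ∀ B : Finset α, B.Nonempty → Disjoint B X →
      φ B * avoidingSumHead S φ B X = φ B * avoidingSum S φ X +
        ∑ E ∈ X.powerset, if E.Nonempty ∧ S (B ∪ E) then
          ψ (B ∪ E) * (-1) ^ #E * avoidingSum S φ (X \ E) else 0 := by
  induction X using Finset.strongInduction with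
  | H X ih =>
    intro B hB hBX
    rw [avoidingSumHead_rec hφ, mul_sub, sub_eq_add_neg]
    congr 1
    rw [neg_eq_iff_eq_neg, mul_sum, ← sum_neg_distrib]
    let G : Finset α → Finset α → ℚ := fun D M => if D.Nonempty then
      (if S (B ∪ M) then ψ (B ∪ M) * (-1) ^ #(M \ D) * avoidingSum S φ (X \ M) else 0) else 0
    have key : ∀ D ∈ X.powerset,
        φ B * (if S (B ∪ D) then φ D * avoidingSumHead S φ D (X \ D) else 0) =
          ∑ E ∈ (X \ D).powerset, G D (D ∪ E) := by
      intro D hD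
      rw [mem_powerset] at hD
      rcases D.eq_empty_or_nonempty with rfl | hDne
      · simp [G, hφ]
      have hBD : Disjoint B D := hBX.mono_right hD
      by_cases hS : S (B ∪ D)
      · rw [if_pos hS, ih (X \ D) (sdiff_ssubset hD hDne) D hDne disjoint_sdiff, mul_add,
          ← mul_assoc, h₁ B D hB hDne hBD hS, mul_sum,
          ← sum_erase_add _ _ (empty_mem_powerset (X \ D)),
          ← sum_erase_add (X \ D).powerset (fun E => G D (D ∪ E))
            (empty_mem_powerset (X \ D)), add_comm]
        congr 1
        · simp only [Finset.not_nonempty_empty, false_and, if_false, mul_zero, add_zero]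
          refine sum_congr rfl fun E hE => ?_
          rw [mem_erase, mem_powerset] at hE
          have hEne : E.Nonempty := nonempty_iff_ne_empty.mpr hE.1
          have hDE : (D ∪ E) \ D = E := by
            rw [union_sdiff_left, Finset.sdiff_eq_self_iff_disjoint]
            exact (disjoint_sdiff.mono_right hE.2).symm
          have hBE : Disjoint B E := hBX.mono_right (hE.2.trans sdiff_subset)
          by_cases hS' : S (D ∪ E)
          · have : S (B ∪ (D ∪ E)) := hchain B D E hDne hS hS'
            simp only [G, hDne, hEne, hS', this, hDE, true_and, if_true]
            rw [← h₂ B (D ∪ E) hB (hDne.mono subset_union_left)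
              (disjoint_union_right.mpr ⟨hBD, hBE⟩) this, sdiff_sdiff_left]
            simp only [sup_eq_union]
            ring
          · have : ¬S (B ∪ (D ∪ E)) := fun h => hS' (hmono _ _ h subset_union_right)
            simp [G, hS', this]
        · simp [G, hDne, hS]
      · rw [if_neg hS, mul_zero, eq_comm]
        refine sum_eq_zero fun E _ => ?_
        have : ¬S (B ∪ (D ∪ E)) := fun h =>
          hS (hmono _ _ h (union_subset_union_right subset_union_left))
        simp [G, this]
    rw [sum_congr rfl key, sum_powerset_sdiff]
    refine sum_congr rfl fun M _ => ?_
    by_cases hS : S (B ∪ M)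
    · have := sum_powerset_nonempty_neg_one_pow M
      simp only [G, hS, if_true, and_true]
      calc _ = ∑ D ∈ M.powerset, (if D.Nonempty then (-1 : ℚ) ^ #(M \ D) else 0) *
            (ψ (B ∪ M) * avoidingSum S φ (X \ M)) := by
              refine sum_congr rfl fun D _ => ?_
              split_ifs <;> ring
        _ = _ := by
              rw [← sum_mul, this]
              split_ifs <;> ring
    · simp [G, hS]

theorem avoidingSum_eq_partitionSum (hφ : φ ∅ = 0) (hmono : ∀ B B', S B → B' ⊆ B → S B')
    (hchain : ∀ B₁ B₂ B₃, B₂.Nonempty → S (B₁ ∪ B₂) → S (B₂ ∪ B₃) → S (B₁ ∪ (B₂ ∪ B₃)))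
    (h₁ : ∀ B₁ B₂, B₁.Nonempty → B₂.Nonempty → Disjoint B₁ B₂ → S (B₁ ∪ B₂) →
      φ B₁ * φ B₂ = ψ (B₁ ∪ B₂))
    (h₂ : ∀ B₁ B₂, B₁.Nonempty → B₂.Nonempty → Disjoint B₁ B₂ → S (B₁ ∪ B₂) →
      φ B₁ * ψ B₂ = ψ (B₁ ∪ B₂)) (X : Finset α) :
    avoidingSum S φ X =
      partitionSum (fun B => φ B + if S B then ψ B * clusterWeight #B else 0) X := by
  induction X using Finset.strongInduction with
  | H X ih =>
    rw [avoidingSum_rec hφ, partitionSum_rec (by simp [hφ, clusterWeight])]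
    congr 1
    let G : Finset α → Finset α → ℚ := fun B M => if B.Nonempty ∧ (M \ B).Nonempty then
      (if S M then ψ M * (-1) ^ #(M \ B) * avoidingSum S φ (X \ M) else 0) else 0
    have key : ∀ B ∈ X.powerset, φ B * avoidingSumHead S φ B (X \ B) =
        φ B * avoidingSum S φ (X \ B) + ∑ E ∈ (X \ B).powerset, G B (B ∪ E) := by
      intro B _
      rcases B.eq_empty_or_nonempty with rfl | hB
      · simp [G, hφ]
      rw [mul_avoidingSumHead hφ hmono hchain h₁ h₂ (X \ B) B hB disjoint_sdiff]
      congr 1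
      refine sum_congr rfl fun E hE => ?_
      rw [mem_powerset] at hE
      have hBE : (B ∪ E) \ B = E := by
        rw [union_sdiff_left, Finset.sdiff_eq_self_iff_disjoint]
        exact (disjoint_sdiff.mono_right hE).symm
      simp only [G, hB, hBE, sdiff_sdiff_left, sup_eq_union, ite_and, if_true]
    rw [sum_congr rfl key, sum_add_distrib, sum_powerset_sdiff, ← sum_add_distrib]
    refine sum_congr rfl fun M hM => ?_
    rw [mem_powerset] at hM
    rcases M.eq_empty_or_nonempty with rfl | hMne
    · simp [G, hφ, clusterWeight]
    rw [← ih (X \ M) (sdiff_ssubset hM hMne), add_mul]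
    congr 1
    by_cases hS : S M
    · have := sum_powerset_proper_neg_one_pow M
      simp only [G, hS, if_true]
      rw [← this, mul_sum, sum_mul]
      refine sum_congr rfl fun B _ => ?_
      split_ifs <;> ring
    · simp [G, hS]

end Cluster

section DoubleSum

/-- `B` lies inside a single member of the family `G`, or misses it. -/
def Within {k : ℕ} (G : Fin k → Finset α) (B : Finset α) : Prop :=
  ∀ j, B ⊆ G j ∨ Disjoint B (G j)

instance {k : ℕ} (G : Fin k → Finset α) : DecidablePred (Within G) := fun B =>
  inferInstanceAs (Decidable (∀ j, B ⊆ G j ∨ Disjoint B (G j)))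

omit [Fintype α] [DecidableEq α] in
theorem Within.mono {k : ℕ} {G : Fin k → Finset α} {B B' : Finset α} (h : Within G B)
    (hB : B' ⊆ B) : Within G B' := fun j =>
  (h j).imp hB.trans fun h' => h'.mono_left hB

omit [Fintype α] in
theorem Within.chain {k : ℕ} {G : Fin k → Finset α} {B₁ B₂ B₃ : Finset α} (hB : B₂.Nonempty)
    (h : Within G (B₁ ∪ B₂)) (h' : Within G (B₂ ∪ B₃)) : Within G (B₁ ∪ (B₂ ∪ B₃)) := by
  intro j
  rcases h j with h | h <;> rcases h' j with h' | h'
  · exact .inl (union_subset (subset_union_left.trans h) h')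
  · rw [disjoint_union_left] at h'
    exact absurd (h'.1.eq_bot_of_le (subset_union_right.trans h)) hB.ne_empty
  · rw [disjoint_union_left] at h
    exact absurd (h.2.eq_bot_of_le (subset_union_left.trans h')) hB.ne_empty
  · rw [disjoint_union_left] at h
    exact .inr (disjoint_union_left.mpr ⟨h.1, h'⟩)

omit [Fintype α] in
theorem ite_within {k : ℕ} (G : Fin k → Finset α) (B : Finset α) :
    (if Within G B then 1 else 0 : ℚ) =
      ∏ j, if B ⊆ G j ∨ Disjoint B (G j) then 1 else 0 := by
  rw [Finset.prod_ite_zero]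
  simp only [mem_univ, true_imp_iff, prod_const_one]
  rfl

omit [Fintype α] in
theorem Within.not_union_subset {k : ℕ} {G : Fin k → Finset α}
    (hd : ∀ i j, i ≠ j → Disjoint (G i) (G j)) (hne : ∀ i, (G i).Nonempty) {B : Finset α}
    (h : Within G B) {i j : Fin k} (hij : i ≠ j) : ¬G i ∪ G j ⊆ B := by
  intro hB
  rw [union_subset_iff] at hB
  rcases h i with h | h
  · exact (hne j).ne_empty ((hd i j hij).symm.eq_bot_of_le (hB.2.trans h))
  · exact (hne i).ne_empty (h.symm.eq_bot_of_le hB.1)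

omit [Fintype α] in
theorem Within.not_subset_of_disjoint {k : ℕ} {F : Fin k → Finset α}
    (hne : ∀ i, (F i).Nonempty) {B₁ B₂ : Finset α} (hB : B₂.Nonempty) (hd : Disjoint B₁ B₂)
    (h : Within F (B₁ ∪ B₂)) (i : Fin k) : ¬F i ⊆ B₁ := by
  intro hF
  rcases h i with h | h
  · exact hB.ne_empty (hd.symm.eq_bot_of_le ((subset_union_right.trans h).trans hF))
  · rw [disjoint_union_left] at h
    exact (hne i).ne_empty (h.1.symm.eq_bot_of_le hF)

omit [Fintype α] in
theorem noAdjacent_eq_sum (S : Finset α → Prop) [DecidablePred S] {k : ℕ}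
    (F : Fin k → Finset α) : noAdjacent S F =
      ∑ T ∈ ({z | z.2.val = z.1.val + 1} : Finset (Fin k × Fin k)).powerset,
        ∏ z ∈ T, -(if S (F z.1 ∪ F z.2) then 1 else 0 : ℚ) := by
  rw [← prod_one_add, prod_filter, ← univ_product_univ, prod_product]
  refine prod_congr rfl fun i _ => prod_congr rfl fun j _ => ?_
  split_ifs <;> simp_all

theorem sum_avoiding {N : ℕ} (hN : Fintype.card α < N) {S : Finset α → Prop} [DecidablePred S]
    {φ ψ : Finset α → ℚ} (hφ : φ ∅ = 0) (hmono : ∀ B B', S B → B' ⊆ B → S B')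
    (hchain : ∀ B₁ B₂ B₃, B₂.Nonempty → S (B₁ ∪ B₂) → S (B₂ ∪ B₃) → S (B₁ ∪ (B₂ ∪ B₃)))
    (h₁ : ∀ B₁ B₂, B₁.Nonempty → B₂.Nonempty → Disjoint B₁ B₂ → S (B₁ ∪ B₂) →
      φ B₁ * φ B₂ = ψ (B₁ ∪ B₂))
    (h₂ : ∀ B₁ B₂, B₁.Nonempty → B₂.Nonempty → Disjoint B₁ B₂ → S (B₁ ∪ B₂) →
      φ B₁ * ψ B₂ = ψ (B₁ ∪ B₂)) :
    ∑ k ∈ range N, ∑ F ∈ parts k univ, (∏ i, φ (F i)) * noAdjacent S F =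
      ∑ k ∈ range N, ∑ F ∈ parts k univ,
        ∏ i, (φ (F i) + if S (F i) then ψ (F i) * clusterWeight #(F i) else 0) := by
  have h := avoidingSum_eq_partitionSum hφ hmono hchain h₁ h₂ univ
  have h' := sum_range_sum_parts_of_lt (X := univ) (α := α) hN hφ fun _ F => noAdjacent S F
  have h'' := sum_range_sum_parts_of_lt (X := univ) (α := α) hN
    (φ := fun B => φ B + if S B then ψ B * clusterWeight #B else 0)
    (by simp [hφ, clusterWeight]) fun _ _ => 1
  simp only [mul_one] at h''
  rw [h', h'']
  exact h

theorem sum_rows {N : ℕ} (hN : Fintype.card α < N) {l : ℕ} {G : Fin l → Finset α}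
    (hd : ∀ i j, i ≠ j → Disjoint (G i) (G j)) (hne : ∀ i, (G i).Nonempty) :
    ∑ k ∈ range N, ∑ F ∈ parts k univ, (∏ i, if (F i).Nonempty then 1 else 0 : ℚ) *
        noAdjacent (Within G) F * noAdjacent (Within F) G =
      ∑ k ∈ range N, ∑ F ∈ parts k univ, (∏ i, if (F i).Nonempty then 1 else 0 : ℚ) *
        (∏ i, (1 + if Within G (F i) then clusterWeight #(F i) else 0)) *
          noAdjacent (Within F) G := by
  let P : Finset (Fin l × Fin l) := {z | z.2.val = z.1.val + 1}
  let φ : Finset (Fin l × Fin l) → Finset α → ℚ := fun T B => if B.Nonempty then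
    ∏ z ∈ T, (if G z.1 ∪ G z.2 ⊆ B ∨ Disjoint (G z.1 ∪ G z.2) B then 1 else 0) else 0
  have expand : ∀ {k : ℕ} (F : Fin k → Finset α),
      (∏ i, if (F i).Nonempty then 1 else 0 : ℚ) * noAdjacent (Within F) G =
        ∑ T ∈ P.powerset, (-1) ^ #T * ∏ i, φ T (F i) := by
    intro k F
    rw [noAdjacent_eq_sum, mul_sum]
    refine sum_congr rfl fun T _ => ?_
    rw [prod_neg]
    simp only [ite_within, φ]
    rw [prod_comm, mul_left_comm, ← prod_mul_distrib]
    congr 1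
    refine prod_congr rfl fun i _ => ?_
    split_ifs <;> simp
  have key : ∀ T ∈ P.powerset,
      ∑ k ∈ range N, ∑ F ∈ parts k univ, (∏ i, φ T (F i)) * noAdjacent (Within G) F =
      ∑ k ∈ range N, ∑ F ∈ parts k univ, (∏ i, φ T (F i)) *
        ∏ i, (1 + if Within G (F i) then clusterWeight #(F i) else 0) := by
    intro T hT
    have hmul : ∀ B₁ B₂ : Finset α, B₁.Nonempty → B₂.Nonempty → Disjoint B₁ B₂ →
        Within G (B₁ ∪ B₂) → φ T B₁ * φ T B₂ = φ T (B₁ ∪ B₂) := by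
      intro B₁ B₂ hB₁ hB₂ _ hW
      simp only [φ, hB₁, hB₂, hB₁.mono subset_union_left, if_true]
      rw [← prod_mul_distrib]
      refine prod_congr rfl fun z hz => ?_
      have hz' : z.2.val = z.1.val + 1 := (mem_filter.mp (mem_powerset.mp hT hz)).2
      have hne' : z.1 ≠ z.2 := fun h => by
        rw [← h] at hz'
        omega
      have h : ¬G z.1 ∪ G z.2 ⊆ B₁ ∪ B₂ := hW.not_union_subset hd hne hne'
      have h1 : ¬G z.1 ∪ G z.2 ⊆ B₁ := fun h' => h (h'.trans subset_union_left)
      have h2 : ¬G z.1 ∪ G z.2 ⊆ B₂ := fun h' => h (h'.trans subset_union_right)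
      simp only [h, h1, h2, false_or, disjoint_union_right]
      split_ifs <;> simp_all
    rw [sum_avoiding (ψ := φ T) hN (by simp [φ]) (fun _ _ h h' => h.mono h')
      (fun _ _ _ h h' h'' => h'.chain h h'') hmul hmul]
    refine sum_congr rfl fun k _ => sum_congr rfl fun F _ => ?_
    rw [← prod_mul_distrib]
    refine prod_congr rfl fun i _ => ?_
    split_ifs <;> ring
  have collect : ∀ Ω : (k : ℕ) → (Fin k → Finset α) → ℚ,
      ∑ k ∈ range N, ∑ F ∈ parts k univ, (∏ i, if (F i).Nonempty then 1 else 0 : ℚ) * Ω k F *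
          noAdjacent (Within F) G =
        ∑ T ∈ P.powerset, (-1) ^ #T *
          ∑ k ∈ range N, ∑ F ∈ parts k univ, (∏ i, φ T (F i)) * Ω k F := by
    intro Ω
    simp only [mul_sum]
    rw [sum_comm]
    refine sum_congr rfl fun k _ => ?_
    rw [sum_comm]
    refine sum_congr rfl fun F _ => ?_
    rw [mul_right_comm, expand, sum_mul]
    simp only [mul_assoc]
  rw [collect fun _ F => noAdjacent (Within G) F,
    collect fun _ F => ∏ i, (1 + if Within G (F i) then clusterWeight #(F i) else 0)]
  exact sum_congr rfl fun T hT => by rw [key T hT]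

theorem sum_columns {N : ℕ} (hN : Fintype.card α < N) {k : ℕ} {F : Fin k → Finset α}
    (hne : ∀ i, (F i).Nonempty) :
    ∑ l ∈ range N, ∑ G ∈ parts l univ, (∏ j, if (G j).Nonempty then 1 else 0 : ℚ) *
        (∏ i, (1 + if Within G (F i) then clusterWeight #(F i) else 0)) *
          noAdjacent (Within F) G =
      ∑ l ∈ range N, ∑ G ∈ parts l univ, ∑ R : Finset (Fin k), ∑ C : Finset (Fin l),
        if (∀ j, (G j).Nonempty) ∧ (∀ i ∈ R, Within G (F i)) ∧ (∀ j ∈ C, Within F (G j)) ∧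
          (∀ i ∈ R, ∀ j ∈ C, Disjoint (F i) (G j)) then
        (∏ i ∈ R, clusterWeight #(F i)) * ∏ j ∈ C, clusterWeight #(G j) else 0 := by
  let φ : Finset (Fin k) → Finset α → ℚ := fun R B => if B.Nonempty then
    ∏ i ∈ R, (if F i ⊆ B ∨ Disjoint (F i) B then 1 else 0) else 0
  let ψ : Finset (Fin k) → Finset α → ℚ := fun R B => if B.Nonempty then
    ∏ i ∈ R, (if Disjoint (F i) B then 1 else 0) else 0
  have key : ∀ R : Finset (Fin k),
      ∑ l ∈ range N, ∑ G ∈ parts l univ, (∏ j, φ R (G j)) * noAdjacent (Within F) G =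
      ∑ l ∈ range N, ∑ G ∈ parts l univ, ∏ j, (φ R (G j) +
        if Within F (G j) then ψ R (G j) * clusterWeight #(G j) else 0) := by
    intro R
    refine sum_avoiding hN (by simp [φ]) (fun _ _ h h' => h.mono h')
      (fun _ _ _ h h' h'' => h'.chain h h'') ?_ ?_
    · intro B₁ B₂ hB₁ hB₂ hd hW
      simp only [φ, ψ, hB₁, hB₂, hB₁.mono subset_union_left, if_true]
      rw [← prod_mul_distrib]
      refine prod_congr rfl fun i _ => ?_
      have h1 : ¬F i ⊆ B₁ := hW.not_subset_of_disjoint hne hB₂ hd i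
      have h2 : ¬F i ⊆ B₂ := (union_comm B₁ B₂ ▸ hW).not_subset_of_disjoint hne hB₁ hd.symm i
      simp only [h1, h2, false_or, disjoint_union_right]
      split_ifs <;> simp_all
    · intro B₁ B₂ hB₁ hB₂ hd hW
      simp only [φ, ψ, hB₁, hB₂, hB₁.mono subset_union_left, if_true]
      rw [← prod_mul_distrib]
      refine prod_congr rfl fun i _ => ?_
      have h1 : ¬F i ⊆ B₁ := hW.not_subset_of_disjoint hne hB₂ hd i
      simp only [h1, false_or, disjoint_union_right]
      split_ifs <;> simp_all
  have expand : ∀ {l : ℕ} (G : Fin l → Finset α),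
      (∏ j, if (G j).Nonempty then 1 else 0 : ℚ) *
        (∏ i, (1 + if Within G (F i) then clusterWeight #(F i) else 0)) =
        ∑ R : Finset (Fin k), (∏ i ∈ R, clusterWeight #(F i)) * ∏ j, φ R (G j) := by
    intro l G
    rw [prod_one_add, mul_sum, powerset_univ]
    refine sum_congr rfl fun R _ => ?_
    have : ∀ i, (if Within G (F i) then clusterWeight #(F i) else 0) =
        clusterWeight #(F i) * if Within G (F i) then 1 else 0 := fun i => by
      split_ifs <;> simp
    simp only [this, ite_within, φ]
    rw [prod_mul_distrib, prod_comm, mul_left_comm, ← prod_mul_distrib]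
    congr 1
    refine prod_congr rfl fun i _ => ?_
    split_ifs <;> simp
  have split : ∀ (R : Finset (Fin k)) {l : ℕ} (G : Fin l → Finset α),
      (∏ i ∈ R, clusterWeight #(F i)) * ∏ j, (φ R (G j) +
        if Within F (G j) then ψ R (G j) * clusterWeight #(G j) else 0) =
      ∑ C : Finset (Fin l),
        if (∀ j, (G j).Nonempty) ∧ (∀ i ∈ R, Within G (F i)) ∧ (∀ j ∈ C, Within F (G j)) ∧
          (∀ i ∈ R, ∀ j ∈ C, Disjoint (F i) (G j)) then
        (∏ i ∈ R, clusterWeight #(F i)) * ∏ j ∈ C, clusterWeight #(G j) else 0 := by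
    intro R l G
    simp only [add_comm (φ R _)]
    rw [prod_add, mul_sum, powerset_univ]
    refine sum_congr rfl fun C _ => ?_
    have hφ : ∀ j, φ R (G j) = if (G j).Nonempty ∧ ∀ i ∈ R, F i ⊆ G j ∨ Disjoint (F i) (G j)
        then 1 else 0 := fun j => by
      simp only [φ, Finset.prod_ite_zero, prod_const_one, ite_and]
    have hψ : ∀ j, (if Within F (G j) then ψ R (G j) * clusterWeight #(G j) else 0) =
        if (G j).Nonempty ∧ Within F (G j) ∧ ∀ i ∈ R, Disjoint (F i) (G j) then
          clusterWeight #(G j) else 0 := fun j => by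
      simp only [ψ, Finset.prod_ite_zero, prod_const_one]
      split_ifs <;> simp_all
    simp only [hφ, hψ]
    rw [Finset.prod_ite_zero, Finset.prod_ite_zero, prod_const_one]
    have hiff : ((∀ j ∈ C, (G j).Nonempty ∧ Within F (G j) ∧ ∀ i ∈ R, Disjoint (F i) (G j)) ∧
        ∀ j ∈ univ \ C, (G j).Nonempty ∧ ∀ i ∈ R, F i ⊆ G j ∨ Disjoint (F i) (G j)) ↔
        (∀ j, (G j).Nonempty) ∧ (∀ i ∈ R, Within G (F i)) ∧ (∀ j ∈ C, Within F (G j)) ∧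
          (∀ i ∈ R, ∀ j ∈ C, Disjoint (F i) (G j)) := by
      simp only [mem_sdiff, mem_univ, true_and]
      constructor
      · rintro ⟨h, h'⟩
        refine ⟨fun j => ?_, fun i hi j => ?_, fun j hj => (h j hj).2.1,
          fun i hi j hj => (h j hj).2.2 i hi⟩
        · by_cases hj : j ∈ C
          exacts [(h j hj).1, (h' j hj).1]
        · by_cases hj : j ∈ C
          exacts [.inr ((h j hj).2.2 i hi), (h' j hj).2 i hi]
      · rintro ⟨h1, h2, h3, h4⟩
        exact ⟨fun j hj => ⟨h1 j, h3 j hj, fun i hi => h4 i hi j hj⟩,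
          fun j _ => ⟨h1 j, fun i hi => h2 i hi j⟩⟩
    rw [← if_congr hiff rfl rfl]
    split_ifs <;> simp_all
  calc _ = ∑ R : Finset (Fin k), (∏ i ∈ R, clusterWeight #(F i)) *
          ∑ l ∈ range N, ∑ G ∈ parts l univ, (∏ j, φ R (G j)) * noAdjacent (Within F) G := by
        simp only [mul_sum]
        rw [sum_comm]
        refine sum_congr rfl fun k _ => ?_
        rw [sum_comm]
        refine sum_congr rfl fun F _ => ?_
        rw [expand, sum_mul]
        simp only [mul_assoc]
    _ = ∑ R : Finset (Fin k), ∑ l ∈ range N, ∑ G ∈ parts l univ,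
          (∏ i ∈ R, clusterWeight #(F i)) * ∏ j, (φ R (G j) +
            if Within F (G j) then ψ R (G j) * clusterWeight #(G j) else 0) := by
        simp only [key, mul_sum]
    _ = _ := by
        rw [sum_comm]
        refine sum_congr rfl fun l _ => ?_
        rw [sum_comm]
        exact sum_congr rfl fun G _ => sum_congr rfl fun R _ => split R G

end DoubleSum

section Fibers

/-- The set of points at which `p` takes the value `i`. -/
def fiber {k : ℕ} (p : α → Fin k) (i : Fin k) : Finset α := univ.filter fun x => p x = i

omit [DecidableEq α] in
theorem mem_fiber {k : ℕ} {p : α → Fin k} {i : Fin k} {x : α} : x ∈ fiber p i ↔ p x = i := by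
  simp [fiber]

omit [DecidableEq α] in
theorem within_fiber_iff {k : ℕ} (q : α → Fin k) {B : Finset α} (hB : B.Nonempty) :
    Within (fiber q) B ↔ ∃ b, ∀ x ∈ B, q x = b := by
  constructor
  · intro h
    obtain ⟨y, hy⟩ := hB
    refine ⟨q y, fun x hx => ?_⟩
    rcases h (q y) with h | h
    · exact mem_fiber.mp (h hx)
    · exact absurd (mem_fiber.mpr rfl) (disjoint_left.mp h hy)
  · rintro ⟨b, hb⟩ j
    by_cases hj : b = j
    · exact .inl fun x hx => mem_fiber.mpr ((hb x hx).trans hj)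
    · refine .inr (disjoint_left.mpr fun x hx hx' => hj ?_)
      rw [← hb x hx, mem_fiber.mp hx']

omit [Fintype α] in
theorem noAdjacent_eq_ite (S : Finset α → Prop) [DecidablePred S] {k : ℕ} (F : Fin k → Finset α) :
    noAdjacent S F = if ∀ i j : Fin k, j.val = i.val + 1 → ¬S (F i ∪ F j) then 1 else 0 := by
  have h : ∀ i j : Fin k, (if j.val = i.val + 1 then (if S (F i ∪ F j) then 0 else 1) else 1 : ℚ) =
      if j.val = i.val + 1 → ¬S (F i ∪ F j) then 1 else 0 := fun i j => by
    split_ifs <;> simp_all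
  simp only [noAdjacent, h, Finset.prod_ite_zero, prod_const_one, mem_univ, true_imp_iff]

theorem isReduced_image_iff {k l : ℕ} (p : α → Fin k) (q : α → Fin l) :
    IsReduced (univ.image fun x => (p x, q x)) ↔
      (∀ i, (fiber p i).Nonempty) ∧ (∀ j, (fiber q j).Nonempty) ∧
      (∀ i i' : Fin k, i'.val = i.val + 1 → ¬Within (fiber q) (fiber p i ∪ fiber p i')) ∧
      ∀ j j' : Fin l, j'.val = j.val + 1 → ¬Within (fiber p) (fiber q j ∪ fiber q j') := by
  have hp : (∀ a, ∃ b, (a, b) ∈ univ.image fun x => (p x, q x)) ↔ ∀ i, (fiber p i).Nonempty := by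
    simp [Finset.Nonempty, mem_fiber]
  have hq : (∀ b, ∃ a, (a, b) ∈ univ.image fun x => (p x, q x)) ↔ ∀ i, (fiber q i).Nonempty := by
    simp only [Finset.Nonempty, mem_fiber, mem_image, mem_univ, true_and, Prod.mk.injEq]
    refine forall_congr' fun b => ⟨?_, ?_⟩
    · rintro ⟨_, x, _, hx⟩
      exact ⟨x, hx⟩
    · rintro ⟨x, hx⟩
      exact ⟨p x, x, rfl, hx⟩
  unfold IsReduced
  rw [hp, hq]
  have hr : (∀ i, (fiber p i).Nonempty) → ∀ i i' : Fin k,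
      ((∃ b, ∀ z ∈ univ.image fun x => (p x, q x), z.1 = i ∨ z.1 = i' → z.2 = b) ↔
        Within (fiber q) (fiber p i ∪ fiber p i')) := by
    intro h i i'
    rw [within_fiber_iff q ((h i).mono subset_union_left)]
    simp [mem_fiber]
  have hc : (∀ i, (fiber q i).Nonempty) → ∀ i i' : Fin l,
      ((∃ b, ∀ z ∈ univ.image fun x => (p x, q x), z.2 = i ∨ z.2 = i' → z.1 = b) ↔
        Within (fiber p) (fiber q i ∪ fiber q i')) := by
    intro h i i'
    rw [within_fiber_iff p ((h i).mono subset_union_left)]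
    simp [mem_fiber]
  constructor
  · rintro ⟨⟨h1, h2⟩, h3, h4⟩
    exact ⟨h1, h3, fun i i' h => by rw [← hr h1]; exact h2 i i' h,
      fun i i' h => by rw [← hc h3]; exact h4 i i' h⟩
  · rintro ⟨h1, h3, h2, h4⟩
    exact ⟨⟨h1, fun i i' h => by rw [hr h1]; exact h2 i i' h⟩, h3,
      fun i i' h => by rw [hc h3]; exact h4 i i' h⟩

open Classical in
theorem sum_card_isReduced {N : ℕ} (hN : Fintype.card α < N) :
    ∑ k ∈ range N, ∑ l ∈ range N,
        (#{f : α → Fin k × Fin l | IsReduced (univ.image f)} : ℚ) =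
      ∑ k ∈ range N, ∑ l ∈ range N, ∑ p : α → Fin k, ∑ q : α → Fin l,
        ∑ R : Finset (Fin k), ∑ C : Finset (Fin l),
          if (∀ i, (fiber p i).Nonempty) ∧ (∀ j, (fiber q j).Nonempty) ∧
            (∀ i ∈ R, Within (fiber q) (fiber p i)) ∧ (∀ j ∈ C, Within (fiber p) (fiber q j)) ∧
            (∀ i ∈ R, ∀ j ∈ C, Disjoint (fiber p i) (fiber q j)) then
          (∏ i ∈ R, clusterWeight #(fiber p i)) * ∏ j ∈ C, clusterWeight #(fiber q j) else 0 := by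
  have hcount : ∀ k l : ℕ, (#{f : α → Fin k × Fin l | IsReduced (univ.image f)} : ℚ) =
      ∑ G ∈ parts l (univ : Finset α), ∑ F ∈ parts k univ,
        (∏ j, if (G j).Nonempty then 1 else 0 : ℚ) * ((∏ i, if (F i).Nonempty then 1 else 0 : ℚ) *
          noAdjacent (Within G) F * noAdjacent (Within F) G) := by
    intro k l
    rw [← sum_fun_eq_sum_parts fun G => ∑ F ∈ parts k univ,
        (∏ j, if (G j).Nonempty then 1 else 0 : ℚ) * ((∏ i, if (F i).Nonempty then 1 else 0 : ℚ) *
          noAdjacent (Within G) F * noAdjacent (Within F) G)]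
    rw [← sum_boole,
      ← (Equiv.arrowProdEquivProdArrow α (fun _ => Fin k) fun _ => Fin l).symm.sum_comp,
      ← univ_product_univ, sum_product_right]
    refine sum_congr rfl fun q _ => ?_
    rw [← sum_fun_eq_sum_parts]
    refine sum_congr rfl fun p _ => ?_
    have h := isReduced_image_iff p q
    change (if IsReduced (univ.image fun x => (p x, q x)) then (1 : ℚ) else 0) =
      (∏ j, if (fiber q j).Nonempty then 1 else 0 : ℚ) *
        ((∏ i, if (fiber p i).Nonempty then 1 else 0 : ℚ) *
          noAdjacent (Within (fiber q)) (fiber p) * noAdjacent (Within (fiber p)) (fiber q))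
    simp only [noAdjacent_eq_ite, Finset.prod_ite_zero, prod_const_one, mem_univ, true_imp_iff]
    rw [if_congr h rfl rfl]
    split_ifs <;> simp_all
  calc _ = ∑ l ∈ range N, ∑ G ∈ parts l (univ : Finset α), (∏ j, if (G j).Nonempty then 1 else 0) *
        ∑ k ∈ range N, ∑ F ∈ parts k univ, (∏ i, if (F i).Nonempty then 1 else 0 : ℚ) *
          noAdjacent (Within G) F * noAdjacent (Within F) G := by
        simp only [hcount, mul_sum]
        rw [sum_comm]
        exact sum_congr rfl fun l _ => sum_comm
    _ = ∑ l ∈ range N, ∑ G ∈ parts l (univ : Finset α), (∏ j, if (G j).Nonempty then 1 else 0) *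
        ∑ k ∈ range N, ∑ F ∈ parts k univ, (∏ i, if (F i).Nonempty then 1 else 0 : ℚ) *
          (∏ i, (1 + if Within G (F i) then clusterWeight #(F i) else 0)) *
            noAdjacent (Within F) G := by
        refine sum_congr rfl fun l _ => sum_congr rfl fun G hG => ?_
        by_cases hne : ∀ j, (G j).Nonempty
        · rw [sum_rows hN (mem_parts.mp hG).1 hne]
        · rw [Finset.prod_ite_zero, if_neg (by simpa using hne), zero_mul, zero_mul]
    _ = ∑ k ∈ range N, ∑ F ∈ parts k (univ : Finset α), (∏ i, if (F i).Nonempty then 1 else 0) *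
        ∑ l ∈ range N, ∑ G ∈ parts l univ, (∏ j, if (G j).Nonempty then 1 else 0 : ℚ) *
          (∏ i, (1 + if Within G (F i) then clusterWeight #(F i) else 0)) *
            noAdjacent (Within F) G := by
        simp only [mul_sum]
        rw [sum_congr rfl fun l _ => sum_comm, sum_comm]
        refine sum_congr rfl fun k _ => ?_
        rw [sum_congr rfl fun l _ => sum_comm, sum_comm]
        refine sum_congr rfl fun F _ => sum_congr rfl fun l _ => sum_congr rfl fun G _ => ?_
        ring
    _ = ∑ k ∈ range N, ∑ F ∈ parts k (univ : Finset α), ∑ l ∈ range N, ∑ G ∈ parts l univ,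
        ∑ R : Finset (Fin k), ∑ C : Finset (Fin l),
          if (∀ i, (F i).Nonempty) ∧ (∀ j, (G j).Nonempty) ∧
            (∀ i ∈ R, Within G (F i)) ∧ (∀ j ∈ C, Within F (G j)) ∧
            (∀ i ∈ R, ∀ j ∈ C, Disjoint (F i) (G j)) then
          (∏ i ∈ R, clusterWeight #(F i)) * ∏ j ∈ C, clusterWeight #(G j) else 0 := by
        refine sum_congr rfl fun k _ => sum_congr rfl fun F _ => ?_
        rw [Finset.prod_ite_zero]
        by_cases hne : ∀ i, (F i).Nonempty
        · rw [sum_columns hN hne]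
          simp [hne]
        · simp [hne]
    _ = _ := by
        refine sum_congr rfl fun k _ => ?_
        rw [sum_comm]
        refine sum_congr rfl fun l _ => ?_
        rw [← sum_fun_eq_sum_parts]
        refine sum_congr rfl fun p _ => ?_
        rw [← sum_fun_eq_sum_parts]
        rfl

end Fibers

end OrderedPartitions

section Counting

theorem S2_eq_zero_of_lt : ∀ {n k : ℕ}, n < k → S2 n k = 0
  | _, 0, h => absurd h (Nat.not_lt_zero _)
  | 0, _ + 1, _ => rfl
  | n + 1, k + 1, h => by
    rw [S2, S2_eq_zero_of_lt (Nat.lt_of_succ_lt_succ h), S2_eq_zero_of_lt (Nat.lt_of_succ_lt h)]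
    rfl

open Classical in
theorem card_surjective_fin : ∀ n k : ℕ,
    #{f : Fin n → Fin k | Function.Surjective f} = k.factorial * S2 n k
  | 0, 0 => by
    have : (univ.filter fun f : Fin 0 → Fin 0 => Function.Surjective f) = univ :=
      filter_true_of_mem fun f _ b => b.elim0
    rw [this]
    simp [S2]
  | 0, k + 1 => by
    have : (univ.filter fun f : Fin 0 → Fin (k + 1) => Function.Surjective f) = ∅ :=
      filter_false_of_mem fun f _ h => (h 0).choose.elim0
    rw [this]
    simp [S2]
  | n + 1, 0 => by
    simp [S2]
  | n + 1, k + 1 => by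
    have hc : ∀ (i : Fin (k + 1)) (g : Fin n → Fin (k + 1)),
        Function.Surjective (Fin.cons i g : Fin (n + 1) → Fin (k + 1)) ↔
          Function.Surjective g ∨ Set.range g = {i}ᶜ := by
      intro i g
      rw [← Set.range_eq_univ, ← Set.range_eq_univ, Fin.range_cons]
      constructor
      · intro h
        by_cases hi : i ∈ Set.range g
        · left
          rwa [Set.insert_eq_of_mem hi] at h
        · right
          ext x
          have hx : x ∈ insert i (Set.range g) := h ▸ Set.mem_univ x
          rw [Set.mem_insert_iff] at hx
          rw [Set.mem_compl_singleton_iff]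
          exact ⟨fun h' h'' => hi (h'' ▸ h'), fun h' => hx.resolve_left h'⟩
      · rintro (h | h)
        · rw [h, Set.insert_eq_of_mem (Set.mem_univ i)]
        · rw [h]
          ext x
          simpa using eq_or_ne x i
    have hr : ∀ i : Fin (k + 1), #{g : Fin n → Fin (k + 1) | Set.range g = {i}ᶜ} =
        #{g : Fin n → Fin k | Function.Surjective g} := by
      intro i
      symm
      refine card_bij (fun g _ => i.succAbove ∘ g) ?_ ?_ ?_
      · intro g hg
        rw [mem_filter] at hg ⊢
        refine ⟨mem_univ _, ?_⟩
        rw [hg.2.range_comp, Fin.range_succAbove]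
      · intro g _ g' _ h
        exact (Fin.succAbove_right_injective.comp_left) h
      · intro g hg
        rw [mem_filter] at hg
        have hne : ∀ x, ∃ y, i.succAbove y = g x := fun x =>
          Fin.exists_succAbove_eq fun h => by
            have : g x ∈ ({i}ᶜ : Set (Fin (k + 1))) := hg.2 ▸ Set.mem_range_self x
            exact this h
        choose g' hg' using hne
        refine ⟨g', ?_, funext hg'⟩
        rw [mem_filter]
        refine ⟨mem_univ _, fun y => ?_⟩
        have : i.succAbove y ∈ Set.range g := by
          rw [hg.2]
          exact Fin.succAbove_ne i y
        obtain ⟨x, hx⟩ := this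
        exact ⟨x, Fin.succAbove_right_injective ((hg' x).trans hx)⟩
    have hi : ∀ i : Fin (k + 1),
        #{g : Fin n → Fin (k + 1) | Function.Surjective g ∨ Set.range g = {i}ᶜ} =
          (k + 1).factorial * S2 n (k + 1) + k.factorial * S2 n k := by
      intro i
      rw [filter_or, card_union_of_disjoint, card_surjective_fin n (k + 1), hr,
        card_surjective_fin n k]
      rw [disjoint_filter]
      intro g _ h h'
      rw [h.range_eq] at h'
      have : i ∈ ({i}ᶜ : Set (Fin (k + 1))) := h' ▸ Set.mem_univ i
      exact this rfl
    rw [card_filter, ← (Fin.consEquiv fun _ => Fin (k + 1)).sum_comp, ← univ_product_univ,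
      sum_product]
    have h : ∀ i : Fin (k + 1), ∑ g : Fin n → Fin (k + 1),
        (if Function.Surjective ((Fin.consEquiv fun _ => Fin (k + 1)) (i, g)) then 1 else 0) =
          (k + 1).factorial * S2 n (k + 1) + k.factorial * S2 n k := fun i => by
      rw [← hi i, card_filter]
      exact sum_congr rfl fun g _ => if_congr (hc i g) rfl rfl
    rw [sum_congr rfl fun i _ => h i]
    rw [sum_const, card_univ, Fintype.card_fin, S2, Nat.factorial_succ, smul_eq_mul]
    ring

theorem card_surjective (Y K : Type*) [Fintype Y] [Fintype K] [DecidableEq Y]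
    [DecidablePred (Function.Surjective : (Y → K) → Prop)] :
    #{f : Y → K | Function.Surjective f} =
      (Fintype.card K).factorial * S2 (Fintype.card Y) (Fintype.card K) := by
  classical
  rw [← card_surjective_fin]
  refine card_equiv ((Fintype.equivFin Y).arrowCongr (Fintype.equivFin K)) fun f => ?_
  rw [mem_filter, mem_filter]
  simp only [mem_univ, true_and]
  change _ ↔ Function.Surjective (Fintype.equivFin K ∘ f ∘ (Fintype.equivFin Y).symm)
  rw [EquivLike.comp_surjective, EquivLike.surjective_comp]

open Classical in
theorem card_embedding_map_eq {k : ℕ} (R : Finset (Fin k)) :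
    #{e : Fin #R ↪ Fin k | univ.map e = R} = (#R).factorial := by
  have h : Fintype.card (Fin #R ≃ R) = (#R).factorial := by
    rw [Fintype.card_equiv R.equivFin.symm, Fintype.card_fin]
  rw [← h, ← card_univ]
  symm
  refine card_bij (fun s _ => s.toEmbedding.trans (Function.Embedding.subtype _)) ?_ ?_ ?_
  · intro s _
    rw [mem_filter]
    refine ⟨mem_univ _, ?_⟩
    ext x
    simp only [mem_map, mem_univ, true_and, Function.Embedding.trans_apply,
      Equiv.coe_toEmbedding, Function.Embedding.subtype_apply]
    exact ⟨fun ⟨y, hy⟩ => hy ▸ (s y).2, fun hx => ⟨s.symm ⟨x, hx⟩, by simp⟩⟩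
  · intro s _ s' _ hs
    ext y
    exact congrArg Fin.val (DFunLike.congr_fun hs y)
  · intro e he
    rw [mem_filter] at he
    have hmem : ∀ y, e y ∈ R := fun y => by
      have h := mem_map_of_mem e (mem_univ y)
      rwa [he.2] at h
    have hbij : Function.Bijective fun y => (⟨e y, hmem y⟩ : R) := by
      rw [Fintype.bijective_iff_injective_and_card]
      exact ⟨fun y y' hy => e.injective (congrArg Subtype.val hy), by simp⟩
    exact ⟨Equiv.ofBijective _ hbij, mem_univ _, rfl⟩

theorem sum_finset_eq_sum_embedding {N k : ℕ} (hk : k < N) (g : Finset (Fin k) → ℚ) :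
    ∑ R : Finset (Fin k), g R =
      ∑ a ∈ range N, (1 / (a.factorial : ℚ)) * ∑ e : Fin a ↪ Fin k, g (univ.map e) := by
  classical
  have hR : ∀ R : Finset (Fin k), #R ∈ range N := fun R => by
    rw [mem_range]
    exact (card_le_univ R).trans_lt (by simpa using hk)
  rw [← sum_fiberwise_of_maps_to fun R _ => hR R]
  refine sum_congr rfl fun a _ => ?_
  rw [← sum_fiberwise_of_maps_to (s := (univ : Finset (Fin a ↪ Fin k)))
    (t := univ.filter fun R => #R = a) (g := fun e => univ.map e) (fun e _ => by simp), mul_sum]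
  refine sum_congr rfl fun R hRa => ?_
  have hRa' : #R = a := (mem_filter.mp hRa).2
  subst hRa'
  rw [sum_congr rfl fun e he => by rw [(mem_filter.mp he).2], sum_const, card_embedding_map_eq,
    nsmul_eq_mul, ← mul_assoc, one_div_mul_cancel (Nat.cast_ne_zero.mpr (Nat.factorial_ne_zero _)),
    one_mul]

variable {α : Type*} [Fintype α]

/-- The labelling `p` is onto, its blocks `e s` are the classes of `τ` labelled `inl s`, and it is
constant on the classes of `τ` labelled `inr s`. -/
def Compatible {a b k : ℕ} (τ : α → Option (Fin a ⊕ Fin b)) (e : Fin a ↪ Fin k)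
    (p : α → Fin k) : Prop :=
  Function.Surjective p ∧ (∀ x s, p x = e s ↔ τ x = some (.inl s)) ∧
    ∀ s, ∃ i, ∀ x, τ x = some (.inr s) → p x = i

open Classical in
theorem card_compatible {a b k : ℕ} {τ : α → Option (Fin a ⊕ Fin b)} (hτ : ∀ s, ∃ x, τ x = some s)
    (e : Fin a ↪ Fin k) : #{p : α → Fin k | Compatible τ e p} =
      (k - a).factorial * S2 (#{x | τ x = none} + b) (k - a) := by
  have hY : Fintype.card ({x // τ x = none} ⊕ Fin b) = #{x | τ x = none} + b := by
    simp [Fintype.card_subtype]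
  have hK : Fintype.card {i // i ∉ Set.range e} = k - a := by
    rw [Fintype.card_subtype_compl, Fintype.card_fin]
    congr 1
    rw [← Fintype.card_congr (Equiv.ofInjective e e.injective), Fintype.card_fin]
  rw [← hK, ← hY]
  refine Eq.trans ?_ (card_surjective _ _)
  choose rep hrep using hτ
  have hnotin : ∀ {p : α → Fin k}, Compatible τ e p → ∀ x, (∀ s, τ x ≠ some (.inl s)) →
      p x ∉ Set.range e := by
    rintro p hp x hx ⟨s, hs⟩
    exact hx s ((hp.2.1 x s).mp hs.symm)
  have hconst : ∀ {p : α → Fin k}, Compatible τ e p → ∀ x s, τ x = some (.inr s) →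
      p x = p (rep (.inr s)) := by
    intro p hp x s hx
    obtain ⟨i, hi⟩ := hp.2.2 s
    rw [hi x hx, hi _ (hrep _)]
  let Φ : (p : α → Fin k) → Compatible τ e p →
      {x // τ x = none} ⊕ Fin b → {i // i ∉ Set.range e} := fun p hp =>
    Sum.elim (fun x => ⟨p x.1, hnotin hp x.1 fun s => by rw [x.2]; simp⟩)
      fun s => ⟨p (rep (.inr s)), hnotin hp _ fun s => by rw [hrep]; simp⟩
  have hsurj : ∀ p hp, Function.Surjective (Φ p hp) := by
    rintro p hp ⟨i, hi⟩
    obtain ⟨x, rfl⟩ := hp.1 i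
    rcases hx : τ x with _ | s | s
    · exact ⟨.inl ⟨x, hx⟩, rfl⟩
    · exact absurd ⟨s, ((hp.2.1 x s).mpr hx).symm⟩ hi
    · exact ⟨.inr s, Subtype.ext (hconst hp x s hx).symm⟩
  have hinj : ∀ p hp p' hp', Φ p hp = Φ p' hp' → p = p' := by
    intro p hp p' hp' h
    funext x
    rcases hx : τ x with _ | s | s
    · exact congrArg Subtype.val (congrFun h (.inl ⟨x, hx⟩))
    · rw [(hp.2.1 x s).mpr hx, (hp'.2.1 x s).mpr hx]
    · rw [hconst hp x s hx, hconst hp' x s hx]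
      exact congrArg Subtype.val (congrFun h (.inr s))
  have hex : ∀ f : {x // τ x = none} ⊕ Fin b → {i // i ∉ Set.range e}, Function.Surjective f →
      ∃ p hp, Φ p hp = f := by
    intro f hf
    have hex : ∀ x, ∃ i : Fin k, (∀ h : τ x = none, i = (f (.inl ⟨x, h⟩)).1) ∧
        (∀ s, τ x = some (.inl s) → i = e s) ∧ ∀ s, τ x = some (.inr s) → i = (f (.inr s)).1 := by
      intro x
      have h : τ x = none ∨ (∃ s, τ x = some (.inl s)) ∨ ∃ s, τ x = some (.inr s) := by
        rcases τ x with _ | s | s <;> simp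
      rcases h with hx | ⟨s, hx⟩ | ⟨s, hx⟩
      · exact ⟨(f (.inl ⟨x, hx⟩)).1, by simp, by simp [hx], by simp [hx]⟩
      · exact ⟨e s, fun h => by simp [hx] at h, by simp +contextual [hx], by simp [hx]⟩
      · exact ⟨(f (.inr s)).1, fun h => by simp [hx] at h, by simp [hx], by simp +contextual [hx]⟩
    choose p hp₁ hp₂ hp₃ using hex
    have hp : Compatible τ e p := by
      refine ⟨fun i => ?_, fun x s => ⟨fun h => ?_, hp₂ x s⟩, fun s => ⟨_, fun x => hp₃ x s⟩⟩
      · by_cases hi : i ∈ Set.range e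
        · obtain ⟨s, rfl⟩ := hi
          exact ⟨rep (.inl s), hp₂ _ s (hrep _)⟩
        · obtain ⟨y, hy⟩ := hf ⟨i, hi⟩
          rcases y with ⟨x, hx⟩ | s
          · exact ⟨x, by rw [hp₁ x hx, hy]⟩
          · exact ⟨rep (.inr s), by rw [hp₃ _ s (hrep _), hy]⟩
      · rcases hx : τ x with _ | s' | s'
        · exact absurd ⟨s, (h.symm.trans (hp₁ x hx))⟩ (f (.inl ⟨x, hx⟩)).2
        · rw [e.injective ((hp₂ x s' hx).symm.trans h)]
        · exact absurd ⟨s, (h.symm.trans (hp₃ x s' hx))⟩ (f (.inr s')).2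
    refine ⟨p, hp, funext fun y => ?_⟩
    rcases y with ⟨x, hx⟩ | s
    · exact Subtype.ext (hp₁ x hx)
    · exact Subtype.ext (hp₃ _ s (hrep _))
  clear_value Φ
  refine card_bij (fun p hp => Φ p (mem_filter.mp hp).2) ?_ ?_ ?_
  · exact fun p hp => mem_filter.mpr ⟨mem_univ _, hsurj p _⟩
  · exact fun p hp p' hp' h => hinj _ _ _ _ h
  · intro f hf
    obtain ⟨p, hp, h⟩ := hex f (mem_filter.mp hf).2
    exact ⟨p, mem_filter.mpr ⟨mem_univ _, hp⟩, h⟩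

open Classical in
theorem sum_card_compatible {N a b : ℕ} {τ : α → Option (Fin a ⊕ Fin b)}
    (hN : Fintype.card α < N) (hτ : ∀ s, ∃ x, τ x = some s) :
    ∑ k ∈ range N, ∑ e : Fin a ↪ Fin k, #{p : α → Fin k | Compatible τ e p} =
      genFubini (#{x | τ x = none} + (a + b)) a := by
  have hM : #{x | τ x = none} + (a + b) < N := by
    choose rep hrep using hτ
    refine lt_of_le_of_lt ?_ hN
    have : Fintype.card ({x // τ x = none} ⊕ (Fin a ⊕ Fin b)) = #{x | τ x = none} + (a + b) := by
      simp [Fintype.card_subtype]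
    rw [← this]
    refine Fintype.card_le_of_injective (Sum.elim Subtype.val rep) ?_
    rintro (⟨x, hx⟩ | s) (⟨y, hy⟩ | t) h
    · simpa using h
    · simp only [Sum.elim_inl, Sum.elim_inr] at h
      simp [h, hrep] at hx
    · simp only [Sum.elim_inl, Sum.elim_inr] at h
      simp [← h, hrep] at hy
    · simp only [Sum.elim_inr] at h
      have : some s = some t := by rw [← hrep s, ← hrep t, h]
      simpa using this
  have hk : ∀ k, ∑ e : Fin a ↪ Fin k, #{p : α → Fin k | Compatible τ e p} =
      if a ≤ k then k.factorial * S2 (#{x | τ x = none} + b) (k - a) else 0 := by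
    intro k
    rw [sum_congr rfl fun e _ => card_compatible hτ e, sum_const, card_univ,
      Fintype.card_embedding_eq, Fintype.card_fin, Fintype.card_fin, smul_eq_mul, ← mul_assoc]
    split_ifs with h
    · rw [mul_comm (k.descFactorial a), Nat.factorial_mul_descFactorial h]
    · rw [Nat.descFactorial_eq_zero_iff_lt.mpr (not_le.mp h)]
      simp
  rw [sum_congr rfl fun k _ => hk k, genFubini, ← sum_filter]
  symm
  have hsub : #{x | τ x = none} + (a + b) - a = #{x | τ x = none} + b := by omega
  rw [hsub]
  refine sum_subset (fun k hk => ?_) fun k hk hk' => ?_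
  · rw [mem_Icc] at hk
    rw [mem_filter, mem_range]
    omega
  · rw [mem_filter, mem_range] at hk
    rw [mem_Icc] at hk'
    rw [S2_eq_zero_of_lt (by omega), mul_zero]

variable [DecidableEq α]

omit [DecidableEq α] in
open Classical in
theorem reduced_conditions_iff_compatible {a b k l : ℕ} {p : α → Fin k} {q : α → Fin l}
    {e : Fin a ↪ Fin k} {e' : Fin b ↪ Fin l} {τ : α → Option (Fin a ⊕ Fin b)}
    (h₁ : ∀ x s, p x = e s ↔ τ x = some (.inl s)) (h₂ : ∀ x s, q x = e' s ↔ τ x = some (.inr s)) :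
    ((∀ i, (fiber p i).Nonempty) ∧ (∀ j, (fiber q j).Nonempty) ∧
      (∀ i ∈ univ.map e, Within (fiber q) (fiber p i)) ∧
      (∀ j ∈ univ.map e', Within (fiber p) (fiber q j)) ∧
      ∀ i ∈ univ.map e, ∀ j ∈ univ.map e', Disjoint (fiber p i) (fiber q j)) ↔
    Compatible τ e p ∧ Compatible (fun x => (τ x).map Sum.swap) e' q := by
  have hs : ∀ x s, (τ x).map Sum.swap = some (.inl s) ↔ τ x = some (.inr s) := fun x s => by
    rcases τ x with _ | t | t <;> simp
  have hs' : ∀ x s, (τ x).map Sum.swap = some (.inr s) ↔ τ x = some (.inl s) := fun x s => by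
    rcases τ x with _ | t | t <;> simp
  have hsurj : ∀ {r : ℕ} (f : α → Fin r), (∀ i, (fiber f i).Nonempty) ↔ Function.Surjective f :=
    fun f => forall_congr' fun i => by simp [Finset.Nonempty, mem_fiber]
  have hdisj : ∀ i ∈ univ.map e, ∀ j ∈ univ.map e', Disjoint (fiber p i) (fiber q j) := by
    simp only [mem_map, mem_univ, true_and, forall_exists_index, forall_apply_eq_imp_iff]
    intro s t
    rw [disjoint_left]
    intro x hx hx'
    rw [mem_fiber, h₁] at hx
    rw [mem_fiber, h₂, hx] at hx'
    simp at hx'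
  simp only [Compatible, hs, hs', h₁, h₂, implies_true, true_and, hsurj]
  constructor
  · rintro ⟨hp, hq, hR, hC, -⟩
    refine ⟨⟨hp, fun s => ?_⟩, hq, fun s => ?_⟩
    · have := (within_fiber_iff p ((hsurj q).mpr hq (e' s))).mp
        (hC _ (mem_map_of_mem _ (mem_univ s)))
      simpa only [mem_fiber, h₂] using this
    · have := (within_fiber_iff q ((hsurj p).mpr hp (e s))).mp
        (hR _ (mem_map_of_mem _ (mem_univ s)))
      simpa only [mem_fiber, h₁] using this
  · rintro ⟨⟨hp, hC⟩, hq, hR⟩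
    refine ⟨hp, hq, ?_, ?_, hdisj⟩
    · simp only [mem_map, mem_univ, true_and, forall_exists_index, forall_apply_eq_imp_iff]
      intro s
      rw [within_fiber_iff q ((hsurj p).mpr hp (e s))]
      simpa only [mem_fiber, h₁] using hR s
    · simp only [mem_map, mem_univ, true_and, forall_exists_index, forall_apply_eq_imp_iff]
      intro s
      rw [within_fiber_iff p ((hsurj q).mpr hq (e' s))]
      simpa only [mem_fiber, h₂] using hC s

open Classical in
theorem reduced_term_eq_sum_compatible {a b k l : ℕ} (p : α → Fin k) (q : α → Fin l)
    (e : Fin a ↪ Fin k) (e' : Fin b ↪ Fin l) :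
    (if (∀ i, (fiber p i).Nonempty) ∧ (∀ j, (fiber q j).Nonempty) ∧
        (∀ i ∈ univ.map e, Within (fiber q) (fiber p i)) ∧
        (∀ j ∈ univ.map e', Within (fiber p) (fiber q j)) ∧
        ∀ i ∈ univ.map e, ∀ j ∈ univ.map e', Disjoint (fiber p i) (fiber q j)
      then (∏ i ∈ univ.map e, clusterWeight #(fiber p i)) *
        ∏ j ∈ univ.map e', clusterWeight #(fiber q j) else 0) =
    ∑ τ : α → Option (Fin a ⊕ Fin b),
      if Compatible τ e p ∧ Compatible (fun x => (τ x).map Sum.swap) e' q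
        then ∏ s, clusterWeight #{x | τ x = some s} else 0 := by
  have hs : ∀ (τ : α → Option (Fin a ⊕ Fin b)) x s,
      (τ x).map Sum.swap = some (.inl s) ↔ τ x = some (.inr s) := fun τ x s => by
    rcases τ x with _ | t | t <;> simp
  by_cases hdisj : ∀ i ∈ univ.map e, ∀ j ∈ univ.map e', Disjoint (fiber p i) (fiber q j)
  · have hex : ∀ x, ∃ o : Option (Fin a ⊕ Fin b), (∀ s, p x = e s ↔ o = some (.inl s)) ∧
        ∀ s, q x = e' s ↔ o = some (.inr s) := by
      intro x
      by_cases h₁ : ∃ s, p x = e s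
      · obtain ⟨s, hs⟩ := h₁
        refine ⟨some (.inl s), fun t => by simp [hs], fun t => ?_⟩
        simp only [Option.some.injEq, reduceCtorEq, iff_false]
        intro ht
        exact disjoint_left.mp (hdisj _ (mem_map_of_mem _ (mem_univ s)) _
          (mem_map_of_mem _ (mem_univ t))) ((mem_fiber ..).mpr hs) ((mem_fiber ..).mpr ht)
      · by_cases h₂ : ∃ s, q x = e' s
        · obtain ⟨s, hs⟩ := h₂
          refine ⟨some (.inr s), fun t => ?_, fun t => by simp [hs]⟩
          simpa using fun h => h₁ ⟨t, h⟩
        · refine ⟨none, fun t => ?_, fun t => ?_⟩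
          · simpa using fun h => h₁ ⟨t, h⟩
          · simpa using fun h => h₂ ⟨t, h⟩
    choose τ h₁ h₂ using hex
    rw [sum_eq_single τ]
    · refine if_congr (reduced_conditions_iff_compatible h₁ h₂) ?_ rfl
      rw [Fintype.prod_sum_type, prod_map, prod_map]
      congr 1
      · exact prod_congr rfl fun s _ => by simp only [fiber, h₁]
      · exact prod_congr rfl fun s _ => by simp only [fiber, h₂]
    · intro τ' _ hne
      refine if_neg fun h => hne ?_
      funext x
      ext s
      rcases s with s | s
      · rw [← h₁, ← h.1.2.1]
      · rw [← h₂, ← hs, ← h.2.2.1]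
    · exact fun h => absurd (mem_univ _) h
  · rw [if_neg fun h => hdisj h.2.2.2.2, sum_eq_zero]
    intro τ _
    refine if_neg fun h => hdisj ?_
    exact ((reduced_conditions_iff_compatible h.1.2.1
      fun x s => (h.2.2.1 x s).trans (hs τ x s)).mpr h).2.2.2.2

open Classical in
theorem sum_reduced_term_eq (N : ℕ) {k l : ℕ} (hk : k < N) (hl : l < N) :
    (∑ p : α → Fin k, ∑ q : α → Fin l, ∑ R : Finset (Fin k), ∑ C : Finset (Fin l),
      if (∀ i, (fiber p i).Nonempty) ∧ (∀ j, (fiber q j).Nonempty) ∧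
        (∀ i ∈ R, Within (fiber q) (fiber p i)) ∧ (∀ j ∈ C, Within (fiber p) (fiber q j)) ∧
        (∀ i ∈ R, ∀ j ∈ C, Disjoint (fiber p i) (fiber q j)) then
      (∏ i ∈ R, clusterWeight #(fiber p i)) * ∏ j ∈ C, clusterWeight #(fiber q j) else 0) =
    ∑ a ∈ range N, ∑ b ∈ range N, (1 / (a.factorial : ℚ)) * (1 / (b.factorial : ℚ)) *
      ∑ τ : α → Option (Fin a ⊕ Fin b), (∏ s, clusterWeight #{x | τ x = some s}) *
        (∑ e : Fin a ↪ Fin k, (#{p | Compatible τ e p} : ℚ)) *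
        ∑ e' : Fin b ↪ Fin l, (#{q | Compatible (fun x => (τ x).map Sum.swap) e' q} : ℚ) := by
  have hpq : ∀ (p : α → Fin k) (q : α → Fin l), (∑ R : Finset (Fin k), ∑ C : Finset (Fin l),
      if (∀ i, (fiber p i).Nonempty) ∧ (∀ j, (fiber q j).Nonempty) ∧
        (∀ i ∈ R, Within (fiber q) (fiber p i)) ∧ (∀ j ∈ C, Within (fiber p) (fiber q j)) ∧
        (∀ i ∈ R, ∀ j ∈ C, Disjoint (fiber p i) (fiber q j)) then
      (∏ i ∈ R, clusterWeight #(fiber p i)) * ∏ j ∈ C, clusterWeight #(fiber q j) else 0) =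
      ∑ a ∈ range N, ∑ b ∈ range N, (1 / (a.factorial : ℚ)) * (1 / (b.factorial : ℚ)) *
        ∑ τ : α → Option (Fin a ⊕ Fin b), (∏ s, clusterWeight #{x | τ x = some s}) *
        ∑ e : Fin a ↪ Fin k, ∑ e' : Fin b ↪ Fin l,
          ((if Compatible τ e p then 1 else 0 : ℚ) *
            if Compatible (fun x => (τ x).map Sum.swap) e' q then 1 else 0) := by
    intro p q
    rw [sum_finset_eq_sum_embedding hk]
    refine sum_congr rfl fun a _ => ?_
    simp_rw [sum_finset_eq_sum_embedding hl, mul_assoc, ← mul_sum]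
    congr 1
    rw [sum_comm]
    refine sum_congr rfl fun b _ => ?_
    rw [← mul_sum]
    congr 1
    simp_rw [reduced_term_eq_sum_compatible, mul_sum]
    rw [sum_comm_cycle]
    refine sum_congr rfl fun τ _ => sum_congr rfl fun e _ => sum_congr rfl fun e' _ => ?_
    by_cases h₁ : Compatible τ e p <;>
      by_cases h₂ : Compatible (fun x => (τ x).map Sum.swap) e' q <;> simp [h₁, h₂]
  simp_rw [hpq]
  rw [sum_comm_cycle]
  refine sum_congr rfl fun a _ => ?_
  rw [sum_comm_cycle]
  refine sum_congr rfl fun b _ => ?_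
  simp_rw [← mul_sum]
  congr 1
  rw [sum_comm_cycle]
  refine sum_congr rfl fun τ _ => ?_
  simp_rw [← mul_sum, mul_assoc]
  congr 1
  simp_rw [← sum_boole]
  rw [sum_mul_sum, sum_comm_cycle]
  refine sum_congr rfl fun e _ => ?_
  rw [← sum_mul_sum, ← mul_sum, sum_comm]

open Classical in
theorem sum_card_isReduced_eq_sum_option {N : ℕ} (hN : Fintype.card α < N) :
    ∑ k ∈ range N, ∑ l ∈ range N,
        (#{f : α → Fin k × Fin l | IsReduced (univ.image f)} : ℚ) =
      ∑ a ∈ range N, ∑ b ∈ range N, (1 / (a.factorial : ℚ)) * (1 / (b.factorial : ℚ)) *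
        ∑ τ : α → Option (Fin a ⊕ Fin b), (∏ s, clusterWeight #{x | τ x = some s}) *
          genFubini (#{x | τ x = none} + (a + b)) a *
          genFubini (#{x | τ x = none} + (a + b)) b := by
  rw [sum_card_isReduced hN]
  rw [sum_congr rfl fun k hk => sum_congr rfl fun l hl =>
    sum_reduced_term_eq N (mem_range.mp hk) (mem_range.mp hl)]
  have hτ : ∀ (a b : ℕ) (τ : α → Option (Fin a ⊕ Fin b)),
      (∏ s, clusterWeight #{x | τ x = some s}) *
          genFubini (#{x | τ x = none} + (a + b)) a *
          genFubini (#{x | τ x = none} + (a + b)) b =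
      ∑ k ∈ range N, ∑ l ∈ range N, (∏ s, clusterWeight #{x | τ x = some s}) *
        (∑ e : Fin a ↪ Fin k, (#{p | Compatible τ e p} : ℚ)) *
        ∑ e' : Fin b ↪ Fin l, (#{q | Compatible (fun x => (τ x).map Sum.swap) e' q} : ℚ) := by
    intro a b τ
    by_cases h : ∀ s, ∃ x, τ x = some s
    · have h' : ∀ s, ∃ x, (τ x).map Sum.swap = some s := fun s => by
        obtain ⟨x, hx⟩ := h s.swap
        exact ⟨x, by simp [hx]⟩
      have h₁ := sum_card_compatible hN h
      have h₂ := sum_card_compatible hN h'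
      simp only [Option.map_eq_none_iff, add_comm b a] at h₂
      rw [← h₁, ← h₂, Nat.cast_sum, Nat.cast_sum]
      simp_rw [← mul_sum, ← sum_mul, ← mul_sum, Nat.cast_sum]
      congr!
    · push Not at h
      obtain ⟨s, hs⟩ := h
      have : ∏ s, clusterWeight #{x | τ x = some s} = 0 := by
        refine prod_eq_zero (mem_univ s) ?_
        rw [filter_false_of_mem fun x _ => hs x]
        simp [clusterWeight]
      simp [this]
  simp_rw [hτ]
  rw [sum_comm_cycle]
  refine sum_congr rfl fun a _ => ?_
  rw [sum_comm_cycle]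
  refine sum_congr rfl fun b _ => ?_
  refine (sum_congr rfl fun k _ => (mul_sum ..).symm).trans ((mul_sum ..).symm.trans ?_)
  rw [sum_comm_cycle]

/-- The sum over all ways to distribute `t` labelled points into `c` labelled parts of the product
of the cluster weights of the parts. -/
def clusterSum : ℕ → ℕ → ℚ
  | 0, t => if t = 0 then 1 else 0
  | c + 1, t => ∑ j ∈ range (t + 1), (t.choose j : ℚ) * (clusterWeight j * clusterSum c (t - j))

theorem sum_parts_prod_clusterWeight : ∀ (c : ℕ) (X : Finset α),
    ∑ F ∈ parts c X, ∏ i, clusterWeight #(F i) = clusterSum c #X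
  | 0, X => by
    rw [sum_parts_zero X fun F => ∏ i, clusterWeight #(F i), clusterSum]
    simp
  | c + 1, X => by
    rw [sum_parts_succ X fun F => ∏ i, clusterWeight #(F i), clusterSum]
    simp_rw [Fin.prod_univ_succ, Fin.cons_zero, Fin.cons_succ, ← mul_sum,
      sum_parts_prod_clusterWeight c]
    rw [sum_congr rfl fun B hB => by rw [card_sdiff_of_subset (mem_powerset.mp hB)],
      sum_powerset_apply_card fun j => clusterWeight j * clusterSum c (#X - j)]
    simp_rw [nsmul_eq_mul]

theorem sum_option_eq_sum_clusterSum (a b : ℕ) (h : ℕ → ℚ) :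
    ∑ τ : α → Option (Fin a ⊕ Fin b),
      (∏ s, clusterWeight #{x | τ x = some s}) * h #{x | τ x = none} =
    ∑ t ∈ range (Fintype.card α + 1), ((Fintype.card α).choose t : ℚ) *
      (clusterSum (a + b) t * h (Fintype.card α - t)) := by
  let σ : Option (Fin a ⊕ Fin b) ≃ Fin (a + b + 1) :=
    finSumFinEquiv.optionCongr.trans (finSuccEquiv (a + b)).symm
  have h₀ : σ none = 0 := rfl
  have h₁ : ∀ s, σ (some s) = (finSumFinEquiv s).succ := fun s => rfl
  clear_value σ
  have hp : ∀ τ : α → Option (Fin a ⊕ Fin b),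
      (∏ s, clusterWeight #{x | τ x = some s}) * h #{x | τ x = none} =
      (∏ i : Fin (a + b), clusterWeight #{x | σ (τ x) = i.succ}) * h #{x | σ (τ x) = 0} := by
    intro τ
    rw [← finSumFinEquiv.prod_comp]
    simp_rw [← h₁, ← h₀, σ.apply_eq_iff_eq]
  simp_rw [hp]
  refine (((Equiv.refl α).arrowCongr σ).sum_comp fun p : α → Fin (a + b + 1) =>
    (∏ i : Fin (a + b), clusterWeight #{x | p x = i.succ}) * h #{x | p x = 0}).trans ?_
  rw [sum_fun_eq_sum_parts fun F : Fin (a + b + 1) → Finset α =>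
    (∏ i : Fin (a + b), clusterWeight #(F i.succ)) * h #(F 0), sum_parts_succ]
  simp_rw [Fin.cons_zero, Fin.cons_succ, ← sum_mul, sum_parts_prod_clusterWeight]
  rw [sum_congr rfl fun B hB => by rw [card_sdiff_of_subset (mem_powerset.mp hB), card_univ],
    sum_powerset_apply_card fun j => clusterSum (a + b) (Fintype.card α - j) * h j, card_univ,
    ← sum_flip]
  refine sum_congr rfl fun t ht => ?_
  have ht' : t ≤ Fintype.card α := Nat.lt_succ_iff.mp (mem_range.mp ht)
  rw [Nat.sub_sub_self ht', Nat.choose_symm ht', nsmul_eq_mul]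

theorem sum_card_isReduced_eq_sum_clusterSum {N : ℕ} (hN : Fintype.card α < N) :
    open Classical in ∑ k ∈ range N, ∑ l ∈ range N,
        (#{f : α → Fin k × Fin l | IsReduced (univ.image f)} : ℚ) =
      ∑ a ∈ range N, ∑ b ∈ range N, (1 / (a.factorial : ℚ)) * (1 / (b.factorial : ℚ)) *
        ∑ t ∈ range (Fintype.card α + 1), ((Fintype.card α).choose t : ℚ) *
          (clusterSum (a + b) t * ((genFubini (Fintype.card α - t + (a + b)) a : ℚ) *
            genFubini (Fintype.card α - t + (a + b)) b)) := by
  rw [sum_card_isReduced_eq_sum_option hN]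
  refine sum_congr rfl fun a _ => sum_congr rfl fun b _ => congrArg _ ?_
  rw [← sum_option_eq_sum_clusterSum a b fun r =>
    (genFubini (r + (a + b)) a : ℚ) * genFubini (r + (a + b)) b]
  refine sum_congr rfl fun τ _ => ?_
  rw [mul_assoc]

end Counting

section Series

open PowerSeries in
theorem coeff_exp_sub_one_pow : ∀ t n : ℕ,
    coeff t ((PowerSeries.exp ℚ - 1) ^ n) = (n.factorial * S2 t n : ℚ) / t.factorial
  | 0, 0 => by simp [S2]
  | 0, n + 1 => by simp [S2]
  | t + 1, 0 => by simp [S2, PowerSeries.coeff_one]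
  | t + 1, n + 1 => by
    have hd : derivative ℚ ((PowerSeries.exp ℚ - 1) ^ (n + 1)) =
        (n + 1 : ℚ) • ((PowerSeries.exp ℚ - 1) ^ (n + 1) + (PowerSeries.exp ℚ - 1) ^ n) := by
      rw [Derivation.leibniz_pow, map_sub, derivative_exp]
      simp only [add_tsub_cancel_right, nsmul_eq_mul, smul_eq_mul,
        Derivation.map_one_eq_zero, sub_zero, Algebra.smul_def, map_add, map_natCast, map_one]
      push_cast
      ring
    have h := congrArg (coeff t) hd
    rw [coeff_derivative, map_smul, map_add, coeff_exp_sub_one_pow t (n + 1),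
      coeff_exp_sub_one_pow t n] at h
    have h₀ : (t + 1 : ℚ) ≠ 0 := by positivity
    rw [← eq_div_iff h₀] at h
    rw [h, S2, Nat.factorial_succ, Nat.factorial_succ]
    have h₁ : (t.factorial : ℚ) ≠ 0 := by positivity
    push_cast
    rw [smul_eq_mul]
    field_simp

/-- The exponential generating function of the cluster weights. -/
noncomputable def clusterSeries : PowerSeries ℚ :=
  2 - PowerSeries.exp ℚ - PowerSeries.evalNegHom (PowerSeries.exp ℚ)

theorem coeff_clusterSeries (j : ℕ) :
    PowerSeries.coeff j clusterSeries = clusterWeight j / j.factorial := by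
  have h2 : PowerSeries.coeff j (2 : PowerSeries ℚ) = if j = 0 then 2 else 0 := by
    rw [show (2 : PowerSeries ℚ) = PowerSeries.C 2 from (map_ofNat PowerSeries.C 2).symm,
      PowerSeries.coeff_C]
  rw [clusterSeries, map_sub, map_sub, h2, PowerSeries.evalNegHom, PowerSeries.coeff_rescale,
    PowerSeries.coeff_exp, clusterWeight]
  split_ifs with h
  · subst h
    norm_num
  · simp
    ring

theorem exp_mul_clusterSeries :
    PowerSeries.exp ℚ * clusterSeries = -(PowerSeries.exp ℚ - 1) ^ 2 := by
  have h := PowerSeries.exp_mul_exp_neg_eq_one (A := ℚ)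
  rw [clusterSeries]
  linear_combination -h

theorem coeff_clusterSeries_pow : ∀ c t : ℕ,
    PowerSeries.coeff t (clusterSeries ^ c) = clusterSum c t / t.factorial
  | 0, t => by
    rw [pow_zero, PowerSeries.coeff_one, clusterSum]
    split_ifs with h <;> simp [h]
  | c + 1, t => by
    rw [pow_succ', PowerSeries.coeff_mul, Finset.Nat.sum_antidiagonal_eq_sum_range_succ fun i j =>
      PowerSeries.coeff i clusterSeries * PowerSeries.coeff j (clusterSeries ^ c), clusterSum,
      sum_div]
    refine sum_congr rfl fun j hj => ?_
    rw [coeff_clusterSeries, coeff_clusterSeries_pow c,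
      Nat.cast_choose ℚ (Nat.lt_succ_iff.mp (mem_range.mp hj))]
    have h₁ : (t.factorial : ℚ) ≠ 0 := by positivity
    field_simp

theorem X_pow_dvd_clusterSeries_pow_sub (N : ℕ) : ∀ d : ℕ,
    PowerSeries.X ^ N ∣ clusterSeries ^ (d + 1) - ∑ i ∈ range N,
      (-1) ^ (i + 1) * (i.choose d : PowerSeries ℚ) * (PowerSeries.exp ℚ - 1) ^ (d + i + 2) := by
  have hW := exp_mul_clusterSeries
  have hunit : IsUnit (PowerSeries.exp ℚ) := by
    rw [PowerSeries.isUnit_iff_constantCoeff]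
    simp
  have hX : PowerSeries.X ∣ PowerSeries.exp ℚ - 1 := by
    rw [PowerSeries.X_dvd_iff]
    simp
  have hpow : ∀ r, PowerSeries.X ^ N ∣ (PowerSeries.exp ℚ - 1) ^ (N + r) := fun r =>
    (pow_dvd_pow_of_dvd hX N).trans (pow_dvd_pow _ (Nat.le_add_right N r))
  intro d
  rw [← hunit.dvd_mul_left]
  induction d with
  | zero =>
    have h : ∀ M, PowerSeries.exp ℚ * ∑ i ∈ range M, (-1) ^ (i + 1) *
        (i.choose 0 : PowerSeries ℚ) * (PowerSeries.exp ℚ - 1) ^ (0 + i + 2) =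
        -(PowerSeries.exp ℚ - 1) ^ 2 + (-1) ^ M * (PowerSeries.exp ℚ - 1) ^ (M + 2) := by
      intro M
      induction M with
      | zero => simp
      | succ M ih =>
        rw [sum_range_succ, mul_add, ih]
        simp only [Nat.choose_zero_right, Nat.cast_one]
        ring
    rw [mul_sub, h, zero_add, pow_one, hW]
    rw [sub_add_cancel_left]
    exact ((hpow 2).mul_left _).neg_right
  | succ d ih =>
    have h : ∀ M, PowerSeries.exp ℚ * ∑ i ∈ range M, (-1) ^ (i + 1) *
        (i.choose (d + 1) : PowerSeries ℚ) * (PowerSeries.exp ℚ - 1) ^ (d + 1 + i + 2) =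
        -(PowerSeries.exp ℚ - 1) ^ 2 * (∑ i ∈ range M, (-1) ^ (i + 1) *
          (i.choose d : PowerSeries ℚ) * (PowerSeries.exp ℚ - 1) ^ (d + i + 2)) +
        (-1) ^ M * (M.choose (d + 1) : PowerSeries ℚ) *
          (PowerSeries.exp ℚ - 1) ^ (M + (d + 3)) := by
      intro M
      induction M with
      | zero => simp
      | succ M ih =>
        rw [sum_range_succ, mul_add, ih, sum_range_succ, Nat.choose_succ_succ]
        push_cast
        ring
    have ih' := hunit.dvd_mul_left.mp ih
    rw [mul_sub, h, pow_succ, ← mul_assoc, mul_right_comm, hW, ← sub_sub, ← mul_sub]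
    exact dvd_sub (ih'.mul_left _) ((hpow _).mul_left _)

theorem clusterSum_eq (c t : ℕ) : clusterSum c t = ∑ k ∈ Icc c (t - c),
    (-1 : ℚ) ^ k * ((c + k).factorial : ℚ) * (S2 t (c + k) : ℚ) *
      ((k - 1).choose (k - c) : ℚ) := by
  rcases c with _ | d
  · rw [clusterSum, sum_eq_single 0]
    · cases t <;> simp [S2]
    · intro k _ hk
      rw [Nat.choose_eq_zero_of_lt (by omega)]
      simp
    · simp
  · have h₁ : (t.factorial : ℚ) ≠ 0 := by positivity
    have h := PowerSeries.X_pow_dvd_iff.mp (X_pow_dvd_clusterSeries_pow_sub (t + 1) d) t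
      (Nat.lt_succ_self t)
    rw [map_sub, sub_eq_zero, coeff_clusterSeries_pow, map_sum, div_eq_iff h₁, sum_mul] at h
    rw [h]
    have hi : ∀ i, PowerSeries.coeff t ((-1) ^ (i + 1) * (i.choose d : PowerSeries ℚ) *
        (PowerSeries.exp ℚ - 1) ^ (d + i + 2)) * t.factorial =
        (-1 : ℚ) ^ (i + 1) * ((d + 1 + (i + 1)).factorial : ℚ) * (S2 t (d + 1 + (i + 1)) : ℚ) *
      (i.choose d : ℚ) := by
      intro i
      have : (-1) ^ (i + 1) * (i.choose d : PowerSeries ℚ) =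
          PowerSeries.C ((-1 : ℚ) ^ (i + 1) * (i.choose d : ℚ)) := by simp
      rw [this, PowerSeries.coeff_C_mul, coeff_exp_sub_one_pow,
        show d + 1 + (i + 1) = d + i + 2 by omega]
      field_simp
    have hshift := sum_Ico_add' (fun k => (-1 : ℚ) ^ k * ((d + 1 + k).factorial : ℚ) *
      (S2 t (d + 1 + k) : ℚ) * ((k - 1).choose d : ℚ)) 0 (t + 1) 1
    rw [sum_congr rfl fun i _ => hi i, range_eq_Ico]
    refine hshift.trans (sum_subset_zero_on_sdiff (fun k hk => ?_) (fun k hk => ?_)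
      fun k hk => ?_).symm
    · rw [mem_Icc] at hk
      rw [mem_Ico]
      omega
    · rw [mem_sdiff, mem_Ico, mem_Icc] at hk
      by_cases hkd : k < d + 1
      · rw [Nat.choose_eq_zero_of_lt (by omega)]
        simp
      · rw [S2_eq_zero_of_lt (by omega)]
        simp
    · rw [mem_Icc] at hk
      rw [← Nat.choose_symm (show k - (d + 1) ≤ k - 1 by omega),
        show k - 1 - (k - (d + 1)) = d by omega]

end Series

theorem clusterSum_eq_zero_of_lt {c t : ℕ} (h : t < 2 * c) : clusterSum c t = 0 := by
  rw [clusterSum_eq, Icc_eq_empty (by omega), sum_empty]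

theorem sum_range_range_eq_sum_antidiagonal {N M : ℕ} (hMN : M ≤ N) (Φ : ℕ → ℕ → ℚ)
    (hΦ : ∀ a b, M ≤ a + b → Φ a b = 0) :
    ∑ a ∈ range N, ∑ b ∈ range N, Φ a b =
      ∑ c ∈ range M, ∑ j ∈ range (c + 1), Φ j (c - j) := by
  have hne : ∀ x ∈ range N ×ˢ range N, Φ x.1 x.2 ≠ 0 → x.1 + x.2 ∈ range M := fun x _ hx =>
    mem_range.mpr (not_le.mp fun h => hx (hΦ _ _ h))
  rw [← sum_product', ← sum_filter_of_ne hne,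
    ← sum_fiberwise_of_maps_to fun x hx => (mem_filter.mp hx).2]
  refine sum_congr rfl fun c hc => ?_
  rw [← Finset.Nat.sum_antidiagonal_eq_sum_range_succ Φ]
  refine sum_congr ?_ fun x _ => rfl
  ext x
  simp only [mem_filter, mem_product, mem_range, HasAntidiagonal.mem_antidiagonal] at hc ⊢
  omega

theorem sum_clusterSum_eq {N m : ℕ} (hm : m < N) :
    (∑ a ∈ range N, ∑ b ∈ range N, (1 / (a.factorial : ℚ)) * (1 / (b.factorial : ℚ)) *
      ∑ t ∈ range (m + 1), (m.choose t : ℚ) *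
        (clusterSum (a + b) t * ((genFubini (m - t + (a + b)) a : ℚ) *
          genFubini (m - t + (a + b)) b))) =
    ∑ c ∈ range (m / 2 + 1), ∑ t ∈ Icc (2 * c) m, (m.choose t : ℚ) * clusterSum c t *
      ∑ j ∈ range (c + 1), ((genFubini (m - t + c) j : ℚ) * (genFubini (m - t + c) (c - j) : ℚ)) /
        ((j.factorial : ℚ) * ((c - j).factorial : ℚ)) := by
  rw [sum_range_range_eq_sum_antidiagonal (M := m / 2 + 1) (by omega)]
  · refine sum_congr rfl fun c _ => ?_
    have hj : ∀ j ∈ range (c + 1), (1 / (j.factorial : ℚ)) * (1 / ((c - j).factorial : ℚ)) *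
        ∑ t ∈ range (m + 1), (m.choose t : ℚ) *
          (clusterSum (j + (c - j)) t * ((genFubini (m - t + (j + (c - j))) j : ℚ) *
            genFubini (m - t + (j + (c - j))) (c - j))) =
        ∑ t ∈ Icc (2 * c) m, (m.choose t : ℚ) * clusterSum c t *
          (((genFubini (m - t + c) j : ℚ) * (genFubini (m - t + c) (c - j) : ℚ)) /
            ((j.factorial : ℚ) * ((c - j).factorial : ℚ))) := by
      intro j hj
      rw [Nat.add_sub_cancel' (Nat.lt_succ_iff.mp (mem_range.mp hj)), mul_sum]
      symm
      refine sum_subset_zero_on_sdiff (fun t ht => ?_) (fun t ht => ?_) fun t _ => ?_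
      · rw [mem_Icc] at ht
        rw [mem_range]
        omega
      · rw [mem_sdiff, mem_range, mem_Icc] at ht
        rw [clusterSum_eq_zero_of_lt (by omega)]
        simp
      · field_simp
    rw [sum_congr rfl hj, sum_comm]
    simp_rw [mul_sum]
  · intro a b hab
    rw [sum_eq_zero, mul_zero]
    intro t ht
    rw [mem_range] at ht
    rw [clusterSum_eq_zero_of_lt (by omega)]
    simp

end ParabolicCount

open ParabolicCount Finset in
theorem pn_formula (n : ℕ) :
    (pdcCount n : ℚ) = (1 / (Nat.factorial n : ℚ)) *
      ∑ m ∈ Finset.range (n + 1), (c1 n m : ℚ) *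
        ∑ c ∈ Finset.range (m / 2 + 1), ∑ t ∈ Finset.Icc (2 * c) m,
          (Nat.choose m t : ℚ) *
          (∑ k ∈ Finset.Icc c (t - c),
            (-1 : ℚ) ^ k * (Nat.factorial (c + k) : ℚ) * (S2 t (c + k) : ℚ) *
              (Nat.choose (k - 1) (k - c) : ℚ)) *
          (∑ j ∈ Finset.range (c + 1),
            ((genFubini (m - t + c) j : ℚ) * (genFubini (m - t + c) (c - j) : ℚ)) /
              ((Nat.factorial j : ℚ) * (Nat.factorial (c - j) : ℚ))) := by
  classical
  rw [pdcCount_eq_sum_sym, Nat.cast_sum]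
  simp_rw [Nat.cast_sum]
  have h : ∀ k l : ℕ, (#{s : Sym (Fin k × Fin l) n |
      IsReduced (s : Multiset (Fin k × Fin l)).toFinset} : ℚ) =
      ∑ m ∈ range (n + 1), (1 / (n.factorial : ℚ)) * ((c1 n m : ℚ) *
        #{f : Fin m → Fin k × Fin l | IsReduced (univ.image f)}) := fun k l => by
    rw [← mul_sum]
    convert! card_sym_eq_sum_card_fun n (IsReduced (k := k) (l := l))
  rw [sum_congr rfl fun k _ => sum_congr rfl fun l _ => h k l, sum_comm_cycle, mul_sum]
  refine sum_congr rfl fun m hm => ?_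
  simp_rw [← mul_sum, ← clusterSum_eq]
  rw [← sum_clusterSum_eq (mem_range.mp hm)]
  have h' := sum_card_isReduced_eq_sum_clusterSum (α := Fin m) (N := n + 1)
    (by simpa using mem_range.mp hm)
  rw [Fintype.card_fin] at h'
  rw [← h']
end

section
/- Let C = W_{I'} w' W_{J'} be a parabolic double coset in S_n, with I', J' ⊆ S and w' ∈ S_n. Define I = {s_i ∈ S : s_i·C = C} and J = {s_i ∈ S : C·s_i = C} (where s_i·C and C·s_i denote the pointwise left and right translates of the set C). Then for every w ∈ C one has C = W_I w W_J, and moreover for any presentation of C, i.e., any I'', J'' ⊆ S and w'' ∈ S_n with C = W_{I''} w'' W_{J''}, one has I'' ⊆ I and J'' ⊆ J. -/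
theorem image_mul_left_eq_iff {G : Type*} [Group G] {C : Set G} {g : G} :
    (fun x => g * x) '' C = C ↔ ∀ x, g * x ∈ C ↔ x ∈ C := by
  constructor
  · intro h x
    conv_lhs => rw [← h]
    simp
  · intro h
    ext x
    rw [← h]
    simp [← h (g⁻¹ * x), h]

theorem image_mul_right_eq_iff {G : Type*} [Group G] {C : Set G} {g : G} :
    (fun x => x * g) '' C = C ↔ ∀ x, x * g ∈ C ↔ x ∈ C := by
  constructor
  · intro h x
    conv_lhs => rw [← h]
    simp
  · intro h
    ext x
    rw [← h]
    simp [← h (x * g⁻¹), h]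

theorem mul_mem_iff_of_mem_closure_left {G : Type*} [Group G] {C K : Set G}
    (hK : ∀ g ∈ K, ∀ x, g * x ∈ C ↔ x ∈ C) {g : G} (hg : g ∈ Subgroup.closure K) :
    ∀ x, g * x ∈ C ↔ x ∈ C := by
  induction hg using Subgroup.closure_induction with
  | mem g hg => exact hK g hg
  | one => simp
  | mul a b _ _ ha hb => intro x; rw [mul_assoc, ha, hb]
  | inv a _ ha => intro x; rw [← ha, mul_inv_cancel_left]

theorem mul_mem_iff_of_mem_closure_right {G : Type*} [Group G] {C K : Set G}
    (hK : ∀ g ∈ K, ∀ x, x * g ∈ C ↔ x ∈ C) {g : G} (hg : g ∈ Subgroup.closure K) :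
    ∀ x, x * g ∈ C ↔ x ∈ C := by
  induction hg using Subgroup.closure_induction with
  | mem g hg => exact hK g hg
  | one => simp
  | mul a b _ _ ha hb => intro x; rw [← mul_assoc, hb, ha]
  | inv a _ ha => intro x; rw [← ha, inv_mul_cancel_right]

theorem mul_mem_doubleCoset_left {n : ℕ} {I J : Set (Equiv.Perm (Fin n))}
    {w g x : Equiv.Perm (Fin n)} (hg : g ∈ Subgroup.closure I) (hx : x ∈ doubleCoset I w J) :
    g * x ∈ doubleCoset I w J := by
  obtain ⟨a, ha, b, hb, rfl⟩ := hx
  exact ⟨g * a, mul_mem hg ha, b, hb, by group⟩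

theorem mul_mem_doubleCoset_right {n : ℕ} {I J : Set (Equiv.Perm (Fin n))}
    {w g x : Equiv.Perm (Fin n)} (hg : g ∈ Subgroup.closure J) (hx : x ∈ doubleCoset I w J) :
    x * g ∈ doubleCoset I w J := by
  obtain ⟨a, ha, b, hb, rfl⟩ := hx
  exact ⟨a, ha, b * g, mul_mem hb hg, by group⟩

theorem image_mul_left_doubleCoset {n : ℕ} {I J : Set (Equiv.Perm (Fin n))}
    {w g : Equiv.Perm (Fin n)} (hg : g ∈ I) :
    (fun x => g * x) '' doubleCoset I w J = doubleCoset I w J := by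
  have hg' := Subgroup.subset_closure hg
  exact image_mul_left_eq_iff.2 fun x =>
    ⟨fun h => by simpa using mul_mem_doubleCoset_left (inv_mem hg') h,
      mul_mem_doubleCoset_left hg'⟩

theorem image_mul_right_doubleCoset {n : ℕ} {I J : Set (Equiv.Perm (Fin n))}
    {w g : Equiv.Perm (Fin n)} (hg : g ∈ J) :
    (fun x => x * g) '' doubleCoset I w J = doubleCoset I w J := by
  have hg' := Subgroup.subset_closure hg
  exact image_mul_right_eq_iff.2 fun x =>
    ⟨fun h => by simpa using mul_mem_doubleCoset_right (inv_mem hg') h,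
      mul_mem_doubleCoset_right hg'⟩

theorem maximal_presentation (n : ℕ) (I' J' : Set (Equiv.Perm (Fin n)))
    (hI' : I' ⊆ simples n) (hJ' : J' ⊆ simples n) (w' : Equiv.Perm (Fin n))
    (C : Set (Equiv.Perm (Fin n))) (hC : C = doubleCoset I' w' J')
    (I J : Set (Equiv.Perm (Fin n)))
    (hI : I = {s | s ∈ simples n ∧ (fun x => s * x) '' C = C})
    (hJ : J = {s | s ∈ simples n ∧ (fun x => x * s) '' C = C}) :
    (∀ w ∈ C, C = doubleCoset I w J) ∧
    (∀ I'' J'' : Set (Equiv.Perm (Fin n)), I'' ⊆ simples n → J'' ⊆ simples n →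
      ∀ w'' : Equiv.Perm (Fin n), C = doubleCoset I'' w'' J'' → I'' ⊆ I ∧ J'' ⊆ J) := by
  have hmax : ∀ I'' J'' : Set (Equiv.Perm (Fin n)), I'' ⊆ simples n → J'' ⊆ simples n →
      ∀ w'' : Equiv.Perm (Fin n), C = doubleCoset I'' w'' J'' → I'' ⊆ I ∧ J'' ⊆ J := by
    rintro I'' J'' hI'' hJ'' w'' rfl
    subst hI hJ
    exact ⟨fun s hs => ⟨hI'' hs, image_mul_left_doubleCoset hs⟩,
      fun s hs => ⟨hJ'' hs, image_mul_right_doubleCoset hs⟩⟩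
  refine ⟨fun w hw => ?_, hmax⟩
  obtain ⟨hII, hJJ⟩ := hmax I' J' hI' hJ' w' hC
  apply Set.Subset.antisymm
  · intro u hu
    rw [hC] at hw hu
    obtain ⟨a, ha, b, hb, rfl⟩ := hw
    obtain ⟨c, hc, d, hd, rfl⟩ := hu
    exact ⟨c * a⁻¹, Subgroup.closure_mono hII (mul_mem hc (inv_mem ha)),
      b⁻¹ * d, Subgroup.closure_mono hJJ (mul_mem (inv_mem hb) hd), by group⟩
  · rintro _ ⟨x, hx, y, hy, rfl⟩
    have hl : ∀ g ∈ I, ∀ x, g * x ∈ C ↔ x ∈ C := by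
      rw [hI]
      exact fun g hg => image_mul_left_eq_iff.1 hg.2
    have hr : ∀ g ∈ J, ∀ x, x * g ∈ C ↔ x ∈ C := by
      rw [hJ]
      exact fun g hg => image_mul_right_eq_iff.1 hg.2
    rwa [mul_mem_iff_of_mem_closure_right hr hy, mul_mem_iff_of_mem_closure_left hl hx]
end

section
/- For every n ≥ 1, the number p_n of distinct parabolic double cosets in S_n equals the number of maximal two-way contingency tables with sum n, i.e., p_n = Σ_{a=1}^{n} Σ_{b=1}^{n} #{ M : a×b matrices of nonnegative integers : the entries of M sum to n, every row sum and column sum of M is strictly positive, and M is maximal }. -/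
/-- A contingency table (given by an `a × b` matrix of naturals) is maximal if there is no
pair of vertically adjacent nonzero entries each of which is the only nonzero entry in its
row, and no pair of horizontally adjacent nonzero entries each of which is the only nonzero
entry in its column. -/
def IsMaximal {a b : ℕ} (M : Fin a → Fin b → ℕ) : Prop :=
  (¬ ∃ (i i' : Fin a) (j : Fin b), (i' : ℕ) = (i : ℕ) + 1 ∧ M i j ≠ 0 ∧ M i' j ≠ 0 ∧
      (∀ j', M i j' ≠ 0 → j' = j) ∧ (∀ j', M i' j' ≠ 0 → j' = j)) ∧
  (¬ ∃ (j j' : Fin b) (i : Fin a), (j' : ℕ) = (j : ℕ) + 1 ∧ M i j ≠ 0 ∧ M i j' ≠ 0 ∧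
      (∀ i', M i' j ≠ 0 → i' = i) ∧ (∀ i', M i' j' ≠ 0 → i' = i))

section

open Equiv Finset

variable {n : ℕ} {α β : Type*} [DecidableEq α] [DecidableEq β]

/-- The adjacent transposition exchanging `i` and `i + 1`. -/
def adjSwap (i : ℕ) (h : i + 1 < n) : Perm (Fin n) :=
  swap ⟨i, Nat.lt_of_succ_lt h⟩ ⟨i + 1, h⟩

/-- The contingency table of a permutation `u`, where `f` colours values and `g` colours
positions. -/
def permTable (f : Fin n → α) (g : Fin n → β) (u : Perm (Fin n)) (k : α) (l : β) : ℕ :=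
  #{i | f (u i) = k ∧ g i = l}

theorem permTable_inv (f : Fin n → α) (g : Fin n → β) (u : Perm (Fin n)) (k : α) (l : β) :
    permTable g f u⁻¹ l k = permTable f g u k l := by
  unfold permTable
  refine card_bij (fun i _ => u⁻¹ i) ?_ ?_ ?_
  · intro i; simp; tauto
  · intro i _ j _ h; simpa using h
  · intro i hi
    refine ⟨u i, ?_, ?_⟩
    · simp at hi ⊢; tauto
    · simp

theorem permTable_ne_zero {f : Fin n → α} {g : Fin n → β} {u : Perm (Fin n)} {k : α} {l : β} :
    permTable f g u k l ≠ 0 ↔ ∃ i, f (u i) = k ∧ g i = l := by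
  simp [permTable, Finset.card_eq_zero, Finset.filter_eq_empty_iff]

theorem permTable_mul {f : Fin n → α} {g : Fin n → β} {x u y : Perm (Fin n)}
    (hx : ∀ i, f (x i) = f i) (hy : ∀ i, g (y i) = g i) :
    permTable f g (x * u * y) = permTable f g u := by
  ext k l
  unfold permTable
  refine card_bij (fun i _ => y i) ?_ ?_ ?_
  · intro i; simp [hx, hy]
  · intro i _ j _ h; simpa using h
  · intro i hi
    refine ⟨y⁻¹ i, ?_, by simp⟩
    have := hy (y⁻¹ i)
    simp at this
    simpa [hx, ← this] using hi

theorem exists_perm_of_card_fiber_eq {φ ψ : Fin n → α}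
    (h : ∀ c, #{i | φ i = c} = #{i | ψ i = c}) : ∃ y : Perm (Fin n), ∀ i, ψ (y i) = φ i := by
  have e : ∀ c, Nonempty ({i // φ i = c} ≃ {i // ψ i = c}) := fun c =>
    ⟨Fintype.equivOfCardEq (by simpa [Fintype.card_subtype] using h c)⟩
  exact ⟨Equiv.ofFiberEquiv fun c => (e c).some, fun i => Equiv.ofFiberEquiv_map _ i⟩

theorem permTable_eq_iff {f : Fin n → α} {g : Fin n → β} {u w : Perm (Fin n)} :
    permTable f g u = permTable f g w ↔
      ∃ x : Perm (Fin n), (∀ i, f (x i) = f i) ∧ ∃ y : Perm (Fin n), (∀ i, g (y i) = g i) ∧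
        u = x * w * y := by
  constructor
  · intro h
    obtain ⟨y, hy⟩ := exists_perm_of_card_fiber_eq (φ := fun i => (f (u i), g i))
      (ψ := fun i => (f (w i), g i)) (fun c => by
        simpa [permTable, Prod.ext_iff] using congrFun (congrFun h c.1) c.2)
    simp only [Prod.mk.injEq] at hy
    refine ⟨u * y⁻¹ * w⁻¹, fun i => ?_, y, fun i => (hy i).2, by simp⟩
    have := (hy (y⁻¹ (w⁻¹ i))).1
    simpa using this.symm
  · rintro ⟨x, hx, y, hy, rfl⟩
    exact permTable_mul hx hy

theorem closure_adjSwap_eq {γ : Type*} [LinearOrder γ] {f : Fin n → γ} (hf : Monotone f)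
    {I : Set (Perm (Fin n))}
    (hI : ∀ s, s ∈ I ↔ ∃ i h, s = adjSwap i h ∧ f ⟨i, Nat.lt_of_succ_lt h⟩ = f ⟨i + 1, h⟩)
    (x : Perm (Fin n)) : x ∈ Subgroup.closure I ↔ ∀ i, f (x i) = f i := by
  constructor
  · intro hx
    induction hx using Subgroup.closure_induction with
    | mem s hs =>
      obtain ⟨i, h, rfl, e⟩ := (hI s).1 hs
      intro j
      unfold adjSwap
      rw [swap_apply_def]
      split_ifs <;> simp_all
    | one => simp
    | mul x y _ _ hx hy => intro i; simp [hx, hy]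
    | inv x _ hx => intro i; simpa using (hx (x⁻¹ i)).symm
  · intro hx
    rw [mem_closure_isSwap]
    · refine ⟨Set.toFinite _, ?_⟩
      have key : ∀ (d i : ℕ) (h : i + d < n), f ⟨i, by omega⟩ = f ⟨i + d, h⟩ →
          (⟨i + d, h⟩ : Fin n) ∈ MulAction.orbit (Subgroup.closure I) (⟨i, by omega⟩ : Fin n) := by
        intro d
        induction d with
        | zero => intro i h _; exact MulAction.mem_orbit_self _
        | succ d ih =>
          intro i h e
          have h1 : f ⟨i, by omega⟩ ≤ f ⟨i + d, by omega⟩ := hf (by simp)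
          have h2 : f ⟨i + d, by omega⟩ ≤ f ⟨i + (d + 1), by omega⟩ := hf (by simp)
          have h3 := ih i (by omega) (le_antisymm h1 (h2.trans e.symm.le))
          have h4 : adjSwap (i + d) h ∈ Subgroup.closure I := Subgroup.subset_closure
            ((hI _).2 ⟨i + d, h, rfl, le_antisymm h2 (e.symm.le.trans h1)⟩)
          have h5 := MulAction.mem_orbit_of_mem_orbit ⟨_, h4⟩ h3
          simpa [adjSwap, Subgroup.smul_def, ← add_assoc] using h5
      have key' : ∀ i j : Fin n, i ≤ j → f i = f j →
          j ∈ MulAction.orbit (Subgroup.closure I) i := by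
        rintro ⟨i, hi⟩ ⟨j, hj⟩ hij e
        obtain ⟨d, rfl⟩ := Nat.exists_eq_add_of_le (show i ≤ j from hij)
        exact key d i hj e
      intro i
      rcases le_total i (x i) with h | h
      · exact key' _ _ h (hx i).symm
      · exact MulAction.mem_orbit_symm.1 (key' _ _ h (hx i))
    · intro s hs
      obtain ⟨i, h, rfl, -⟩ := (hI s).1 hs
      exact ⟨_, _, by simp, rfl⟩

/-- `C` is stable under left multiplication by the `i`-th adjacent transposition. -/
def LeftStable (C : Set (Perm (Fin n))) (i : ℕ) : Prop :=
  ∀ h : i + 1 < n, ∀ u, adjSwap i h * u ∈ C ↔ u ∈ C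

theorem leftStable_of_eq {f : Fin n → α} {g : Fin n → β} {M : α → β → ℕ} {i : ℕ}
    {h : i + 1 < n} (e : f ⟨i, Nat.lt_of_succ_lt h⟩ = f ⟨i + 1, h⟩) :
    LeftStable {u | permTable f g u = M} i := by
  intro h u
  have := permTable_mul (f := f) (g := g) (x := adjSwap i h) (u := u) (y := 1) (by
    intro j
    unfold adjSwap
    rw [swap_apply_def]
    split_ifs <;> simp_all) (by simp)
  simp only [mul_one] at this
  simp [this]

theorem val_succ_of_ne {a : ℕ} {f : Fin n → Fin a} (hf : Monotone f)
    (hs : Function.Surjective f) {i : ℕ} (h : i + 1 < n)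
    (e : f ⟨i, Nat.lt_of_succ_lt h⟩ ≠ f ⟨i + 1, h⟩) :
    (f ⟨i + 1, h⟩ : ℕ) = f ⟨i, Nat.lt_of_succ_lt h⟩ + 1 := by
  have h1 : f ⟨i, Nat.lt_of_succ_lt h⟩ < f ⟨i + 1, h⟩ := lt_of_le_of_ne (hf (by simp)) e
  by_contra hne
  have h2 : (f ⟨i, Nat.lt_of_succ_lt h⟩ : ℕ) + 1 < f ⟨i + 1, h⟩ := by
    have : (f ⟨i, Nat.lt_of_succ_lt h⟩ : ℕ) < f ⟨i + 1, h⟩ := h1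
    omega
  obtain ⟨⟨j, hj⟩, hj'⟩ := hs ⟨f ⟨i, Nat.lt_of_succ_lt h⟩ + 1, by omega⟩
  have hv := congrArg Fin.val hj'
  simp only at hv
  rcases Nat.lt_or_ge i j with hij | hij
  · have : f ⟨i + 1, h⟩ ≤ f ⟨j, hj⟩ := hf (by simpa using hij)
    have : (f ⟨i + 1, h⟩ : ℕ) ≤ f ⟨j, hj⟩ := this
    omega
  · have : f ⟨j, hj⟩ ≤ f ⟨i, Nat.lt_of_succ_lt h⟩ := hf (by simpa using hij)
    have : (f ⟨j, hj⟩ : ℕ) ≤ f ⟨i, Nat.lt_of_succ_lt h⟩ := this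
    omega

theorem exists_jump {a : ℕ} {f : Fin n → Fin a} (hf : Monotone f)
    (hs : Function.Surjective f) {k k' : Fin a} (hk : (k' : ℕ) = k + 1) :
    ∃ (i : ℕ) (h : i + 1 < n), f ⟨i, Nat.lt_of_succ_lt h⟩ = k ∧ f ⟨i + 1, h⟩ = k' := by
  classical
  have hex : ∃ p, ∃ h : p < n, k' ≤ f ⟨p, h⟩ := by
    obtain ⟨⟨p, hp⟩, e⟩ := hs k'
    exact ⟨p, hp, e.ge⟩
  obtain ⟨hp, hle⟩ := Nat.find_spec hex
  have hmin := fun m hm => Nat.find_min (m := m) hex hm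
  generalize Nat.find hex = p at hp hle hmin
  obtain ⟨⟨q, hq⟩, eq⟩ := hs k
  obtain ⟨⟨r, hr⟩, er⟩ := hs k'
  have hqp : q < p := by
    by_contra hc
    have h1 : f ⟨p, hp⟩ ≤ f ⟨q, hq⟩ := hf (by simpa using hc)
    have h2 : (k' : ℕ) ≤ k := by simpa [eq] using hle.trans h1
    omega
  obtain ⟨i, rfl⟩ : ∃ i, p = i + 1 := ⟨p - 1, by omega⟩
  have hpr : i + 1 ≤ r := by
    by_contra hc
    exact hmin r (by omega) ⟨hr, er.ge⟩
  refine ⟨i, hp, ?_, le_antisymm ?_ hle⟩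
  · have h1 : f ⟨q, hq⟩ ≤ f ⟨i, by omega⟩ := hf (by simp; omega)
    have h2 : ¬ k' ≤ f ⟨i, by omega⟩ := fun h => hmin i (by omega) ⟨by omega, h⟩
    rw [eq] at h1
    rw [Fin.le_def] at h1 h2
    apply Fin.ext
    omega
  · rw [← er]
    exact hf (by simpa using hpr)

/-- Two adjacent rows of `M` each have a single nonzero entry, in the same column. -/
def HasMergeableRows {a : ℕ} (M : Fin a → β → ℕ) : Prop :=
  ∃ (i i' : Fin a) (j : β), (i' : ℕ) = (i : ℕ) + 1 ∧ M i j ≠ 0 ∧ M i' j ≠ 0 ∧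
      (∀ j', M i j' ≠ 0 → j' = j) ∧ (∀ j', M i' j' ≠ 0 → j' = j)

theorem not_hasMergeableRows_iff {a : ℕ} {f : Fin n → Fin a} (hf : Monotone f)
    (hs : Function.Surjective f) {g : Fin n → β} (w : Perm (Fin n)) :
    ¬ HasMergeableRows (permTable f g w) ↔ ∀ (i : ℕ) (h : i + 1 < n),
      LeftStable {u | permTable f g u = permTable f g w} i →
        f ⟨i, Nat.lt_of_succ_lt h⟩ = f ⟨i + 1, h⟩ := by
  constructor
  · intro hM i h hL
    by_contra e
    apply hM
    have hsw : ∀ p q u, f p = f ⟨i, Nat.lt_of_succ_lt h⟩ → f q = f ⟨i + 1, h⟩ →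
        permTable f g u = permTable f g w →
        permTable f g (swap p q * u) = permTable f g w := by
      intro p q u hp hq hu
      set x : Perm (Fin n) := swap ⟨i, Nat.lt_of_succ_lt h⟩ p * swap ⟨i + 1, h⟩ q with hx
      have hxf : ∀ j, f (x j) = f j := by
        have aux : ∀ {r s : Fin n}, f r = f s → ∀ j, f (swap r s j) = f j := by
          intro r s hrs j
          rw [swap_apply_def]
          split_ifs <;> simp_all
        intro j
        rw [hx, Perm.mul_apply, aux hp.symm, aux hq.symm]
      have hxf' : ∀ j, f (x⁻¹ j) = f j := fun j => by simpa using (hxf (x⁻¹ j)).symm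
      have hxp : x ⟨i, Nat.lt_of_succ_lt h⟩ = p := by
        have h1 : (⟨i, Nat.lt_of_succ_lt h⟩ : Fin n) ≠ q := by rintro rfl; exact e hq
        rw [hx, Perm.mul_apply, swap_apply_of_ne_of_ne (by simp) h1, swap_apply_left]
      have hxq : x ⟨i + 1, h⟩ = q := by
        rw [hx, Perm.mul_apply, swap_apply_left, swap_apply_of_ne_of_ne]
        · rintro rfl; exact e hq
        · rintro rfl; exact e (hp.symm.trans hq)
      have h1 : permTable f g (x⁻¹ * u) = permTable f g w := by
        rw [← hu]; simpa using permTable_mul (u := u) (y := 1) hxf' (g := g) (by simp)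
      have h2 : permTable f g (adjSwap i h * (x⁻¹ * u)) = permTable f g w := (hL h _).2 h1
      have h3 : swap p q * u = x * (adjSwap i h * (x⁻¹ * u)) := by
        rw [← hxp, ← hxq, Equiv.swap_apply_apply]
        simp [adjSwap, mul_assoc]
      rw [h3, ← h2]
      simpa using permTable_mul (u := adjSwap i h * (x⁻¹ * u)) (y := 1) hxf (g := g) (by simp)
    have hcol : ∀ p q, f p = f ⟨i, Nat.lt_of_succ_lt h⟩ → f q = f ⟨i + 1, h⟩ →
        g (w⁻¹ p) = g (w⁻¹ q) := by
      intro p q hp hq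
      by_contra hg
      have h1 := congrFun (congrFun (hsw p q w hp hq rfl) (f p)) (g (w⁻¹ p))
      have hlt : #{r | f (swap p q (w r)) = f p ∧ g r = g (w⁻¹ p)} <
          #{r | f (w r) = f p ∧ g r = g (w⁻¹ p)} := by
        apply card_lt_card
        rw [Finset.ssubset_iff_of_subset]
        · refine ⟨w⁻¹ p, by simp, ?_⟩
          simp [hp, hq, Ne.symm e]
        intro r hr
        simp only [mem_filter, mem_univ, true_and] at hr ⊢
        obtain ⟨hr1, hr2⟩ := hr
        refine ⟨?_, hr2⟩
        by_cases h1 : w r = p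
        · rw [h1]
        · rw [swap_apply_of_ne_of_ne h1] at hr1
          · exact hr1
          · rintro rfl
            simp [hr2] at hg
      exact hlt.ne h1
    refine ⟨f ⟨i, Nat.lt_of_succ_lt h⟩, f ⟨i + 1, h⟩, g (w⁻¹ ⟨i, Nat.lt_of_succ_lt h⟩),
      val_succ_of_ne hf hs h e, permTable_ne_zero.2 ⟨_, by simp, rfl⟩,
      permTable_ne_zero.2 ⟨w⁻¹ ⟨i + 1, h⟩, by simp, (hcol _ _ rfl rfl).symm⟩, ?_, ?_⟩
    · intro j' hj'
      obtain ⟨r, hr, rfl⟩ := permTable_ne_zero.1 hj'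
      rw [hcol _ _ rfl rfl]
      simpa using hcol _ _ hr rfl
    · intro j' hj'
      obtain ⟨r, hr, rfl⟩ := permTable_ne_zero.1 hj'
      simpa using (hcol _ _ rfl hr).symm
  · rintro hM ⟨k, k', j, hk, h1, h2, h3, h4⟩
    obtain ⟨i, h, rfl, rfl⟩ := exists_jump hf hs hk
    have e := hM i h ?_
    · rw [e] at hk; omega
    have half : ∀ u, permTable f g u = permTable f g w →
        permTable f g (adjSwap i h * u) = permTable f g w := by
      intro u hu
      rw [← hu] at h3 h4
      have g1 := h3 (g (u⁻¹ ⟨i, Nat.lt_of_succ_lt h⟩)) (permTable_ne_zero.2 ⟨_, by simp, rfl⟩)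
      have g2 := h4 (g (u⁻¹ ⟨i + 1, h⟩)) (permTable_ne_zero.2 ⟨_, by simp, rfl⟩)
      have h5 : adjSwap i h * u =
          1 * u * swap (u⁻¹ ⟨i, Nat.lt_of_succ_lt h⟩) (u⁻¹ ⟨i + 1, h⟩) := by
        rw [Equiv.swap_apply_apply]
        simp [adjSwap, mul_assoc]
      rw [h5, ← hu]
      apply permTable_mul (by simp)
      intro r
      rw [swap_apply_def]
      split_ifs <;> simp_all
    intro _ u
    refine ⟨fun hu => ?_, half u⟩
    have := half _ hu
    rwa [adjSwap, ← mul_assoc, swap_mul_self, one_mul] at this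

theorem sum_permTable_right [Fintype β] (f : Fin n → α) (g : Fin n → β) (u : Perm (Fin n))
    (k : α) : ∑ l, permTable f g u k l = #{i | f i = k} := by
  have h1 : #{i | f i = k} = #{i | f (u i) = k} :=
    (card_bij (fun i _ => u i) (by simp) (by simp) fun i hi => ⟨u⁻¹ i, by simpa using hi⟩).symm
  rw [h1, card_eq_sum_card_fiberwise (f := g) (t := univ) (by simp)]
  simp [permTable, filter_filter]

theorem sum_permTable_left [Fintype α] (f : Fin n → α) (g : Fin n → β) (u : Perm (Fin n))
    (l : β) : ∑ k, permTable f g u k l = #{i | g i = l} := by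
  simp_rw [← permTable_inv f g]
  exact sum_permTable_right g f _ l

theorem Monotone.eq_of_card_fiber_eq [PartialOrder α] {f f' : Fin n → α} (hf : Monotone f)
    (hf' : Monotone f') (h : ∀ c, #{i | f i = c} = #{i | f' i = c}) : f = f' := by
  obtain ⟨y, hy⟩ := exists_perm_of_card_fiber_eq h
  have e : f' ∘ y = f := funext hy
  have := Tuple.unique_monotone (f := f') (σ := y) (τ := 1) (by rwa [e]) (by simpa using hf')
  rw [e] at this
  simpa using this

/-- The permutations having table `M` with respect to some monotone surjections form `C`. -/
def Represents {a b : ℕ} (C : Set (Perm (Fin n))) (M : Fin a → Fin b → ℕ) : Prop :=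
  ∃ (f : Fin n → Fin a) (g : Fin n → Fin b) (w : Perm (Fin n)),
    (Monotone f ∧ Function.Surjective f) ∧ (Monotone g ∧ Function.Surjective g) ∧
      permTable f g w = M ∧ C = {u | permTable f g u = M}

theorem card_fiber_pos {f : Fin n → α} (hf : Function.Surjective f) (k : α) :
    0 < #{i | f i = k} := by
  obtain ⟨i, hi⟩ := hf k
  exact card_pos.2 ⟨i, by simpa using hi⟩

theorem Represents.isTable {a b : ℕ} {C : Set (Perm (Fin n))} {M : Fin a → Fin b → ℕ}
    (h : Represents C M) :
    (∑ i, ∑ j, M i j) = n ∧ (∀ i, 0 < ∑ j, M i j) ∧ (∀ j, 0 < ∑ i, M i j) := by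
  obtain ⟨f, g, w, hf, hg, rfl, -⟩ := h
  refine ⟨?_, fun k => ?_, fun l => ?_⟩
  · simp_rw [sum_permTable_right]
    rw [← card_eq_sum_card_fiberwise (s := univ) (f := f) (t := univ) (by simp)]
    simp
  · rw [sum_permTable_right]
    exact card_fiber_pos hf.2 k
  · rw [sum_permTable_left]
    exact card_fiber_pos hg.2 l

theorem exists_represents {a b : ℕ} {M : Fin a → Fin b → ℕ} (hn : (∑ i, ∑ j, M i j) = n)
    (hr : ∀ i, 0 < ∑ j, M i j) (hc : ∀ j, 0 < ∑ i, M i j) :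
    ∃ C : Set (Perm (Fin n)), Represents C M := by
  obtain ⟨h, hh⟩ : ∃ h : Fin n → Fin a × Fin b, ∀ k l, #{i | h i = (k, l)} = M k l := by
    let e : Fin n ≃ Σ p : Fin a × Fin b, Fin (M p.1 p.2) :=
      Fintype.equivOfCardEq (by simp [Fintype.sum_prod_type, hn])
    refine ⟨fun i => (e i).1, fun k l => ?_⟩
    have := Fintype.card_congr ((e.subtypeEquiv (p := fun i => (e i).1 = (k, l))
      (q := fun x => x.1 = (k, l)) (fun _ => Iff.rfl)).trans
        (Equiv.sigmaSubtype (k, l)))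
    simpa [Fintype.card_subtype] using this
  have hpos : ∀ k l, 0 < M k l → ∃ i, h i = (k, l) := by
    intro k l hkl
    rw [← hh, card_pos] at hkl
    obtain ⟨i, hi⟩ := hkl
    exact ⟨i, by simpa using hi⟩
  set x := Tuple.sort fun i => (h i).1 with hx
  set y := Tuple.sort fun i => (h i).2 with hy
  have hT : permTable (fun i => (h (x i)).1) (fun i => (h (y i)).2) (x⁻¹ * y) = M := by
    ext k l
    rw [← hh, permTable]
    refine card_bij (fun i _ => y i) ?_ (by simp) ?_
    · intro i; simp [Prod.ext_iff]
    · intro i hi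
      exact ⟨y⁻¹ i, by simpa [Prod.ext_iff] using hi, by simp⟩
  refine ⟨_, _, _, x⁻¹ * y, ⟨Tuple.monotone_sort fun i => (h i).1, fun k => ?_⟩,
    ⟨Tuple.monotone_sort fun i => (h i).2, fun l => ?_⟩, hT, rfl⟩
  · obtain ⟨l, -, hl⟩ := Finset.exists_ne_zero_of_sum_ne_zero (hr k).ne'
    obtain ⟨i, hi⟩ := hpos k l (Nat.pos_of_ne_zero hl)
    exact ⟨x⁻¹ i, by simp [← hx, hi]⟩
  · obtain ⟨k, -, hk⟩ := Finset.exists_ne_zero_of_sum_ne_zero (hc l).ne'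
    obtain ⟨i, hi⟩ := hpos k l (Nat.pos_of_ne_zero hk)
    exact ⟨y⁻¹ i, by simp [← hy, hi]⟩

theorem Represents.coset_unique {a b : ℕ} {C C' : Set (Perm (Fin n))} {M : Fin a → Fin b → ℕ}
    (h : Represents C M) (h' : Represents C' M) : C = C' := by
  obtain ⟨f, g, w, hf, hg, rfl, rfl⟩ := h
  obtain ⟨f', g', w', hf', hg', hM, rfl⟩ := h'
  obtain rfl : f = f' := hf.1.eq_of_card_fiber_eq hf'.1 fun k => by
    rw [← sum_permTable_right f g w, ← hM, sum_permTable_right]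
  obtain rfl : g = g' := hg.1.eq_of_card_fiber_eq hg'.1 fun l => by
    rw [← sum_permTable_left f g w, ← hM, sum_permTable_left]
  rfl

theorem Represents.exists_eq_doubleCoset {a b : ℕ} {C : Set (Perm (Fin n))}
    {M : Fin a → Fin b → ℕ} (h : Represents C M) :
    ∃ I ⊆ simples n, ∃ J ⊆ simples n, ∃ w : Perm (Fin n), C = doubleCoset I w J := by
  obtain ⟨f, g, w, hf, hg, rfl, rfl⟩ := h
  refine ⟨{s | ∃ i h, s = adjSwap i h ∧ f ⟨i, Nat.lt_of_succ_lt h⟩ = f ⟨i + 1, h⟩}, ?_,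
    {s | ∃ i h, s = adjSwap i h ∧ g ⟨i, Nat.lt_of_succ_lt h⟩ = g ⟨i + 1, h⟩}, ?_, w, ?_⟩
  · rintro s ⟨i, h, rfl, -⟩
    exact ⟨i, h, rfl⟩
  · rintro s ⟨i, h, rfl, -⟩
    exact ⟨i, h, rfl⟩
  · ext u
    rw [Set.mem_ofPred_eq, permTable_eq_iff]
    simp_rw [← closure_adjSwap_eq hf.1 (fun s => Iff.rfl),
      ← closure_adjSwap_eq hg.1 (fun s => Iff.rfl)]
    rfl

theorem setOf_inv_mem_permTable (f : Fin n → α) (g : Fin n → β) (w : Perm (Fin n)) :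
    {u | u⁻¹ ∈ {u | permTable f g u = permTable f g w}} =
      {u | permTable g f u = permTable g f w⁻¹} := by
  ext u
  change permTable f g u⁻¹ = permTable f g w ↔ permTable g f u = permTable g f w⁻¹
  simp_rw [funext_iff, permTable_inv f g w, permTable_inv g f u]
  exact forall_comm

theorem isMaximal_permTable_iff {a b : ℕ} {f : Fin n → Fin a} (hf : Monotone f)
    (hfs : Function.Surjective f) {g : Fin n → Fin b} (hg : Monotone g)
    (hgs : Function.Surjective g) {w : Perm (Fin n)} {C : Set (Perm (Fin n))}
    (hC : C = {u | permTable f g u = permTable f g w}) :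
    IsMaximal (permTable f g w) ↔
      (∀ (i : ℕ) (h : i + 1 < n), LeftStable C i →
        f ⟨i, Nat.lt_of_succ_lt h⟩ = f ⟨i + 1, h⟩) ∧
      (∀ (i : ℕ) (h : i + 1 < n), LeftStable {u | u⁻¹ ∈ C} i →
        g ⟨i, Nat.lt_of_succ_lt h⟩ = g ⟨i + 1, h⟩) := by
  subst hC
  rw [setOf_inv_mem_permTable, ← not_hasMergeableRows_iff hf hfs,
    ← not_hasMergeableRows_iff hg hgs]
  have : permTable g f w⁻¹ = fun l k => permTable f g w k l := by
    ext l k; exact permTable_inv f g w k l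
  rw [this]
  rfl

theorem eq_of_same_jumps (hn : 1 ≤ n) {a a' : ℕ} {f : Fin n → Fin a} {f' : Fin n → Fin a'}
    (hf : Monotone f) (hfs : Function.Surjective f) (hf' : Monotone f')
    (hfs' : Function.Surjective f')
    (h : ∀ i (h : i + 1 < n), f ⟨i, Nat.lt_of_succ_lt h⟩ = f ⟨i + 1, h⟩ ↔
      f' ⟨i, Nat.lt_of_succ_lt h⟩ = f' ⟨i + 1, h⟩) :
    a = a' ∧ ∀ i, (f i : ℕ) = f' i := by
  have zero : ∀ {c : ℕ} {e : Fin n → Fin c}, Monotone e → Function.Surjective e →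
      (e ⟨0, hn⟩ : ℕ) = 0 := by
    intro c e he hes
    obtain ⟨i, hi⟩ := hes ⟨0, (e ⟨0, hn⟩).pos⟩
    have h1 : e ⟨0, hn⟩ ≤ e i := he (by simp [Fin.le_def])
    rw [hi, Fin.le_def] at h1
    simpa using h1
  have last : ∀ {c : ℕ} {e : Fin n → Fin c}, Monotone e → Function.Surjective e →
      (e ⟨n - 1, by omega⟩ : ℕ) + 1 = c := by
    intro c e he hes
    have hc := (e ⟨0, hn⟩).pos
    obtain ⟨i, hi⟩ := hes ⟨c - 1, by omega⟩
    have h1 : e i ≤ e ⟨n - 1, by omega⟩ := he (by simp [Fin.le_def]; omega)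
    rw [hi, Fin.le_def] at h1
    have := (e ⟨n - 1, by omega⟩).2
    simp only at h1
    omega
  have key : ∀ i (hi : i < n), (f ⟨i, hi⟩ : ℕ) = f' ⟨i, hi⟩ := by
    intro i
    induction i with
    | zero => intro hi; rw [zero hf hfs, zero hf' hfs']
    | succ i ih =>
      intro hi
      by_cases e : f ⟨i, Nat.lt_of_succ_lt hi⟩ = f ⟨i + 1, hi⟩
      · rw [← e, ← (h i hi).1 e, ih]
      · rw [val_succ_of_ne hf hfs hi e, val_succ_of_ne hf' hfs' hi (mt (h i hi).2 e), ih]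
  refine ⟨?_, fun i => key i i.2⟩
  rw [← last hf hfs, ← last hf' hfs', key]

theorem Represents.table_unique (hn : 1 ≤ n) {a b a' b' : ℕ} {C : Set (Perm (Fin n))}
    {M : Fin a → Fin b → ℕ} {M' : Fin a' → Fin b' → ℕ}
    (h : Represents C M) (h' : Represents C M') (hM : IsMaximal M) (hM' : IsMaximal M') :
    ∃ (ha : a = a') (hb : b = b'), ∀ i j, M i j = M' (Fin.cast ha i) (Fin.cast hb j) := by
  obtain ⟨f, g, w, ⟨hf, hfs⟩, ⟨hg, hgs⟩, rfl, hC⟩ := h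
  obtain ⟨f', g', w', ⟨hf', hfs'⟩, ⟨hg', hgs'⟩, rfl, hC'⟩ := h'
  rw [isMaximal_permTable_iff hf hfs hg hgs hC] at hM
  rw [isMaximal_permTable_iff hf' hfs' hg' hgs' hC'] at hM'
  have hD := congrArg (fun C => {u | u⁻¹ ∈ C}) hC
  have hD' := congrArg (fun C => {u | u⁻¹ ∈ C}) hC'
  simp only [setOf_inv_mem_permTable] at hD hD'
  obtain ⟨rfl, e⟩ := eq_of_same_jumps hn hf hfs hf' hfs' fun i h =>
    ⟨fun e => hM'.1 i h (hC ▸ leftStable_of_eq e), fun e => hM.1 i h (hC' ▸ leftStable_of_eq e)⟩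
  obtain ⟨rfl, e'⟩ := eq_of_same_jumps hn hg hgs hg' hgs' fun i h =>
    ⟨fun e => hM'.2 i h (hD ▸ leftStable_of_eq e), fun e => hM.2 i h (hD' ▸ leftStable_of_eq e)⟩
  obtain rfl : f = f' := funext fun i => Fin.ext (e i)
  obtain rfl : g = g' := funext fun i => Fin.ext (e' i)
  refine ⟨rfl, rfl, fun i j => ?_⟩
  have hw : w ∈ C := by rw [hC]; rfl
  rw [hC'] at hw
  exact congrFun (congrFun hw i) j

theorem exists_monotone_surjective_of_pred (hn : 1 ≤ n) (P : ℕ → Prop) :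
    ∃ (a : ℕ) (f : Fin n → Fin a), Monotone f ∧ Function.Surjective f ∧
      ∀ i (h : i + 1 < n), f ⟨i, Nat.lt_of_succ_lt h⟩ = f ⟨i + 1, h⟩ ↔ P i := by
  classical
  have hmono := Nat.count_monotone fun i => ¬ P i
  refine ⟨Nat.count (fun i => ¬ P i) (n - 1) + 1,
    fun i => ⟨Nat.count (fun i => ¬ P i) i, Nat.lt_succ_of_le (hmono (by omega))⟩,
    fun i j hij => hmono hij, ?_, fun i h => ?_⟩
  · rintro ⟨k, hk⟩
    have key : ∀ m, k < Nat.count (fun i => ¬ P i) m + 1 →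
        ∃ i ≤ m, Nat.count (fun i => ¬ P i) i = k := by
      intro m
      induction m with
      | zero => intro h; exact ⟨0, le_rfl, by simp at h ⊢; omega⟩
      | succ m ih =>
        intro h
        by_cases hm : k < Nat.count (fun i => ¬ P i) m + 1
        · obtain ⟨i, hi, e⟩ := ih hm
          exact ⟨i, by omega, e⟩
        · refine ⟨m + 1, le_rfl, ?_⟩
          rw [Nat.count_succ] at h ⊢
          split_ifs at h ⊢ <;> omega
    obtain ⟨i, hi, e⟩ := key _ hk
    exact ⟨⟨i, by omega⟩, Fin.ext e⟩
  · simp [Fin.ext_iff, Nat.count_succ]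

theorem LeftStable.closure {C : Set (Perm (Fin n))} {S : Set (Perm (Fin n))}
    (hS : ∀ s ∈ S, ∃ i h, s = adjSwap i h ∧ LeftStable C i) {x : Perm (Fin n)}
    (hx : x ∈ Subgroup.closure S) (u : Perm (Fin n)) : x * u ∈ C ↔ u ∈ C := by
  induction hx using Subgroup.closure_induction generalizing u with
  | mem s hs =>
    obtain ⟨i, h, rfl, hi⟩ := hS s hs
    exact hi h u
  | one => simp
  | mul x y _ _ hx hy => rw [mul_assoc, hx, hy]
  | inv x _ hx => rw [← hx]; simp

theorem mul_mem_doubleCoset_iff {I J : Set (Perm (Fin n))} {w s : Perm (Fin n)}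
    (hs : s ∈ Subgroup.closure I) (u : Perm (Fin n)) :
    s * u ∈ doubleCoset I w J ↔ u ∈ doubleCoset I w J := by
  constructor
  · rintro ⟨x, hx, y, hy, e⟩
    exact ⟨s⁻¹ * x, mul_mem (inv_mem hs) hx, y, hy, by simp [mul_assoc, eq_inv_mul_iff_mul_eq, e]⟩
  · rintro ⟨x, hx, y, hy, rfl⟩
    exact ⟨s * x, mul_mem hs hx, y, hy, by simp [mul_assoc]⟩

theorem setOf_inv_mem_doubleCoset (I J : Set (Perm (Fin n))) (w : Perm (Fin n)) :
    {u | u⁻¹ ∈ doubleCoset I w J} = doubleCoset J w⁻¹ I := by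
  ext u
  constructor
  · rintro ⟨x, hx, y, hy, e⟩
    exact ⟨y⁻¹, inv_mem hy, x⁻¹, inv_mem hx, by rw [← inv_inj, e]; simp [mul_assoc]⟩
  · rintro ⟨x, hx, y, hy, rfl⟩
    exact ⟨y⁻¹, inv_mem hy, x⁻¹, inv_mem hx, by simp [mul_assoc]⟩

theorem leftStable_of_mem {I J : Set (Perm (Fin n))} {w : Perm (Fin n)} {i : ℕ} {h : i + 1 < n}
    (hi : adjSwap i h ∈ I) : LeftStable (doubleCoset I w J) i :=
  fun _ => mul_mem_doubleCoset_iff (Subgroup.subset_closure hi)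

theorem exists_maximal_represents (hn : 1 ≤ n) {I J : Set (Perm (Fin n))} (hI : I ⊆ simples n)
    (hJ : J ⊆ simples n) (w : Perm (Fin n)) :
    ∃ (a b : ℕ) (M : Fin a → Fin b → ℕ), IsMaximal M ∧ Represents (doubleCoset I w J) M := by
  set C := doubleCoset I w J with hC
  have hCinv : {u | u⁻¹ ∈ C} = doubleCoset J w⁻¹ I := setOf_inv_mem_doubleCoset I J w
  obtain ⟨a, f, hf, hfs, hfP⟩ := exists_monotone_surjective_of_pred hn (LeftStable C)
  obtain ⟨b, g, hg, hgs, hgP⟩ := exists_monotone_surjective_of_pred hn (LeftStable {u | u⁻¹ ∈ C})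
  have eq : C = {u | permTable f g u = permTable f g w} := by
    ext u
    rw [Set.mem_ofPred_eq, permTable_eq_iff]
    simp_rw [← closure_adjSwap_eq hf (fun s => Iff.rfl), ← closure_adjSwap_eq hg (fun s => Iff.rfl)]
    constructor
    · rintro ⟨x, hx, y, hy, rfl⟩
      refine ⟨x, Subgroup.closure_mono ?_ hx, y, Subgroup.closure_mono ?_ hy, rfl⟩
      · intro s hs
        obtain ⟨i, h, rfl⟩ := hI hs
        exact ⟨i, h, rfl, (hfP i h).2 (leftStable_of_mem (h := h) hs)⟩
      · intro s hs
        obtain ⟨i, h, rfl⟩ := hJ hs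
        exact ⟨i, h, rfl, (hgP i h).2 (hCinv ▸ leftStable_of_mem (h := h) hs)⟩
    · rintro ⟨x, hx, y, hy, rfl⟩
      rw [mul_assoc, LeftStable.closure (C := C) _ hx]
      · have := (LeftStable.closure (C := {u | u⁻¹ ∈ C}) (by
          rintro s ⟨i, h, rfl, e⟩
          exact ⟨i, h, rfl, (hgP i h).1 e⟩) (inv_mem hy) w⁻¹).2
            (by simpa using ⟨1, one_mem _, 1, one_mem _, by simp⟩)
        simpa using this
      · rintro s ⟨i, h, rfl, e⟩
        exact ⟨i, h, rfl, (hfP i h).1 e⟩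
  refine ⟨a, b, permTable f g w, ?_, f, g, w, ⟨hf, hfs⟩, ⟨hg, hgs⟩, rfl, eq⟩
  rw [isMaximal_permTable_iff hf hfs hg hgs eq]
  exact ⟨fun i h => (hfP i h).2, fun i h => (hgP i h).2⟩

theorem Represents.dim_mem (hn : 1 ≤ n) {a b : ℕ} {C : Set (Perm (Fin n))}
    {M : Fin a → Fin b → ℕ} (h : Represents C M) : a ∈ Icc 1 n ∧ b ∈ Icc 1 n := by
  obtain ⟨f, g, -, hf, hg, -⟩ := h
  have ha := Fintype.card_le_of_surjective f hf.2
  have hb := Fintype.card_le_of_surjective g hg.2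
  have ha' := (f ⟨0, hn⟩).pos
  have hb' := (g ⟨0, hn⟩).pos
  simp only [Fintype.card_fin, mem_Icc] at *
  omega

/-- The maximal `a × b` contingency tables with sum `n`. -/
abbrev MaximalTable (n a b : ℕ) : Type :=
  {M : Fin a → Fin b → ℕ //
        (∑ i, ∑ j, M i j) = n ∧ (∀ i, 0 < ∑ j, M i j) ∧ (∀ j, 0 < ∑ i, M i j) ∧
        IsMaximal M}

instance (n a b : ℕ) : Finite (MaximalTable n a b) := by
  refine Set.Finite.subset (Set.finite_Icc (0 : Fin a → Fin b → ℕ) fun _ _ => n) ?_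
  rintro M ⟨h, -⟩
  refine ⟨fun i j => Nat.zero_le _, fun i j => ?_⟩
  calc M i j ≤ ∑ j, M i j := single_le_sum (f := fun j => M i j) (by simp) (mem_univ j)
    _ ≤ ∑ i, ∑ j, M i j := single_le_sum (f := fun i => ∑ j, M i j) (by simp) (mem_univ i)
    _ = n := h

end

theorem pn_eq_maximal_tables (n : ℕ) (hn : 1 ≤ n) :
    pdcCount n = ∑ a ∈ Finset.Icc 1 n, ∑ b ∈ Finset.Icc 1 n,
      Nat.card {M : Fin a → Fin b → ℕ //
        (∑ i, ∑ j, M i j) = n ∧ (∀ i, 0 < ∑ j, M i j) ∧ (∀ j, 0 < ∑ i, M i j) ∧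
        IsMaximal M} := by
  change _ = ∑ a ∈ Finset.Icc 1 n, ∑ b ∈ Finset.Icc 1 n, Nat.card (MaximalTable n a b)
  have hsum : ∑ a ∈ Finset.Icc 1 n, ∑ b ∈ Finset.Icc 1 n, Nat.card (MaximalTable n a b) =
      Nat.card (Σ p : Finset.Icc 1 n ×ˢ Finset.Icc 1 n, MaximalTable n p.1.1 p.1.2) := by
    rw [Nat.card_sigma, ← Finset.sum_product',
      Finset.sum_coe_sort _ fun p : ℕ × ℕ => Nat.card (MaximalTable n p.1 p.2)]
  rw [hsum, pdcCount]
  symm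
  choose F hF using fun x : Σ p : Finset.Icc 1 n ×ˢ Finset.Icc 1 n, MaximalTable n p.1.1 p.1.2 =>
    exists_represents x.2.2.1 x.2.2.2.1 x.2.2.2.2.1
  refine Nat.card_congr (Equiv.ofBijective
    (fun x => ⟨F x, (hF x).exists_eq_doubleCoset⟩) ⟨?_, ?_⟩)
  · rintro x y hxy
    have hy := hF y
    rw [← Subtype.mk.inj hxy] at hy
    have hx := hF x
    generalize F x = C at hx hy
    clear hxy
    obtain ⟨⟨⟨a, b⟩, hab⟩, M, hM⟩ := x
    obtain ⟨⟨⟨a', b'⟩, hab'⟩, M', hM'⟩ := y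
    obtain ⟨ha, hb, e⟩ := hx.table_unique hn hy hM.2.2.2 hM'.2.2.2
    dsimp only at ha hb
    subst ha hb
    obtain rfl : M = M' := funext₂ e
    rfl
  · rintro ⟨C, I, hI, J, hJ, w, rfl⟩
    obtain ⟨a, b, M, hM, hR⟩ := exists_maximal_represents hn hI hJ w
    have hT := hR.isTable
    refine ⟨⟨⟨(a, b), Finset.mem_product.2 (hR.dim_mem hn)⟩,
      M, hT.1, hT.2.1, hT.2.2, hM⟩, Subtype.ext ?_⟩
    exact (hF _).coset_unique hR
end

section
/- For every n ≥ 1, the number of two-way contingency tables with sum n equals Σ_{I ⊆ S} Σ_{J ⊆ S} |W_I \ S_n / W_J|, where |W_I \ S_n / W_J| denotes the number of distinct double cosets W_I w W_J (w ∈ S_n). That is, p_{n,0} = Σ_{I ⊆ S} Σ_{J ⊆ S} #{ C ⊆ S_n : ∃ w ∈ S_n, C = W_I w W_J }. -/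
/-- The set of simple transpositions, as a `Finset`. -/
noncomputable def simplesFinset (n : ℕ) : Finset (Equiv.Perm (Fin n)) :=
  (Set.toFinite (simples n)).toFinset

/-- `pn0 n` is the number of two-way contingency tables with sum `n`: matrices of
nonnegative integers (of some dimensions `a × b` with `1 ≤ a, b ≤ n`) whose entries sum
to `n`, all of whose row sums and column sums are strictly positive. -/
noncomputable def pn0 (n : ℕ) : ℕ :=
  ∑ a ∈ Finset.Icc 1 n, ∑ b ∈ Finset.Icc 1 n,
    Nat.card {M : Fin a → Fin b → ℕ //
      (∑ i, ∑ j, M i j) = n ∧ (∀ i, 0 < ∑ j, M i j) ∧ (∀ j, 0 < ∑ i, M i j)}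

section Fibers

variable {α β γ : Type*} [Fintype α] [DecidableEq β] [DecidableEq γ]

lemma exists_perm_comp_eq_of_card_fiber_eq {f g : α → β}
    (h : ∀ b, Finset.card {a | f a = b} = Finset.card {a | g a = b}) :
    ∃ e : Equiv.Perm α, g ∘ e = f := by
  have key (b : β) : Nonempty ({a // f a = b} ≃ {a // g a = b}) := by
    rw [← Fintype.card_eq, Fintype.card_subtype, Fintype.card_subtype]
    exact h b
  exact ⟨Equiv.ofFiberEquiv fun b ↦ (key b).some, funext fun a ↦ Equiv.ofFiberEquiv_map _ a⟩

lemma card_fiber_comp_perm (f : α → β) (e : Equiv.Perm α) (b : β) :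
    Finset.card {a | f (e a) = b} = Finset.card {a | f a = b} :=
  Finset.card_equiv e (by simp)

/-- The matrix counting the elements of `α` according to their images under `f` and `g`. -/
def crossTable (f : α → β) (g : α → γ) (i : β) (j : γ) : ℕ :=
  Finset.card {k | f k = i ∧ g k = j}

lemma sum_crossTable_right [Fintype γ] (f : α → β) (g : α → γ) (i : β) :
    ∑ j, crossTable f g i j = Finset.card {k | f k = i} := by
  rw [Finset.card_eq_sum_card_fiberwise (f := g) (t := Finset.univ) (by simp)]
  simp [crossTable, Finset.filter_filter]

lemma sum_crossTable_left [Fintype β] (f : α → β) (g : α → γ) (j : γ) :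
    ∑ i, crossTable f g i j = Finset.card {k | g k = j} := by
  rw [Finset.card_eq_sum_card_fiberwise (f := f) (t := Finset.univ) (by simp)]
  simp [crossTable, Finset.filter_filter, and_comm]

lemma crossTable_comp_perm (f : α → β) (g : α → γ) (e : Equiv.Perm α) :
    crossTable (f ∘ e) (g ∘ e) = crossTable f g := by
  funext i j
  simpa [crossTable, Prod.ext_iff] using card_fiber_comp_perm (fun k ↦ (f k, g k)) e (i, j)

lemma crossTable_eq_crossTable_iff {f f' : α → β} {g g' : α → γ} :
    crossTable f g = crossTable f' g' ↔ ∃ e : Equiv.Perm α, f' ∘ e = f ∧ g' ∘ e = g := by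
  refine ⟨fun h ↦ ?_, ?_⟩
  · obtain ⟨e, he⟩ := exists_perm_comp_eq_of_card_fiber_eq (f := fun k ↦ (f k, g k))
      (g := fun k ↦ (f' k, g' k)) fun ⟨i, j⟩ ↦ by
        simpa [crossTable, Prod.ext_iff] using congrFun (congrFun h i) j
    exact ⟨e, funext fun k ↦ congrArg Prod.fst (congrFun he k),
      funext fun k ↦ congrArg Prod.snd (congrFun he k)⟩
  · rintro ⟨e, rfl, rfl⟩
    exact crossTable_comp_perm _ _ e

lemma exists_crossTable_eq [Fintype β] [Fintype γ] (M : β → γ → ℕ)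
    (hM : ∑ i, ∑ j, M i j = Fintype.card α) :
    ∃ (f : α → β) (g : α → γ), crossTable f g = M := by
  have e : α ≃ Σ p : β × γ, Fin (M p.1 p.2) := Fintype.equivOfCardEq (by
    simp [← hM, Fintype.sum_prod_type])
  refine ⟨fun k ↦ (e k).1.1, fun k ↦ (e k).1.2, ?_⟩
  funext i j
  calc crossTable (fun k ↦ (e k).1.1) (fun k ↦ (e k).1.2) i j
      = Fintype.card {k // (e k).1 = (i, j)} := by
        simp [crossTable, Fintype.card_subtype, Prod.ext_iff]
    _ = Fintype.card {x : Σ p : β × γ, Fin (M p.1 p.2) // x.1 = (i, j)} :=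
        Fintype.card_congr (e.subtypeEquiv fun _ ↦ Iff.rfl)
    _ = M i j := by
        rw [Fintype.card_congr (Equiv.sigmaSubtype (β := fun p : β × γ ↦ Fin (M p.1 p.2)) (i, j))]
        simp

lemma range_crossTable_comp_perm [Fintype β] [Fintype γ] (f : α → β) (g : α → γ) :
    Set.range (fun w : Equiv.Perm α ↦ crossTable (f ∘ w) g) =
      {M | (∀ i, ∑ j, M i j = Finset.card {k | f k = i}) ∧
        ∀ j, ∑ i, M i j = Finset.card {k | g k = j}} := by
  ext M
  refine ⟨?_, fun ⟨hr, hc⟩ ↦ ?_⟩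
  · rintro ⟨w, rfl⟩
    exact ⟨fun i ↦ (sum_crossTable_right _ _ i).trans (card_fiber_comp_perm f w i),
      fun j ↦ sum_crossTable_left _ _ j⟩
  · obtain ⟨f', g', rfl⟩ := exists_crossTable_eq (α := α) M (by
      simp_rw [hr]
      exact (Finset.card_eq_sum_card_fiberwise (f := f) (by simp)).symm)
    obtain ⟨u, hu⟩ := exists_perm_comp_eq_of_card_fiber_eq fun i ↦
      (sum_crossTable_right f' g' i).symm.trans (hr i)
    obtain ⟨v, hv⟩ := exists_perm_comp_eq_of_card_fiber_eq fun j ↦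
      (sum_crossTable_left f' g' j).symm.trans (hc j)
    refine ⟨v.symm.trans u, crossTable_eq_crossTable_iff.2 ⟨v.symm, ?_, ?_⟩⟩
    · rw [← hu]; rfl
    · rw [← hv]; ext; simp

end Fibers

lemma Nat.card_range_eq_of_ker_eq {α β γ : Type*} {f : α → β} {g : α → γ}
    (h : ∀ x y, f x = f y ↔ g x = g y) : Nat.card (Set.range f) = Nat.card (Set.range g) :=
  Nat.card_congr <| (Setoid.quotientKerEquivRange f).symm.trans <|
    (Quotient.congrRight h).trans (Setoid.quotientKerEquivRange g)

section Parabolic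

variable {n : ℕ}

lemma doubleCoset_eq_iff {I J : Set (Equiv.Perm (Fin n))} {w w' : Equiv.Perm (Fin n)} :
    doubleCoset I w J = doubleCoset I w' J ↔ w ∈ doubleCoset I w' J := by
  have key (w) : doubleCoset I w J =
      DoubleCoset.doubleCoset w (Subgroup.closure I) (Subgroup.closure J) := by
    ext u
    simp [doubleCoset, DoubleCoset.mem_doubleCoset]
  simp only [key]
  refine ⟨fun h ↦ h ▸ DoubleCoset.mem_doubleCoset_self _ _ _, fun h ↦ ?_⟩
  exact DoubleCoset.doubleCoset_eq_of_mem h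

/-- The simple transpositions preserving the fibers of `f`. -/
def simplesFixing {α : Type*} (f : Fin n → α) : Set (Equiv.Perm (Fin n)) :=
  {σ ∈ simples n | f ∘ σ = f}

lemma mem_closure_simplesFixing {α : Type*} [PartialOrder α] {f : Fin n → α} (hf : Monotone f)
    {σ : Equiv.Perm (Fin n)} : σ ∈ Subgroup.closure (simplesFixing f) ↔ f ∘ σ = f := by
  refine ⟨fun h ↦ ?_, fun h ↦ ?_⟩
  · induction h using Subgroup.closure_induction with
    | mem x hx => exact hx.2
    | one => rfl
    | mul x y _ _ hx hy => rw [Equiv.Perm.coe_mul, ← Function.comp_assoc, hx, hy]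
    | inv x _ hx =>
      nth_rw 1 [← hx]
      ext; simp
  · have swap : ∀ τ ∈ simplesFixing f, τ.IsSwap := by
      rintro _ ⟨⟨i, hi, rfl⟩, -⟩
      exact ⟨_, _, by simp, rfl⟩
    have up : ∀ (d k : ℕ) (hk : k + d < n), f ⟨k, by omega⟩ = f ⟨k + d, hk⟩ →
        (⟨k + d, hk⟩ : Fin n) ∈
          MulAction.orbit (Subgroup.closure (simplesFixing f)) (⟨k, by omega⟩ : Fin n) := by
      intro d
      induction d with
      | zero => exact fun k hk _ ↦ MulAction.mem_orbit_self _
      | succ d ih =>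
        intro k hk hfk
        have h1 : f ⟨k, by omega⟩ = f ⟨k + d, by omega⟩ :=
          le_antisymm (hf (by simp)) (hfk ▸ hf (by simp))
        have h2 : f ⟨k + d, by omega⟩ = f ⟨k + d + 1, hk⟩ := h1.symm.trans hfk
        rw [← MulAction.orbit_eq_iff.2 (ih k (by omega) h1)]
        refine ⟨⟨Equiv.swap ⟨k + d, by omega⟩ ⟨k + d + 1, hk⟩, Subgroup.subset_closure
          ⟨⟨k + d, hk, rfl⟩, funext fun x ↦ ?_⟩⟩, Equiv.swap_apply_left _ _⟩
        simp only [Function.comp_apply, Equiv.swap_apply_def]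
        split_ifs with hx hx <;> simp [hx, h2]
    have orb (x y : Fin n) (hxy : x ≤ y) (hf' : f x = f y) :
        y ∈ MulAction.orbit (Subgroup.closure (simplesFixing f)) x := by
      obtain ⟨d, hd⟩ := Nat.exists_eq_add_of_le (Fin.le_def.1 hxy)
      have hy : y = ⟨x + d, hd ▸ y.2⟩ := Fin.ext hd
      rw [hy] at hf' ⊢
      exact up d x _ hf'
    refine (mem_closure_isSwap swap).2 ⟨Set.toFinite _, fun x ↦ ?_⟩
    rcases le_total x (σ x) with hx | hx
    · exact orb _ _ hx (congrFun h x).symm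
    · exact MulAction.mem_orbit_symm.1 (orb _ _ hx (congrFun h x))

lemma card_doubleCosets_simplesFixing {a b : ℕ} {f : Fin n → Fin a} {g : Fin n → Fin b}
    (hf : Monotone f) (hg : Monotone g) :
    Nat.card {C : Set (Equiv.Perm (Fin n)) //
        ∃ w : Equiv.Perm (Fin n), C = doubleCoset (simplesFixing f) w (simplesFixing g)} =
      Nat.card {M : Fin a → Fin b → ℕ // (∀ i, ∑ j, M i j = Finset.card {k | f k = i}) ∧
        ∀ j, ∑ i, M i j = Finset.card {k | g k = j}} := by
  trans Nat.card (Set.range fun w ↦ doubleCoset (simplesFixing f) w (simplesFixing g))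
  · exact Nat.card_congr (Equiv.subtypeEquivRight fun C ↦ by simp [eq_comm])
  trans Nat.card (Set.range fun w : Equiv.Perm (Fin n) ↦ crossTable (f ∘ w) g)
  · refine Nat.card_range_eq_of_ker_eq fun w w' ↦ ?_
    rw [doubleCoset_eq_iff, crossTable_eq_crossTable_iff]
    simp only [doubleCoset, Set.mem_ofPred_eq, mem_closure_simplesFixing hf,
      mem_closure_simplesFixing hg]
    constructor
    · rintro ⟨x, hx, y, hy, rfl⟩
      refine ⟨y, ?_, hy⟩
      nth_rw 1 [← hx]
      rfl
    · rintro ⟨e, he, he'⟩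
      refine ⟨w * e⁻¹ * w'⁻¹, ?_, e, he', by simp [mul_assoc]⟩
      rw [Equiv.Perm.coe_mul, Equiv.Perm.coe_mul, ← Function.comp_assoc, ← Function.comp_assoc,
        ← he]
      ext; simp
  · rw [range_crossTable_comp_perm]
    rfl

end Parabolic

namespace Composition

variable {n : ℕ}

lemma monotone_index (c : Composition n) : Monotone c.index := by
  intro x y hxy
  by_contra! h
  have h1 := c.lt_sizeUpTo_index_succ y
  have h2 := c.sizeUpTo_index_le x
  have h3 := c.monotone_sizeUpTo (Nat.succ_le_of_lt (Fin.lt_def.1 h))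
  simp only [Fin.val_succ, Nat.succ_eq_add_one] at h1 h3
  have := Fin.le_def.1 hxy
  omega

lemma card_fiber_index (c : Composition n) (i : Fin c.length) :
    Finset.card {k | c.index k = i} = c.blocksFun i := by
  rw [← Fintype.card_subtype, ← Fintype.card_fin (c.blocksFun i)]
  refine Fintype.card_congr (Equiv.trans ?_
    (Equiv.sigmaSubtype (β := fun i ↦ Fin (c.blocksFun i)) i))
  exact c.blocksFinEquiv.symm.subtypeEquiv fun _ ↦ Iff.rfl

lemma surjective_index (c : Composition n) : Function.Surjective c.index :=
  fun i ↦ ⟨c.embedding i ⟨0, c.one_le_blocksFun i⟩, c.index_embedding _ _⟩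

lemma val_index_zero (c : Composition n) (h : 0 < n) : (c.index ⟨0, h⟩ : ℕ) = 0 := by
  obtain ⟨k, hk⟩ := c.surjective_index ⟨0, c.length_pos_iff.2 h⟩
  have := Fin.le_def.1 (c.monotone_index (show (⟨0, h⟩ : Fin n) ≤ k from Nat.zero_le _))
  rw [hk] at this
  exact Nat.le_zero.1 this

lemma val_index_succ (c : Composition n) {k : ℕ} (h : k + 1 < n)
    (hne : c.index ⟨k, by omega⟩ ≠ c.index ⟨k + 1, h⟩) :
    (c.index ⟨k + 1, h⟩ : ℕ) = c.index ⟨k, by omega⟩ + 1 := by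
  have hle : c.index ⟨k, by omega⟩ ≤ c.index ⟨k + 1, h⟩ := c.monotone_index (by simp)
  have hlt := Fin.lt_def.1 (lt_of_le_of_ne hle hne)
  by_contra hcon
  obtain ⟨m, hm⟩ := c.surjective_index ⟨c.index ⟨k, by omega⟩ + 1, by omega⟩
  have h1 : (⟨k, by omega⟩ : Fin n) < m :=
    c.monotone_index.reflect_lt (by rw [hm, Fin.lt_def]; simp)
  have h2 : m < ⟨k + 1, h⟩ :=
    c.monotone_index.reflect_lt (by rw [hm, Fin.lt_def]; simp only; omega)
  rw [Fin.lt_def] at h1 h2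
  simp only at h1 h2
  omega

lemma length_le_of_val_index_eq {c d : Composition n}
    (h : ∀ k, (c.index k : ℕ) = d.index k) : c.length ≤ d.length := by
  by_contra! hlt
  obtain ⟨k, hk⟩ := c.surjective_index ⟨d.length, hlt⟩
  have h1 := h k
  rw [hk] at h1
  have h2 := (d.index k).2
  simp only at h1
  omega

lemma eq_of_val_index_eq {c d : Composition n} (h : ∀ k, (c.index k : ℕ) = d.index k) :
    c = d := by
  have hlen : c.length = d.length :=
    (length_le_of_val_index_eq h).antisymm (length_le_of_val_index_eq fun k ↦ (h k).symm)
  refine Composition.ext (List.ext_getElem (by simpa using hlen) fun i hi hi' ↦ ?_)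
  change c.blocksFun ⟨i, hi⟩ = d.blocksFun ⟨i, hi'⟩
  rw [← card_fiber_index, ← card_fiber_index]
  simp [Fin.ext_iff, h]

lemma index_eq_index_succ_iff (c : Composition n) {k : ℕ} (h : k + 1 < n) :
    c.index ⟨k, by omega⟩ = c.index ⟨k + 1, h⟩ ↔
      Equiv.swap ⟨k, by omega⟩ ⟨k + 1, h⟩ ∈ simplesFixing c.index := by
  refine ⟨fun heq ↦ ⟨⟨k, h, rfl⟩, funext fun x ↦ ?_⟩, fun hmem ↦ ?_⟩
  · simp only [Function.comp_apply, Equiv.swap_apply_def]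
    split_ifs with hx hx <;> simp [hx, heq]
  · simpa using (congrFun hmem.2 ⟨k + 1, h⟩)

lemma simplesFixing_index_injective :
    Function.Injective fun c : Composition n ↦ simplesFixing c.index := by
  intro c d hcd
  refine eq_of_val_index_eq ?_
  rintro ⟨k, hk⟩
  induction k with
  | zero => rw [val_index_zero, val_index_zero]
  | succ k ih =>
    have ih := ih (by omega)
    have hiff : c.index ⟨k, by omega⟩ = c.index ⟨k + 1, hk⟩ ↔
        d.index ⟨k, by omega⟩ = d.index ⟨k + 1, hk⟩ := by
      rw [index_eq_index_succ_iff, index_eq_index_succ_iff]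
      exact Set.ext_iff.1 hcd _
    by_cases hc : c.index ⟨k, by omega⟩ = c.index ⟨k + 1, hk⟩
    · rw [← hc, ← hiff.1 hc, ih]
    · rw [val_index_succ c hk hc, val_index_succ d hk (mt hiff.2 hc), ih]

end Composition

lemma card_simplesFinset_le (n : ℕ) : (simplesFinset n).card ≤ n - 1 := by
  have : simplesFinset n ⊆ Finset.univ.image fun i : Fin (n - 1) ↦
      Equiv.swap (⟨i, by omega⟩ : Fin n) ⟨i + 1, by omega⟩ := by
    intro σ hσ
    obtain ⟨i, hi, rfl⟩ := (Set.Finite.mem_toFinset _).1 hσ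
    exact Finset.mem_image.2 ⟨⟨i, by omega⟩, Finset.mem_univ _, rfl⟩
  exact (Finset.card_le_card this).trans (Finset.card_image_le.trans (by simp))

lemma sum_powerset_simplesFinset {A : Type*} [AddCommMonoid A] (n : ℕ)
    (F : Set (Equiv.Perm (Fin n)) → A) :
    ∑ I ∈ (simplesFinset n).powerset, F ↑I = ∑ c : Composition n, F (simplesFixing c.index) := by
  classical
  let G (c : Composition n) : Finset (Equiv.Perm (Fin n)) :=
    (Set.toFinite (simplesFixing c.index)).toFinset
  have hG (c) : (G c : Set (Equiv.Perm (Fin n))) = simplesFixing c.index := by simp [G]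
  have inj : Function.Injective G := fun c d h ↦
    Composition.simplesFixing_index_injective (by simp only [← hG, h])
  have himg : Finset.univ.image G = (simplesFinset n).powerset := by
    refine Finset.eq_of_subset_of_card_le (fun I hI ↦ ?_) ?_
    · obtain ⟨c, -, rfl⟩ := Finset.mem_image.1 hI
      refine Finset.mem_powerset.2 fun σ hσ ↦ (Set.Finite.mem_toFinset _).2 ?_
      exact ((Set.Finite.mem_toFinset _).1 hσ).1
    · rw [Finset.card_image_of_injective _ inj, Finset.card_powerset, Finset.card_univ,
        composition_card]
      exact Nat.pow_le_pow_right (by norm_num) (card_simplesFinset_le n)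
  rw [← himg, Finset.sum_image fun _ _ _ _ h ↦ inj h]
  simp only [hG]

/-- The `a × b` contingency tables with sum `n`. -/
abbrev ContingencyTable (n a b : ℕ) : Type :=
  {M : Fin a → Fin b → ℕ //
    (∑ i, ∑ j, M i j) = n ∧ (∀ i, 0 < ∑ j, M i j) ∧ (∀ j, 0 < ∑ i, M i j)}

namespace ContingencyTable

variable {n a b : ℕ}

instance : Finite (ContingencyTable n a b) := by
  refine Set.Finite.to_subtype
    ((Set.finite_Iic (fun (_ : Fin a) (_ : Fin b) ↦ n)).subset fun M hM i j ↦ ?_)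
  rw [← hM.1]
  exact (Finset.single_le_sum (f := fun j ↦ M i j) (by simp) (Finset.mem_univ j)).trans
    (Finset.single_le_sum (f := fun i ↦ ∑ j, M i j) (by simp) (Finset.mem_univ i))

/-- The compositions of `n` formed by the row sums and by the column sums. -/
def margins (M : ContingencyTable n a b) : Composition n × Composition n where
  fst :=
    { blocks := List.ofFn fun i ↦ ∑ j, M.1 i j
      blocks_pos := by
        intro x hx
        obtain ⟨i, rfl⟩ := List.mem_ofFn.1 hx
        exact M.2.2.1 i
      blocks_sum := by rw [List.sum_ofFn, M.2.1] }
  snd :=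
    { blocks := List.ofFn fun j ↦ ∑ i, M.1 i j
      blocks_pos := by
        intro x hx
        obtain ⟨j, rfl⟩ := List.mem_ofFn.1 hx
        exact M.2.2.2 j
      blocks_sum := by rw [List.sum_ofFn, Finset.sum_comm, M.2.1] }

lemma length_margins (M : ContingencyTable n a b) :
    M.margins.1.length = a ∧ M.margins.2.length = b := by
  simp [margins, Composition.length]

lemma margins_eq_iff {c d : Composition n} (M : ContingencyTable n c.length d.length) :
    M.margins = (c, d) ↔
      (∀ i, ∑ j, M.1 i j = c.blocksFun i) ∧ ∀ j, ∑ i, M.1 i j = d.blocksFun j := by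
  rw [Prod.ext_iff, Composition.ext_iff, Composition.ext_iff, ← c.ofFn_blocksFun,
    ← d.ofFn_blocksFun]
  simp only [margins, List.ofFn_inj, funext_iff]

lemma card_margins_eq (c d : Composition n) :
    Nat.card {M : ContingencyTable n c.length d.length // M.margins = (c, d)} =
      Nat.card {M : Fin c.length → Fin d.length → ℕ //
        (∀ i, ∑ j, M i j = c.blocksFun i) ∧ ∀ j, ∑ i, M i j = d.blocksFun j} := by
  refine Nat.card_congr (((Equiv.refl _).subtypeEquiv margins_eq_iff).trans
    (Equiv.subtypeSubtypeEquivSubtype fun {M} h ↦ ⟨?_, fun i ↦ ?_, fun j ↦ ?_⟩))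
  · simp only [h.1, c.sum_blocksFun]
  · rw [h.1]; exact c.one_le_blocksFun i
  · rw [h.2]; exact d.one_le_blocksFun j

lemma card_eq_sum_card_margins_eq :
    Nat.card (ContingencyTable n a b) = ∑ c : Composition n, ∑ d : Composition n,
      Nat.card {M : ContingencyTable n a b // M.margins = (c, d)} := by
  rw [← Nat.card_congr (Equiv.sigmaFiberEquiv (margins (n := n) (a := a) (b := b))),
    Nat.card_sigma, Fintype.sum_prod_type]

end ContingencyTable

lemma pn0_eq_sum_card_margins {n : ℕ} (hn : 1 ≤ n) :
    pn0 n = ∑ c : Composition n, ∑ d : Composition n,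
      Nat.card {M : Fin c.length → Fin d.length → ℕ //
        (∀ i, ∑ j, M i j = c.blocksFun i) ∧ ∀ j, ∑ i, M i j = d.blocksFun j} := by
  have mem (c : Composition n) : c.length ∈ Finset.Icc 1 n :=
    Finset.mem_Icc.2 ⟨c.length_pos_iff.2 hn, c.length_le⟩
  have empty (a b : ℕ) (c d : Composition n) (h : a ≠ c.length ∨ b ≠ d.length) :
      Nat.card {M : ContingencyTable n a b // M.margins = (c, d)} = 0 := by
    have : IsEmpty {M : ContingencyTable n a b // M.margins = (c, d)} := by
      refine ⟨fun ⟨M, hM⟩ ↦ ?_⟩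
      have := M.length_margins
      rw [hM] at this
      rcases h with h | h
      · exact h this.1.symm
      · exact h this.2.symm
    exact Nat.card_of_isEmpty
  calc pn0 n
      = ∑ a ∈ Finset.Icc 1 n, ∑ b ∈ Finset.Icc 1 n, Nat.card (ContingencyTable n a b) := rfl
    _ = ∑ c : Composition n, ∑ d : Composition n, ∑ a ∈ Finset.Icc 1 n, ∑ b ∈ Finset.Icc 1 n,
          Nat.card {M : ContingencyTable n a b // M.margins = (c, d)} := by
        simp_rw [ContingencyTable.card_eq_sum_card_margins_eq,
          Finset.sum_comm (s := Finset.Icc 1 n) (t := Finset.univ)]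
    _ = _ := by
        refine Finset.sum_congr rfl fun c _ ↦ Finset.sum_congr rfl fun d _ ↦ ?_
        rw [Finset.sum_eq_single_of_mem _ (mem c) fun a _ ha ↦
            Finset.sum_eq_zero fun b _ ↦ empty a b c d (.inl ha),
          Finset.sum_eq_single_of_mem _ (mem d) fun b _ hb ↦ empty _ b c d (.inr hb),
          ContingencyTable.card_margins_eq]

theorem pn0_eq_sum_double_quotients (n : ℕ) (hn : 1 ≤ n) :
    pn0 n = ∑ I ∈ (simplesFinset n).powerset, ∑ J ∈ (simplesFinset n).powerset,
      Nat.card {C : Set (Equiv.Perm (Fin n)) //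
        ∃ w : Equiv.Perm (Fin n), C = doubleCoset (↑I) w (↑J)} := by
  rw [pn0_eq_sum_card_margins hn, sum_powerset_simplesFinset n fun I ↦
    ∑ J ∈ (simplesFinset n).powerset, Nat.card {C : Set (Equiv.Perm (Fin n)) //
      ∃ w : Equiv.Perm (Fin n), C = doubleCoset I w ↑J}]
  refine Finset.sum_congr rfl fun c _ ↦ ?_
  rw [sum_powerset_simplesFinset n fun J ↦ Nat.card {C : Set (Equiv.Perm (Fin n)) //
      ∃ w : Equiv.Perm (Fin n), C = doubleCoset (simplesFixing c.index) w J}]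
  refine Finset.sum_congr rfl fun d _ ↦ ?_
  rw [card_doubleCosets_simplesFixing c.monotone_index d.monotone_index]
  simp only [Composition.card_fiber_index]
end
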